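/- arXiv:1609.01221 — 10 statements merged into one kernel-verified Lean document; each statement's English description precedes it below -/
import Mathlib

section
/- Let t ≥ 2 be an integer. Every 2-connected simple graph G that contains a path of length at least 4t² either contains θ_{1,2,t} or is a cycle (that is, G is connected and every vertex of G has degree exactly 2). -/
open SimpleGraph

/-- Two u-v walks are internally disjoint if they share no vertices other than `u` and `v`. -/
def InternallyDisjoint {V : Type} {G : SimpleGraph V} {u v : V} (P Q : G.Walk u v) : Prop :=
  ∀ x : V, x ∈ P.support → x ∈ Q.support → x = u ∨ x = v

/-- `G` contains `θ_{a,b,c}`: two distinct vertices joined by three pairwise internally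
disjoint paths of lengths at least `a`, `b`, `c`. -/
def ContainsTheta {V : Type} (G : SimpleGraph V) (a b c : ℕ) : Prop :=
  ∃ (u v : V), u ≠ v ∧ ∃ (P₁ P₂ P₃ : G.Walk u v),
    P₁.IsPath ∧ P₂.IsPath ∧ P₃.IsPath ∧
    a ≤ P₁.length ∧ b ≤ P₂.length ∧ c ≤ P₃.length ∧
    InternallyDisjoint P₁ P₂ ∧ InternallyDisjoint P₁ P₃ ∧ InternallyDisjoint P₂ P₃

/-- A finite simple graph is 2-connected if it is connected, has at least 3 vertices,
and deleting any single vertex leaves it connected. -/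
def TwoConnected {V : Type} [Fintype V] (G : SimpleGraph V) : Prop :=
  G.Connected ∧ 3 ≤ Fintype.card V ∧
    ∀ v : V, (G.induce ({v}ᶜ : Set V)).Connected

namespace SimpleGraph.Walk

variable {V : Type} {G : SimpleGraph V}

theorem IsPath.append_of_support {u v w : V} {p : G.Walk u v} {q : G.Walk v w} (hp : p.IsPath)
    (hq : q.IsPath) (h : ∀ x ∈ p.support, x ∈ q.support → x = v) : (p.append q).IsPath := by
  have hq' := hq.support_nodup
  rw [← cons_tail_support, List.nodup_cons] at hq'
  rw [isPath_def, support_append, List.nodup_append']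
  refine ⟨hp.support_nodup, hq'.2, fun x hx hx' ↦ ?_⟩
  obtain rfl := h x hx (List.mem_of_mem_tail hx')
  exact hq'.1 hx'

theorem mem_edges_of_length_eq_one {u v : V} {p : G.Walk u v} (h : p.length = 1) :
    s(u, v) ∈ p.edges := by
  cases p with
  | nil => simp at h
  | cons hadj p =>
    obtain rfl := eq_of_length_eq_zero (p := p) (by simpa using h)
    simp

/-- A walk ending in `T` splits at the first vertex where it meets `T`. -/
theorem exists_append_of_end_mem {T : Set V} {u v : V} (p : G.Walk u v) (hv : v ∈ T) :
    ∃ b ∈ T, ∃ (q : G.Walk u b) (r : G.Walk b v),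
      p = q.append r ∧ ∀ x ∈ q.support, x ∈ T → x = b := by
  induction p with
  | @nil u => exact ⟨u, hv, nil, nil, rfl, by simp⟩
  | @cons u w v h p ih =>
    by_cases hu : u ∈ T
    · exact ⟨u, hu, nil, cons h p, rfl, by simp⟩
    · obtain ⟨b, hb, q, r, rfl, hq⟩ := ih hv
      refine ⟨b, hb, cons h q, r, rfl, fun x hx hxT ↦ ?_⟩
      rw [support_cons, List.mem_cons] at hx
      rcases hx with rfl | hx
      · exact absurd hxT hu
      · exact hq x hx hxT

theorem exists_isPath_support_subset {S : Set V} {u a b : V} {p : G.Walk u a} {q : G.Walk u b}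
    (hp : ∀ x ∈ p.support, x ∈ S) (hq : ∀ x ∈ q.support, x ∈ S) :
    ∃ r : G.Walk a b, r.IsPath ∧ ∀ x ∈ r.support, x ∈ S := by
  classical
  refine ⟨(p.reverse.append q).bypass, bypass_isPath _, fun x hx ↦ ?_⟩
  have := support_bypass_subset_support _ hx
  rw [mem_support_append_iff, support_reverse, List.mem_reverse] at this
  exact this.elim (hp x) (hq x)

/-- If all subpaths of a path between consecutive vertices of `S` are short, then so is the path,
relative to the number of its vertices in `S`. -/
theorem IsPath.length_add_le_mul_card [DecidableEq V] {S : Finset V} {m : ℕ}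
    (hm : ∀ a ∈ S, ∀ b ∈ S, a ≠ b → ∀ q : G.Walk a b, q.IsPath →
      (∀ x ∈ q.support, x ∈ S → x = a ∨ x = b) → q.length ≤ m)
    (n : ℕ) {u v : V} (p : G.Walk u v) (hn : p.length ≤ n) (hp : p.IsPath) (hu : u ∈ S)
    (hv : v ∈ S) : p.length + m ≤ m * (S.filter (· ∈ p.support)).card := by
  induction n generalizing u with
  | zero =>
    have hc : 0 < (S.filter (· ∈ p.support)).card := Finset.card_pos.2 ⟨u, by simp [hu]⟩
    nlinarith
  | succ n ih =>
    cases p with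
    | nil =>
      have hc : 0 < (S.filter (· ∈ (Walk.nil : G.Walk v v).support)).card :=
        Finset.card_pos.2 ⟨v, by simp [hu]⟩
      simp only [length_nil]
      nlinarith
    | @cons _ w _ h p =>
      obtain ⟨b, hb, q, r, rfl, hq⟩ := exists_append_of_end_mem (T := (S : Set V)) p hv
      rw [cons_isPath_iff] at hp
      have huq : u ∉ q.support := fun hx ↦ hp.2 (by simp [hx])
      have hur : u ∉ r.support := fun hx ↦ hp.2 (by simp [hx])
      have hqm := hm u hu b hb (by rintro rfl; exact huq q.end_mem_support) (cons h q)
        (hp.1.of_append_left.cons huq) (by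
          intro x hx hxS
          rw [support_cons, List.mem_cons] at hx
          exact hx.imp_right fun hx ↦ hq x hx hxS)
      have hr := ih r (by simp at hn; omega) hp.1.of_append_right hb
      have hsub : insert u (S.filter (· ∈ r.support)) ⊆
          S.filter (· ∈ (cons h (q.append r)).support) := by
        intro x hx
        simp only [Finset.mem_insert, Finset.mem_filter] at hx
        rcases hx with rfl | hx
        · simp [hu]
        · simp [hx]
      have hc := Finset.card_le_card hsub
      rw [Finset.card_insert_of_notMem (by simp [hur])] at hc
      simp only [length_cons, length_append] at hqm ⊢
      nlinarith

end SimpleGraph.Walk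

section

variable {V : Type} {G : SimpleGraph V}

open Walk

theorem InternallyDisjoint.isCycle_append_reverse {u v : V} {P Q : G.Walk u v}
    (h : InternallyDisjoint P Q) (hP : P.IsPath) (hQ : Q.IsPath)
    (hl : 1 < P.length ∨ 1 < Q.length) : (P.append Q.reverse).IsCycle := by
  refine hP.isCycle_append hQ.reverse (fun x hx hx' ↦ ?_) (by simpa using hl)
  have hP' := hP.support_nodup
  have hQ' := hQ.reverse.support_nodup
  rw [← cons_tail_support, List.nodup_cons] at hP' hQ'
  have hxQ := List.mem_of_mem_tail hx'
  rw [support_reverse, List.mem_reverse] at hxQ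
  rcases h x (List.mem_of_mem_tail hx) hxQ with rfl | rfl
  · exact hP'.1 hx
  · exact hQ'.1 hx'

theorem exists_isPath_notMem_support {v x y : V}
    (h : (G.induce ({v}ᶜ : Set V)).Connected) (hx : x ≠ v) (hy : y ≠ v) :
    ∃ p : G.Walk x y, p.IsPath ∧ v ∉ p.support := by
  classical
  obtain ⟨p⟩ := h.preconnected ⟨x, hx⟩ ⟨y, hy⟩
  let q : G.Walk x y := p.map (Embedding.induce _).toHom
  have hq : q.support = p.support.map Subtype.val := Walk.support_map _ p
  refine ⟨q.bypass, bypass_isPath _, fun hv ↦ ?_⟩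
  have := support_bypass_subset_support _ hv
  rw [hq, List.mem_map] at this
  obtain ⟨z, -, hz⟩ := this
  exact z.2 hz

theorem exists_internallyDisjoint_isPath
    (hG : ∀ v : V, (G.induce ({v}ᶜ : Set V)).Connected) {x y : V} (p : G.Walk y x) (hxy : x ≠ y) :
    ∃ P Q : G.Walk x y, P.IsPath ∧ Q.IsPath ∧ InternallyDisjoint P Q := by
  classical
  induction p with
  | nil => exact absurd rfl hxy
  | @cons y w x h p ih =>
    by_cases hxw : x = w
    · subst hxw
      refine ⟨h.symm.toWalk, h.symm.toWalk, h.symm.isPath_toWalk, h.symm.isPath_toWalk, ?_⟩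
      intro z hz _
      simpa using hz
    obtain ⟨P, Q, hP, hQ, hPQ⟩ := ih hxw
    obtain ⟨R₀, hR₀, hwR₀⟩ := exists_isPath_notMem_support (hG w) h.ne hxw
    obtain ⟨z, hz, R, R', rfl, hRz⟩ := R₀.exists_append_of_end_mem
      (T := {z | z ∈ P.support ∨ z ∈ Q.support}) (Or.inl P.start_mem_support)
    have hwR : w ∉ R.support := fun hw ↦ hwR₀ (by simp [hw])
    have hR := hR₀.of_append_left
    clear hR₀ hwR₀ R'
    wlog hzP : z ∈ P.support generalizing P Q
    · have hz' := hz.resolve_left hzP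
      exact this Q P hQ hP (fun a ha hb ↦ hPQ a hb ha) hz.symm
        (fun a ha hb ↦ hRz a ha hb.symm) hz'
    have hzw : z ≠ w := by rintro rfl; exact hwR R.end_mem_support
    have hwP : w ∉ (P.takeUntil z hzP).support :=
      endpoint_notMem_support_takeUntil hP hzP hzw.symm
    have hsub := P.support_takeUntil_subset_support hzP
    refine ⟨(P.takeUntil z hzP).append R.reverse, Q.concat h.symm, ?_, ?_, ?_⟩
    · refine (hP.takeUntil hzP).append_of_support hR.reverse fun a ha ha' ↦ ?_
      exact hRz a (by simpa using ha') (Or.inl (hsub ha))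
    · refine hQ.concat (fun hy ↦ ?_) _
      obtain rfl := hRz y R.start_mem_support (Or.inr hy)
      exact (hPQ y hzP hy).elim hxy.symm h.ne
    · intro a ha ha'
      rw [support_concat, List.mem_append, List.mem_singleton] at ha'
      rw [mem_support_append_iff, support_reverse, List.mem_reverse] at ha
      rcases ha' with haQ | rfl
      · left
        rcases ha with ha | ha
        · refine (hPQ a (hsub ha) haQ).resolve_right ?_
          rintro rfl
          exact hwP ha
        · obtain rfl := hRz a ha (Or.inr haQ)
          exact (hPQ a hzP haQ).resolve_right hzw
      · exact Or.inr rfl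

/-- A 2-connected graph with a long path has a long cycle. -/
theorem exists_isCycle_of_isPath
    (hG : ∀ v : V, (G.induce ({v}ᶜ : Set V)).Connected) {t : ℕ} (ht : 2 ≤ t) {u v : V}
    {P : G.Walk u v} (hP : P.IsPath) (hl : 4 * t ^ 2 ≤ P.length) :
    ∃ (a : V) (C : G.Walk a a), C.IsCycle ∧ 2 * t ≤ C.length := by
  classical
  have huv : u ≠ v := by
    rintro rfl
    have := length_eq_zero_iff.2 (isPath_iff_nil.1 hP)
    nlinarith
  obtain ⟨A, B, hA, hB, hAB⟩ := exists_internallyDisjoint_isPath hG P.reverse huv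
  by_contra! hC
  have hlt : A.length + B.length < 2 * t := by
    by_contra! hlt
    have := hC _ _ (hAB.isCycle_append_reverse hA hB (by omega))
    simp at this
    omega
  set S : Finset V := A.support.toFinset ∪ B.support.toFinset with hS
  have hcard : S.card ≤ 2 * t + 1 := by
    have h1 := A.support.toFinset_card_le
    have h2 := B.support.toFinset_card_le
    have h3 := Finset.card_union_le A.support.toFinset B.support.toFinset
    rw [length_support] at h1 h2
    rw [hS]
    omega
  have hconn : ∀ a ∈ S, ∃ p : G.Walk u a, ∀ x ∈ p.support, x ∈ (S : Set V) := by
    intro a ha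
    rw [hS, Finset.mem_union, List.mem_toFinset, List.mem_toFinset] at ha
    rcases ha with ha | ha
    · exact ⟨A.takeUntil a ha, fun x hx ↦ by
        simp [hS, A.support_takeUntil_subset_support ha hx]⟩
    · exact ⟨B.takeUntil a ha, fun x hx ↦ by
        simp [hS, B.support_takeUntil_subset_support ha hx]⟩
  have hears : ∀ a ∈ S, ∀ b ∈ S, a ≠ b → ∀ q : G.Walk a b, q.IsPath →
      (∀ x ∈ q.support, x ∈ S → x = a ∨ x = b) → q.length ≤ 2 * t - 1 := by
    intro a ha b hb hab q hq hqS
    obtain ⟨p, hp⟩ := hconn a ha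
    obtain ⟨p', hp'⟩ := hconn b hb
    obtain ⟨r, hr, hrS⟩ := exists_isPath_support_subset hp hp'
    by_contra! hql
    have := hC _ _ (InternallyDisjoint.isCycle_append_reverse
      (fun x hx hx' ↦ hqS x hx (hrS x hx')) hq hr (by omega))
    simp at this
    omega
  have := hP.length_add_le_mul_card hears _ P le_rfl (by simp [hS]) (by simp [hS])
  have hc := (Finset.card_filter_le S (· ∈ P.support)).trans hcard
  obtain ⟨s, rfl⟩ : ∃ s, t = s + 1 := ⟨t - 1, by omega⟩
  have h2 : 2 * (s + 1) - 1 = 2 * s + 1 := by omega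
  rw [h2] at this
  have := Nat.mul_le_mul_left (2 * s + 1) hc
  nlinarith

theorem containsTheta_of_isCycle (hG : ∀ v : V, (G.induce ({v}ᶜ : Set V)).Connected)
    {t : ℕ} {v w : V} {C : G.Walk v v} (hC : C.IsCycle) (hl : 2 * t ≤ C.length)
    (hvw : G.Adj v w) (hedge : s(v, w) ∉ C.edges) : ContainsTheta G 1 2 t := by
  classical
  have hsnd : C.snd ≠ v := (C.adj_snd hC.not_nil).ne'
  obtain ⟨R, hR, hvR⟩ := exists_isPath_notMem_support (hG v) hvw.ne' hsnd
  obtain ⟨b, hb, R, R', rfl, hRb⟩ := R.exists_append_of_end_mem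
      (T := {z | z ∈ C.support}) (C.getVert_mem_support 1)
  have hvR : v ∉ R.support := fun hw ↦ hvR (by simp [hw])
  have hR := hR.of_append_left
  have hvb : v ≠ b := by rintro rfl; exact hvR R.end_mem_support
  let Q := cons hvw R
  have hQ : Q.IsPath := hR.cons hvR
  have hQC : ∀ x ∈ Q.support, x ∈ C.support → x = v ∨ x = b := by
    intro x hx hxC
    rw [support_cons, List.mem_cons] at hx
    exact hx.imp_right fun hx ↦ hRb x hx hxC
  have hQ1 : 1 ≤ Q.length := by simp [Q]
  have hQe : Q.length = 1 → s(v, b) ∉ C.edges := by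
    intro h
    have : w = b := eq_of_length_eq_zero (p := R) (by simpa [Q] using h)
    rwa [← this]
  clear_value Q
  obtain ⟨A, B, rfl⟩ := mem_support_iff_exists_append.1 hb
  have hA : A.IsPath := hC.isPath_of_append_left (not_nil_of_ne hvb.symm)
  have hB : B.reverse.IsPath := (hC.isPath_of_append_right (not_nil_of_ne hvb)).reverse
  have hAB : InternallyDisjoint A B.reverse := by
    intro x hxA hxB
    rw [support_reverse, List.mem_reverse] at hxB
    have := hC.support_nodup
    rw [tail_support_append, List.nodup_append'] at this
    rw [mem_support_iff] at hxA hxB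
    have := @this.2.2 x
    tauto
  have hQA : InternallyDisjoint Q A := fun x hx hx' ↦ hQC x hx (by simp [hx'])
  have hQB : InternallyDisjoint Q B.reverse := fun x hx hx' ↦ hQC x hx (by simp at hx'; simp [hx'])
  have hlen : 2 * t ≤ A.length + B.reverse.length := by simpa using hl
  have hAe : Q.length = 1 → A.length ≠ 1 := by
    intro h h'
    exact hQe h (by simp [mem_edges_of_length_eq_one h'])
  have hBe : Q.length = 1 → B.reverse.length ≠ 1 := by
    intro h h'
    have := mem_edges_of_length_eq_one h'
    rw [edges_reverse, List.mem_reverse] at this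
    exact hQe h (by simp [this])
  have hA1 : A.length ≠ 0 := fun h ↦ hvb (eq_of_length_eq_zero h)
  have hB1 : B.reverse.length ≠ 0 := fun h ↦ hvb (eq_of_length_eq_zero h)
  have hsymm : ∀ {P P' : G.Walk v b}, InternallyDisjoint P P' → InternallyDisjoint P' P :=
    fun h x hx hx' ↦ h x hx' hx
  generalize B.reverse = B' at *
  rcases eq_or_ne Q.length 1 with h1 | h1
  · rcases le_total B'.length A.length with h | h
    · exact ⟨v, b, hvb, Q, B', A, hQ, hB, hA, by omega, by have := hBe h1; omega, by omega, hQB, hQA,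
        hsymm hAB⟩
    · exact ⟨v, b, hvb, Q, A, B', hQ, hA, hB, by omega, by have := hAe h1; omega, by omega, hQA, hQB,
        hAB⟩
  · rcases le_total B'.length A.length with h | h
    · exact ⟨v, b, hvb, B', Q, A, hB, hQ, hA, by omega, by omega, by omega, hsymm hQB, hsymm hAB,
        hQA⟩
    · exact ⟨v, b, hvb, A, Q, B', hA, hQ, hB, by omega, by omega, by omega, hsymm hQA, hAB, hQB⟩

theorem SimpleGraph.Walk.IsCycle.degree_eq_two [Fintype V] [DecidableRel G.Adj]
    (hconn : G.Connected) {a : V} {C : G.Walk a a} (hC : C.IsCycle)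
    (h : ∀ v w, v ∈ C.support → G.Adj v w → s(v, w) ∈ C.edges) (v : V) : G.degree v = 2 := by
  have hv : v ∈ C.support := by
    by_contra hv
    obtain ⟨p⟩ := hconn.preconnected a v
    obtain ⟨d, -, hd, hd'⟩ := p.exists_boundary_dart {x | x ∈ C.support} C.start_mem_support hv
    exact hd' (C.snd_mem_support_of_mem_edges (h _ _ hd d.adj))
  have : C.toSubgraph.neighborSet v = G.neighborSet v := by
    ext w
    exact ⟨fun hw ↦ C.toSubgraph.adj_sub hw, fun hw ↦ adj_toSubgraph_iff_mem_edges.2 (h v w hv hw)⟩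
  rw [← hC.ncard_neighborSet_toSubgraph_eq_two hv, this, ← Nat.card_coe_set_eq,
    Nat.card_eq_fintype_card, card_neighborSet_eq_degree]

end

theorem stmt_0 {V : Type} [Fintype V] [DecidableEq V] (G : SimpleGraph V) [DecidableRel G.Adj]
    (t : ℕ) (ht : 2 ≤ t) (h2c : TwoConnected G)
    (hpath : ∃ (u v : V) (P : G.Walk u v), P.IsPath ∧ 4 * t ^ 2 ≤ P.length) :
    ContainsTheta G 1 2 t ∨ (G.Connected ∧ ∀ v : V, G.degree v = 2) := by
  obtain ⟨hconn, -, hG⟩ := h2c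
  obtain ⟨u, v, P, hP, hl⟩ := hpath
  obtain ⟨a, C, hC, hCl⟩ := exists_isCycle_of_isPath hG ht hP hl
  by_cases h : ∀ v w, v ∈ C.support → G.Adj v w → s(v, w) ∈ C.edges
  · exact Or.inr ⟨hconn, hC.degree_eq_two hconn h⟩
  · push Not at h
    obtain ⟨v, w, hv, hvw, hedge⟩ := h
    refine Or.inl (containsTheta_of_isCycle hG (hC.rotate hv) (by simpa using hCl) hvw ?_)
    rwa [(C.rotate_edges v hv).perm.mem_iff]
end

section
/- Let t ≥ 2 be an integer. Every 2-connected simple graph G that contains a path of length at least 4t² either contains θ_{2,2,t} or has a Hamiltonian cycle C such that no two chords of C cross, i.e., there do not exist four distinct vertices u, x, v, y occurring in this cyclic order along C with uv ∈ E(G) and xy ∈ E(G). -/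
open SimpleGraph

/-- Two chords of the cycle `C` cross: four distinct vertices occur in this cyclic order
along `C` (witnessed by increasing positions along the closed walk), the first and third
are adjacent in `G`, and so are the second and fourth. -/
def HasCrossingChords {V : Type} (G : SimpleGraph V) {r : V} (C : G.Walk r r) : Prop :=
  ∃ i₁ i₂ i₃ i₄ : ℕ, i₁ < i₂ ∧ i₂ < i₃ ∧ i₃ < i₄ ∧ i₄ < C.length ∧
    C.getVert i₁ ≠ C.getVert i₂ ∧ C.getVert i₁ ≠ C.getVert i₃ ∧
    C.getVert i₁ ≠ C.getVert i₄ ∧ C.getVert i₂ ≠ C.getVert i₃ ∧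
    C.getVert i₂ ≠ C.getVert i₄ ∧ C.getVert i₃ ≠ C.getVert i₄ ∧
    G.Adj (C.getVert i₁) (C.getVert i₃) ∧ G.Adj (C.getVert i₂) (C.getVert i₄)

namespace SimpleGraph.Walk

variable {V : Type} {G : SimpleGraph V}

lemma _root_.InternallyDisjoint.symm {u v : V} {P Q : G.Walk u v} (h : InternallyDisjoint P Q) :
    InternallyDisjoint Q P :=
  fun x hQ hP => h x hP hQ

/-- A walk ending in `S` splits at its first vertex in `S`. -/
lemma exists_append_first_mem (S : Set V) {u v : V} (P : G.Walk u v) (hv : v ∈ S) :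
    ∃ z ∈ S, ∃ (E : G.Walk u z) (P' : G.Walk z v), P = E.append P' ∧
      ∀ w ∈ E.support, w ∈ S → w = z := by
  induction P with
  | nil => exact ⟨_, hv, nil, nil, rfl, by simp⟩
  | @cons a b c h p ih =>
    by_cases ha : a ∈ S
    · exact ⟨a, ha, nil, cons h p, rfl, by simp⟩
    · obtain ⟨z, hz, E, P', rfl, hE⟩ := ih hv
      refine ⟨z, hz, cons h E, P', rfl, ?_⟩
      intro w hw hwS
      rw [support_cons, List.mem_cons] at hw
      grind

/-- A path between two vertices of `S` is short if each of its segments that meets `S`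
only in its ends is short and `S` has few vertices on the path. -/
lemma IsPath.length_le_mul_countP (S : Set V) [DecidablePred (· ∈ S)] (k : ℕ)
    (hS : ∀ ⦃w z : V⦄ (E : G.Walk w z), w ∈ S → z ∈ S → w ≠ z → E.IsPath →
      (∀ x ∈ E.support, x ∈ S → x = w ∨ x = z) → E.length ≤ k)
    {u v : V} (P : G.Walk u v) (hP : P.IsPath) (hu : u ∈ S) (hv : v ∈ S) :
    P.length ≤ k * P.support.tail.countP (· ∈ S) := by
  induction hn : P.length using Nat.strong_induction_on generalizing u with
  | _ n ih =>
    subst hn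
    cases P with
    | nil => simp
    | @cons _ b _ h p =>
      obtain ⟨z, hz, E, P', rfl, hE⟩ := exists_append_first_mem S p hv
      rw [← cons_append] at hP
      have hPE := hP.of_append_left
      have hP' := hP.of_append_right
      have hlt : P'.length < (cons h (E.append P')).length := by
        simp only [length_cons, length_append]; omega
      have key := ih _ hlt P' hP' hz rfl
      have huz : u ≠ z := by
        rintro rfl
        exact (cons_isPath_iff _ _).1 hPE |>.2 E.end_mem_support
      have hlen := hS (cons h E) hu hz huz hPE (by
        intro x hx hxS
        rw [support_cons, List.mem_cons] at hx
        grind)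
      have hcount : 1 ≤ E.support.countP (· ∈ S) :=
        List.countP_pos_iff.2 ⟨z, E.end_mem_support, by simpa using hz⟩
      rw [support_cons, List.tail_cons, support_append, List.countP_append]
      simp only [length_cons, length_append] at hlen ⊢
      nlinarith

lemma IsCycle.append_comm {u v : V} {P : G.Walk u v} {Q : G.Walk v u}
    (h : (P.append Q).IsCycle) : (Q.append P).IsCycle := by
  have hl := h.three_le_length
  rw [isCycle_def, isTrail_def] at h ⊢
  refine ⟨?_, ?_, ?_⟩
  · rw [edges_append] at h ⊢
    exact List.nodup_append_comm.1 h.1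
  · intro h0
    have := congrArg length h0
    simp only [length_append, length_nil] at hl this
    omega
  · rw [tail_support_append] at h ⊢
    exact List.nodup_append_comm.1 h.2.2

/-- Two vertices of a cycle split it into two internally disjoint paths. -/
lemma IsCycle.exists_isPath_pair [DecidableEq V] {r : V} {C : G.Walk r r} (hC : C.IsCycle)
    {w z : V} (hw : w ∈ C.support) (hz : z ∈ C.support) (hwz : w ≠ z) :
    ∃ P Q : G.Walk w z, P.IsPath ∧ Q.IsPath ∧ InternallyDisjoint P Q ∧
      P.length + Q.length = C.length ∧
      ∀ x, x ∈ C.support ↔ x ∈ P.support ∨ x ∈ Q.support := by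
  have hz' : z ∈ (C.rotate w hw).support := by simpa using hz
  have hspec := take_spec _ hz'
  have hcyc : ((C.rotate w hw).takeUntil z hz' |>.append
      ((C.rotate w hw).dropUntil z hz')).IsCycle := by
    rw [hspec]; exact hC.rotate hw
  have hlen : C.length = (C.rotate w hw).length := by simp
  have hsupp : ∀ x, x ∈ C.support ↔ x ∈ (C.rotate w hw).support := by simp
  rw [← hspec] at hlen hsupp
  generalize (C.rotate w hw).takeUntil z hz' = P at *
  generalize (C.rotate w hw).dropUntil z hz' = Q at *
  have hPn : ¬ P.Nil := fun h => hwz h.eq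
  have hQn : ¬ Q.Nil := fun h => hwz h.eq.symm
  refine ⟨P, Q.reverse, hcyc.isPath_of_append_left hQn,
    (hcyc.isPath_of_append_right hPn).reverse, ?_, ?_, ?_⟩
  · intro x hxP hxQ
    have hnd := hcyc.support_nodup
    rw [tail_support_append, List.nodup_append'] at hnd
    rw [support_reverse, List.mem_reverse, mem_support_iff] at hxQ
    rw [mem_support_iff] at hxP
    have := @hnd.2.2 x
    tauto
  · simp [hlen]
  · simpa [mem_support_append_iff] using hsupp

/-- Two internally disjoint paths, one of which is not a single edge, form a cycle. -/
lemma IsPath.isCycle_append_reverse {u v : V} {P Q : G.Walk u v} (hP : P.IsPath)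
    (hQ : Q.IsPath) (hPQ : InternallyDisjoint P Q) (hl : 2 ≤ P.length) :
    (P.append Q.reverse).IsCycle := by
  refine hP.isCycle_append hQ.reverse ?_ (Or.inl hl)
  intro x hx hx'
  have h₁ : x ∈ P.support := List.mem_of_mem_tail hx
  have h₂ : x ∈ Q.support := by simpa using List.mem_of_mem_tail hx'
  rcases hPQ x h₁ h₂ with rfl | rfl
  · have := hP.support_nodup
    rw [← cons_tail_support, List.nodup_cons] at this
    exact this.1 hx
  · have := hQ.reverse.support_nodup
    rw [← cons_tail_support, List.nodup_cons] at this
    exact this.1 hx'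

/-- Four segments of a cycle, the first of length at least `t`, whose opposite ends are
adjacent, yield a theta. -/
lemma IsCycle.containsTheta_of_adj {u x v y : V} {A : G.Walk u x} {B : G.Walk x v}
    {C : G.Walk v y} {D : G.Walk y u} (h : (A.append (B.append (C.append D))).IsCycle)
    (hux : u ≠ x) (huy : u ≠ y) (hxv : x ≠ v) (hxy : x ≠ y) (hvy : v ≠ y)
    (hadj : G.Adj u v) (hadj' : G.Adj x y) {t : ℕ} (ht : t ≤ A.length) :
    ContainsTheta G 2 2 t := by
  have hnd := h.support_nodup
  simp only [tail_support_append] at hnd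
  have hx := A.end_mem_tail_support (fun h => hux h.eq)
  have hv := B.end_mem_tail_support (fun h => hxv h.eq)
  have hy := C.end_mem_tail_support (fun h => hvy h.eq)
  have hu := D.end_mem_tail_support (fun h => huy h.eq.symm)
  have hA := A.cons_tail_support
  have hB := B.cons_tail_support
  have hD := D.cons_tail_support
  have hBl : 1 ≤ B.length := by
    by_contra! h0
    exact hxv (eq_of_length_eq_zero (p := B) (by omega))
  have hDl : 1 ≤ D.length := by
    by_contra! h0
    exact huy (eq_of_length_eq_zero (p := D) (by omega)).symm
  simp only [List.nodup_append'] at hnd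
  obtain ⟨hAn, ⟨hBn, ⟨-, hDn, hCD⟩, hBCD⟩, hABCD⟩ := hnd
  simp only [List.disjoint_left, List.mem_append] at hCD hBCD hABCD
  refine ⟨u, x, hux, cons hadj B.reverse, D.reverse.concat hadj'.symm, A, ?_, ?_, ?_, ?_, ?_,
    ht, ?_, ?_, ?_⟩
  · rw [cons_isPath_iff, isPath_reverse_iff, isPath_def, support_reverse, List.mem_reverse,
      ← hB, List.nodup_cons, List.mem_cons]
    grind
  · rw [concat_isPath_iff, isPath_reverse_iff, isPath_def, support_reverse, List.mem_reverse,
      ← hD, List.nodup_cons, List.mem_cons]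
    grind
  · rw [isPath_def, ← hA, List.nodup_cons]
    grind
  · simp; omega
  · simp; omega
  all_goals
    intro p hp hq
    simp only [support_cons, support_concat, support_reverse, List.mem_cons, List.mem_reverse,
      List.mem_append, List.not_mem_nil, or_false] at hp hq
    simp only [mem_support_iff] at hp hq
    grind

lemma exists_drop_eq_append {u v : V} (p : G.Walk u v) {i j : ℕ} (h : i ≤ j) :
    ∃ B : G.Walk (p.getVert i) (p.getVert j), p.drop i = B.append (p.drop j) := by
  obtain ⟨k, rfl⟩ := Nat.exists_eq_add_of_le h
  refine ⟨((p.drop i).take k).copy rfl (drop_getVert ..), ?_⟩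
  rw [drop_add_eq, append_copy_copy, append_take_drop_eq, copy_rfl_rfl]

/-- A long cycle with crossing chords yields a theta. -/
lemma IsCycle.containsTheta_of_hasCrossingChords {r : V} {C : G.Walk r r} (hC : C.IsCycle)
    (hcross : HasCrossingChords G C) {t : ℕ} (ht : 4 * t ≤ C.length + 3) :
    ContainsTheta G 2 2 t := by
  obtain ⟨i₁, i₂, i₃, i₄, h₁₂, h₂₃, h₃₄, -, n₁₂, n₁₃, n₁₄, n₂₃, n₂₄, n₃₄, a₁₃, a₂₄⟩ := hcross
  obtain ⟨P, hP⟩ := C.exists_drop_eq_append h₁₂.le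
  obtain ⟨Q, hQ⟩ := C.exists_drop_eq_append h₂₃.le
  obtain ⟨R, hR⟩ := C.exists_drop_eq_append h₃₄.le
  have hCeq := C.append_take_drop_eq i₁
  rw [hP, hQ, hR] at hCeq
  rw [← hCeq] at hC ht
  have hC₁ := hC.append_comm
  simp only [← append_assoc] at hC₁
  simp only [length_append] at ht
  generalize hS : (C.drop i₄).append (C.take i₁) = S at hC₁
  have hSl : S.length = (C.drop i₄).length + (C.take i₁).length := by
    rw [← hS, length_append]
  have hC₂ := hC₁.append_comm
  simp only [← append_assoc] at hC₂
  have hC₃ := hC₂.append_comm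
  simp only [← append_assoc] at hC₃
  have hC₄ := hC₃.append_comm
  simp only [← append_assoc] at hC₄
  by_cases t₁ : t ≤ P.length
  · exact hC₁.containsTheta_of_adj n₁₂ n₁₄ n₂₃ n₂₄ n₃₄ a₁₃ a₂₄ t₁
  by_cases t₂ : t ≤ Q.length
  · exact hC₂.containsTheta_of_adj n₂₃ n₁₂.symm n₃₄ n₁₃.symm n₁₄.symm a₂₄ a₁₃.symm t₂
  by_cases t₃ : t ≤ R.length
  · exact hC₃.containsTheta_of_adj n₃₄ n₂₃.symm n₁₄.symm n₂₄.symm n₁₂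
      a₁₃.symm a₂₄.symm t₃
  · exact hC₄.containsTheta_of_adj n₁₄.symm n₃₄.symm n₁₂ n₁₃ n₂₃ a₂₄.symm a₁₃
      (by omega)

end SimpleGraph.Walk

namespace TwoConnected

open SimpleGraph Walk

variable {V : Type} [Fintype V] [DecidableEq V] {G : SimpleGraph V}

lemma exists_isPath_notMem_support (h2c : TwoConnected G) {a b c : V} (ha : a ≠ c)
    (hb : b ≠ c) : ∃ P : G.Walk a b, P.IsPath ∧ c ∉ P.support := by
  have ha' : a ∈ ({c}ᶜ : Set V) := ha
  have hb' : b ∈ ({c}ᶜ : Set V) := hb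
  obtain ⟨W⟩ := (h2c.2.2 c).preconnected ⟨a, ha'⟩ ⟨b, hb'⟩
  have hW : c ∉ (W.map (Embedding.induce ({c}ᶜ : Set V)).toHom).support := by
    rw [Walk.support_map, List.mem_map]
    rintro ⟨⟨x, hx⟩, -, hxc⟩
    exact hx hxc
  exact ⟨_, bypass_isPath _, fun h => hW (support_bypass_subset_support _ h)⟩

lemma exists_isCycle_of_adj (h2c : TwoConnected G) {x y : V} (hxy : G.Adj x y) :
    ∃ (r : V) (C : G.Walk r r), C.IsCycle ∧ x ∈ C.support ∧ y ∈ C.support := by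
  obtain ⟨w, hw⟩ : ∃ w, w ∉ ({x, y} : Finset V) := by
    by_contra! h
    have := Finset.card_le_card (fun a _ => h a : (Finset.univ : Finset V) ⊆ {x, y})
    have := Finset.card_le_two (a := x) (b := y)
    have := h2c.2.1
    rw [Finset.card_univ] at *
    omega
  simp only [Finset.mem_insert, Finset.mem_singleton, not_or] at hw
  obtain ⟨P, -, hP⟩ := h2c.exists_isPath_notMem_support hxy.ne.symm hw.1
  obtain ⟨Q, -, hQ⟩ := h2c.exists_isPath_notMem_support hw.2 hxy.ne
  refine ⟨x, cons hxy (P.append Q).bypass, ?_, by simp, by simp⟩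
  rw [cons_isCycle_iff]
  refine ⟨bypass_isPath _, fun h => ?_⟩
  have := edges_bypass_subset_edges _ h
  rw [edges_append, List.mem_append] at this
  rcases this with h | h
  · exact hP (fst_mem_support_of_mem_edges _ h)
  · exact hQ (snd_mem_support_of_mem_edges _ h)

/-- An edge from `w ∈ S` out of `S` extends to a path with distinct ends in `S` and no other vertex
in `S`. -/
lemma exists_isPath_of_adj (h2c : TwoConnected G) {S : Set V} {w y s : V}
    (hy : y ∉ S) (hs : s ∈ S) (hsw : s ≠ w) (hwy : G.Adj w y) :
    ∃ z ∈ S, w ≠ z ∧ ∃ E : G.Walk w z, E.IsPath ∧ 2 ≤ E.length ∧ y ∈ E.support ∧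
      ∀ x ∈ E.support, x ∈ S → x = w ∨ x = z := by
  obtain ⟨P, hP, hwP⟩ := h2c.exists_isPath_notMem_support hwy.ne.symm hsw
  obtain ⟨z, hz, E, P', rfl, hE⟩ := exists_append_first_mem S P hs
  rw [mem_support_append_iff, not_or] at hwP
  have hyz : y ≠ z := fun h => hy (h ▸ hz)
  refine ⟨z, hz, fun h => hwP.1 (h ▸ E.end_mem_support), cons hwy E,
    (cons_isPath_iff _ _).2 ⟨hP.of_append_left, hwP.1⟩, ?_, by simp, ?_⟩
  · have : E.length ≠ 0 := fun h => hyz (eq_of_length_eq_zero h)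
    rw [length_cons]
    omega
  · intro x hx hxS
    rw [support_cons, List.mem_cons] at hx
    grind

/-- Any two vertices lie on a common cycle. -/
lemma exists_isCycle (h2c : TwoConnected G) {x y : V} (hxy : x ≠ y) :
    ∃ (r : V) (C : G.Walk r r), C.IsCycle ∧ x ∈ C.support ∧ y ∈ C.support := by
  obtain ⟨W⟩ := h2c.1.preconnected y x
  induction W with
  | nil => exact absurd rfl hxy
  | @cons y w x hyw _ ih =>
    by_cases hxw : x = w
    · subst hxw
      exact h2c.exists_isCycle_of_adj hyw.symm
    obtain ⟨r, C, hC, hxC, hwC⟩ := ih hxw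
    by_cases hyC : y ∈ C.support
    · exact ⟨r, C, hC, hxC, hyC⟩
    obtain ⟨z, hz, hwz, E, hE, hEl, hyE, hES⟩ := h2c.exists_isPath_of_adj
      (S := {a | a ∈ C.support}) hyC hxC hxw hyw.symm
    obtain ⟨P, Q, hP, hQ, -, -, hPQ⟩ := hC.exists_isPath_pair hwC hz hwz
    rcases (hPQ x).1 hxC with hx | hx
    · exact ⟨w, _, hE.isCycle_append_reverse hP
        (fun a h₁ h₂ => hES a h₁ ((hPQ a).2 (Or.inl h₂))) hEl, by simp [hx], by simp [hyE]⟩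
    · exact ⟨w, _, hE.isCycle_append_reverse hQ
        (fun a h₁ h₂ => hES a h₁ ((hPQ a).2 (Or.inr h₂))) hEl, by simp [hx], by simp [hyE]⟩

/-- A path of length at least `4 * t ^ 2` forces a cycle of length at least `2 * t`. -/
lemma exists_isCycle_two_mul_le_length (h2c : TwoConnected G) {t : ℕ} (ht : 2 ≤ t) {u v : V}
    {P : G.Walk u v} (hP : P.IsPath) (hl : 4 * t ^ 2 ≤ P.length) :
    ∃ (r : V) (C : G.Walk r r), C.IsCycle ∧ 2 * t ≤ C.length := by
  have huv : u ≠ v := by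
    rintro rfl
    rw [isPath_iff_nil, ← length_eq_zero_iff] at hP
    nlinarith
  obtain ⟨r, C, hC, huC, hvC⟩ := h2c.exists_isCycle huv
  by_contra! hshort
  have hbound := hP.length_le_mul_countP {a | a ∈ C.support} (2 * t - 1) (by
    intro w z E hw hz hwz hE hES
    by_contra! hlong
    obtain ⟨A, B, hA, -, -, -, hAB⟩ := hC.exists_isPath_pair hw hz hwz
    have := hshort _ _ (hE.isCycle_append_reverse hA
      (fun a h₁ h₂ => hES a h₁ ((hAB a).2 (Or.inl h₂))) (by omega))
    rw [length_append] at this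
    omega) P huC hvC
  have hcount : P.support.tail.countP (· ∈ {a | a ∈ C.support}) ≤ C.length := by
    rw [List.countP_eq_length_filter]
    have hnd : (P.support.tail.filter (· ∈ {a | a ∈ C.support})).Nodup :=
      hP.support_nodup.tail.filter _
    have hsub : P.support.tail.filter (· ∈ {a | a ∈ C.support}) ⊆ C.support.tail := by
      intro a ha
      have haC : a ∈ C.support := by simpa using (List.mem_filter.1 ha).2
      rw [mem_support_iff] at haC
      rcases haC with rfl | haC
      · exact C.end_mem_tail_support hC.not_nil
      · exact haC
    simpa using (hnd.subperm hsub).length_le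
  have hCl := hshort _ C hC
  obtain ⟨m, rfl⟩ : ∃ m, t = m + 1 := ⟨t - 1, by omega⟩
  have h1 : 2 * (m + 1) - 1 = 2 * m + 1 := by omega
  rw [h1] at hbound
  have h2 := Nat.mul_le_mul_left (2 * m + 1) (hcount.trans (by omega : C.length ≤ 2 * m + 1))
  nlinarith

/-- A longest cycle of length at least `2 * t` that misses a vertex yields a theta. -/
lemma containsTheta_of_notMem_support (h2c : TwoConnected G) {t : ℕ} {r : V} {C : G.Walk r r}
    (hC : C.IsCycle) (hmax : ∀ (s : V) (D : G.Walk s s), D.IsCycle → D.length ≤ C.length)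
    (hl : 2 * t ≤ C.length + 1) {v : V} (hv : v ∉ C.support) : ContainsTheta G 2 2 t := by
  obtain ⟨W⟩ := h2c.1.preconnected r v
  obtain ⟨d, -, hd₁, hd₂⟩ := W.exists_boundary_dart {a | a ∈ C.support} C.start_mem_support hv
  obtain ⟨s, hs, hsd⟩ : ∃ s ∈ C.support, s ≠ d.fst := by
    by_cases h : r = d.fst
    · exact ⟨C.snd, C.getVert_mem_support 1, h ▸ (C.adj_snd hC.not_nil).ne.symm⟩
    · exact ⟨r, C.start_mem_support, h⟩
  obtain ⟨z, hz, hwz, E, hE, hEl, -, hES⟩ :=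
    h2c.exists_isPath_of_adj (S := {a | a ∈ C.support}) hd₂ hs hsd d.adj
  obtain ⟨P, Q, hP, hQ, hPQ, hlen, hsupp⟩ := hC.exists_isPath_pair hd₁ hz hwz
  have hEP : InternallyDisjoint E P := fun a h₁ h₂ => hES a h₁ ((hsupp a).2 (Or.inl h₂))
  have hEQ : InternallyDisjoint E Q := fun a h₁ h₂ => hES a h₁ ((hsupp a).2 (Or.inr h₂))
  have h₁ := hmax _ _ (hE.isCycle_append_reverse hP hEP hEl)
  have h₂ := hmax _ _ (hE.isCycle_append_reverse hQ hEQ hEl)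
  rw [length_append, length_reverse] at h₁ h₂
  by_cases hPt : t ≤ P.length
  · exact ⟨_, _, hwz, E, Q, P, hE, hQ, hP, hEl, by omega, hPt, hEQ, hEP, hPQ.symm⟩
  · exact ⟨_, _, hwz, E, P, Q, hE, hP, hQ, hEl, by omega, by omega, hEP, hEQ, hPQ⟩

end TwoConnected

theorem stmt_1 {V : Type} [Fintype V] [DecidableEq V] (G : SimpleGraph V) [DecidableRel G.Adj]
    (t : ℕ) (ht : 2 ≤ t) (h2c : TwoConnected G)
    (hpath : ∃ (u v : V) (P : G.Walk u v), P.IsPath ∧ 4 * t ^ 2 ≤ P.length) :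
    ContainsTheta G 2 2 t ∨
      ∃ (r : V) (C : G.Walk r r), C.IsCycle ∧ (∀ v : V, v ∈ C.support) ∧
        ¬ HasCrossingChords G C := by
  obtain ⟨u, v, P, hP, hPl⟩ := hpath
  obtain ⟨r₀, C₀, hC₀, hl₀⟩ := h2c.exists_isCycle_two_mul_le_length ht hP hPl
  have hbdd : ∀ (s : V) (D : G.Walk s s), D.IsCycle → D.length ≤ Fintype.card V := by
    intro s D hD
    simpa using hD.support_nodup.length_le_card
  classical
  let p : ℕ → Prop := fun n => ∃ (s : V) (D : G.Walk s s), D.IsCycle ∧ D.length = n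
  have hp₀ : p C₀.length := ⟨r₀, C₀, hC₀, rfl⟩
  obtain ⟨r, C, hC, hCl⟩ := Nat.findGreatest_spec (hbdd _ C₀ hC₀) hp₀
  have hmax : ∀ (s : V) (D : G.Walk s s), D.IsCycle → D.length ≤ C.length := fun s D hD =>
    hCl ▸ Nat.le_findGreatest (P := p) (hbdd s D hD) ⟨s, D, hD, rfl⟩
  by_cases hham : ∀ w : V, w ∈ C.support
  · by_cases hcross : HasCrossingChords G C
    · left
      refine hC.containsTheta_of_hasCrossingChords hcross ?_
      have hcard : Fintype.card V ≤ C.length := by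
        have hsub : (Finset.univ : Finset V) ⊆ C.support.tail.toFinset := by
          intro a _
          rw [List.mem_toFinset]
          rcases (Walk.mem_support_iff _).1 (hham a) with rfl | ha
          · exact C.end_mem_tail_support hC.not_nil
          · exact ha
        have := (Finset.card_le_card hsub).trans (List.toFinset_card_le _)
        simpa using this
      have := hP.length_lt
      nlinarith
    · exact Or.inr ⟨r, C, hC, hham, hcross⟩
  · push Not at hham
    obtain ⟨w, hw⟩ := hham
    exact Or.inl (h2c.containsTheta_of_notMem_support hC hmax
      (by have := hmax _ _ hC₀; omega) hw)
end

section
/- Let e = ab and f = cd be two distinct edges of a 2-connected simple graph G, and suppose that no 2-element subset Z of V(G) separates e from f. Then G contains an ef-theta, unless either (i) e and f have a common endpoint v and v has degree 2 in G, or (ii) e and f have no common endpoint and G is isomorphic to the complete graph K₄. -/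
open SimpleGraph

/-- `G` contains an `ef`-theta: two distinct vertices joined by three pairwise internally
disjoint paths such that `e` and `f` lie on two different ones of these paths and the
third path has length at least 2. -/
def ContainsEfTheta {V : Type} (G : SimpleGraph V) (e f : Sym2 V) : Prop :=
  ∃ (u v : V), u ≠ v ∧ ∃ (P₁ P₂ P₃ : G.Walk u v),
    P₁.IsPath ∧ P₂.IsPath ∧ P₃.IsPath ∧
    InternallyDisjoint P₁ P₂ ∧ InternallyDisjoint P₁ P₃ ∧ InternallyDisjoint P₂ P₃ ∧
    e ∈ P₁.edges ∧ f ∈ P₂.edges ∧ 2 ≤ P₃.length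

/-- `Z` separates the edge `ab` from the edge `cd`: both edges have an endpoint outside
`Z` and, after deleting `Z`, no path joins an endpoint of `ab` outside `Z` to an endpoint
of `cd` outside `Z`. -/
def SeparatesEdges {V : Type} (G : SimpleGraph V) (a b c d : V) (Z : Set V) : Prop :=
  (({a, b} : Set V) \ Z).Nonempty ∧ (({c, d} : Set V) \ Z).Nonempty ∧
  ∀ (p q : (Zᶜ : Set V)), (p : V) ∈ ({a, b} : Set V) \ Z → (q : V) ∈ ({c, d} : Set V) \ Z →
    ¬ (G.induce (Zᶜ : Set V)).Reachable p q

section Connectivity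

variable {V : Type} {G : SimpleGraph V}

/-- `u` and `v` are joined by a walk all of whose edges have both ends in `S`. -/
def ReachIn (G : SimpleGraph V) (S : Set V) : V → V → Prop :=
  Relation.ReflTransGen fun u v => G.Adj u v ∧ u ∈ S ∧ v ∈ S

/-- The set `S` induces a preconnected subgraph. -/
def ConnOn (G : SimpleGraph V) (S : Set V) : Prop :=
  ∀ u ∈ S, ∀ v ∈ S, ReachIn G S u v

/-- The vertices of `S` that are reachable from `u` inside `S`. -/
def compIn (G : SimpleGraph V) (S : Set V) (u : V) : Set V :=
  {w | w ∈ S ∧ ReachIn G S u w}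

theorem ReachIn.mono {S T : Set V} (h : S ⊆ T) {u v : V} (huv : ReachIn G S u v) :
    ReachIn G T u v :=
  Relation.ReflTransGen.mono (fun _ _ hab => ⟨hab.1, h hab.2.1, h hab.2.2⟩) _ _ huv

theorem ReachIn.symm {S : Set V} {u v : V} (huv : ReachIn G S u v) : ReachIn G S v u := by
  induction huv with
  | refl => exact .refl
  | tail _ h ih => exact .head ⟨h.1.symm, h.2.2, h.2.1⟩ ih

theorem ReachIn.trans {S : Set V} {u v w : V} (huv : ReachIn G S u v) (hvw : ReachIn G S v w) :
    ReachIn G S u w :=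
  Relation.ReflTransGen.trans huv hvw

theorem ReachIn.of_adj {S : Set V} {u v : V} (h : G.Adj u v) (hu : u ∈ S) (hv : v ∈ S) :
    ReachIn G S u v :=
  .single ⟨h, hu, hv⟩

/-- A walk inside `S` that leaves `U` traverses an edge leaving `U`. -/
theorem ReachIn.exists_exit {S U : Set V} {u v : V} (huv : ReachIn G S u v) (hu : u ∈ U)
    (hv : v ∉ U) : ∃ s t, G.Adj s t ∧ s ∈ S ∧ t ∈ S ∧ s ∈ U ∧ t ∉ U := by
  induction huv with
  | refl => exact absurd hu hv
  | @tail x y _ h ih =>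
    by_cases hx : x ∈ U
    · exact ⟨x, y, h.1, h.2.1, h.2.2, hx, hv⟩
    · exact ih hx

theorem reachIn_of_reachable_induce {S : Set V} {u v : S} (h : (G.induce S).Reachable u v) :
    ReachIn G S u v := by
  rw [SimpleGraph.reachable_iff_reflTransGen] at h
  induction h with
  | refl => exact .refl
  | @tail x y _ h ih => exact .tail ih ⟨h, x.2, y.2⟩

theorem ConnOn.of_induce {S : Set V} (h : (G.induce S).Connected) : ConnOn G S :=
  fun u hu v hv => reachIn_of_reachable_induce (h.preconnected ⟨u, hu⟩ ⟨v, hv⟩)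

theorem ConnOn.singleton (u : V) : ConnOn G {u} := by
  rintro _ rfl _ rfl
  exact .refl

theorem ConnOn.union_of_adj {S T : Set V} (hS : ConnOn G S) (hT : ConnOn G T) {s t : V}
    (hs : s ∈ S) (ht : t ∈ T) (h : G.Adj s t) : ConnOn G (S ∪ T) := by
  have key : ∀ u ∈ S ∪ T, ReachIn G (S ∪ T) u s := by
    rintro u (hu | hu)
    · exact (hS u hu s hs).mono Set.subset_union_left
    · exact ((hT u hu t ht).mono Set.subset_union_right).trans
        (.of_adj h.symm (Or.inr ht) (Or.inl hs))
  exact fun u hu v hv => (key u hu).trans (key v hv).symm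

theorem ConnOn.pair {u v : V} (h : G.Adj u v) : ConnOn G {u, v} :=
  (ConnOn.singleton u).union_of_adj (ConnOn.singleton v) rfl rfl h

theorem mem_compIn_self {S : Set V} {u : V} (hu : u ∈ S) : u ∈ compIn G S u := ⟨hu, .refl⟩

theorem mem_compIn_of_adj {S : Set V} {u v w : V} (hv : v ∈ compIn G S u) (h : G.Adj v w)
    (hw : w ∈ S) : w ∈ compIn G S u :=
  ⟨hw, hv.2.trans (.of_adj h hv.1 hw)⟩

theorem ReachIn.in_compIn {S : Set V} {u w : V} (h : ReachIn G S u w) :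
    ReachIn G (compIn G S u) u w := by
  induction h with
  | refl => exact .refl
  | @tail x y hx h ih => exact .tail ih ⟨h.1, ⟨h.2.1, hx⟩, ⟨h.2.2, hx.tail h⟩⟩

theorem ConnOn.compIn (S : Set V) (u : V) : ConnOn G (compIn G S u) :=
  fun _ hx _ hy => hx.2.in_compIn.symm.trans hy.2.in_compIn

theorem ReachIn.exists_path [DecidableEq V] {S : Set V} {u v : V} (h : ReachIn G S u v)
    (hu : u ∈ S) : ∃ p : G.Walk u v, p.IsPath ∧ ∀ x ∈ p.support, x ∈ S := by
  suffices ∃ p : G.Walk u v, ∀ x ∈ p.support, x ∈ S by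
    obtain ⟨p, hp⟩ := this
    exact ⟨p.bypass, p.bypass_isPath, fun x hx => hp x (p.support_bypass_subset_support hx)⟩
  induction h with
  | refl => exact ⟨.nil, by simpa using hu⟩
  | @tail x y _ h ih =>
    obtain ⟨p, hp⟩ := ih
    refine ⟨p.concat h.1, fun z hz => ?_⟩
    rw [SimpleGraph.Walk.support_concat] at hz
    simp only [List.mem_append, List.mem_singleton] at hz
    rcases hz with hz | rfl
    · exact hp z hz
    · exact h.2.2

theorem isPath_append {u v w : V} {p : G.Walk u v} {q : G.Walk v w} (hp : p.IsPath)
    (hq : q.IsPath) (h : ∀ x ∈ p.support, x ∈ q.support → x = v) : (p.append q).IsPath := by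
  rw [SimpleGraph.Walk.isPath_def, SimpleGraph.Walk.support_append, List.nodup_append']
  have hq' := hq.support_nodup
  rw [← SimpleGraph.Walk.cons_tail_support q, List.nodup_cons] at hq'
  refine ⟨hp.support_nodup, hq'.2, fun x hx hx' => ?_⟩
  have := h x hx (List.mem_of_mem_tail hx')
  exact hq'.1 (this ▸ hx')

theorem eq_of_mem_takeUntil_dropUntil [DecidableEq V] {u v w : V} {p : G.Walk u v}
    (hp : p.IsPath) (hw : w ∈ p.support) {x : V} (h1 : x ∈ (p.takeUntil w hw).support)
    (h2 : x ∈ (p.dropUntil w hw).support) : x = w := by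
  by_contra hne
  have h := hp
  rw [← p.take_spec hw] at h
  exact h.ne_of_mem_support_of_append hne h1 h2 rfl

end Connectivity

section Theta

variable {V : Type} {G : SimpleGraph V}

/-- If `R` is adjacent to the connected set `X`, and `S` contains `R` and all of `X` outside of
`A`, then the component of `R` in `S` is adjacent to `A`. -/
theorem exists_adj_compIn {X R A S : Set V} {a x r r' : V} (hX : ConnOn G X) (hR : ConnOn G R)
    (haX : a ∈ X) (hXS : ∀ z ∈ X, z ∉ A → z ∈ S) (hRS : R ⊆ S) (haS : a ∉ S)
    (hx : x ∈ X) (hr : r ∈ R) (hxr : G.Adj x r) (hr' : r' ∈ R) :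
    ∃ u ∈ A, ∃ k ∈ compIn G S r', G.Adj u k := by
  have hRK : R ⊆ compIn G S r' := fun z hz => ⟨hRS hz, (hR r' hr' z hz).mono hRS⟩
  obtain ⟨s, t, hst, hs, ht, hsK, htK⟩ :=
    (hX.union_of_adj hR hx hr hxr r' (Or.inr hr') a (Or.inl haX)).exists_exit
      (hRK hr') (fun h => haS h.1)
  have htX : t ∈ X := ht.resolve_right fun h => htK (hRK h)
  exact ⟨t, by_contra fun h => htK (mem_compIn_of_adj hsK hst (hXS t htX h)), s, hsK, hst.symm⟩

/-- Starting from disjoint `X` and `Y`, with paths inside them, and a connected set `R` disjoint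
from both and adjacent to both, there is a connecting path of length at least two. -/
theorem exists_connecting_path [DecidableEq V] {X Y R A B : Set V} {a b : V}
    (hX : ConnOn G X) (hY : ConnOn G Y) (hR : ConnOn G R)
    (hXY : Disjoint X Y) (hXR : Disjoint X R) (hYR : Disjoint Y R)
    (hAX : A ⊆ X) (hBY : B ⊆ Y) (ha : a ∈ A) (hb : b ∈ B)
    (hx : ∃ x ∈ X, ∃ r ∈ R, G.Adj x r) (hy : ∃ y ∈ Y, ∃ r ∈ R, G.Adj y r) :
    ∃ u ∈ A, ∃ v ∈ B, ∃ P : G.Walk u v, P.IsPath ∧ 2 ≤ P.length ∧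
      ∀ z ∈ P.support, z ∈ A ∪ B → z = u ∨ z = v := by
  obtain ⟨x, hxX, r, hr, hxr⟩ := hx
  obtain ⟨y, hyY, r', hr', hyr⟩ := hy
  have hRd : R ⊆ (A ∪ B)ᶜ := by
    rintro z hz (h | h)
    · exact Set.disjoint_left.1 hXR (hAX h) hz
    · exact Set.disjoint_left.1 hYR (hBY h) hz
  obtain ⟨u, huA, k, hk, huk⟩ := exists_adj_compIn (S := (A ∪ B)ᶜ) hX hR (hAX ha)
    (fun z hz hzA h => h.elim hzA fun h' => Set.disjoint_left.1 hXY hz (hBY h')) hRd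
    (fun h => h (Or.inl ha)) hxX hr hxr hr
  obtain ⟨v, hvB, k', hk', hvk⟩ := exists_adj_compIn (S := (A ∪ B)ᶜ) hY hR (hBY hb)
    (fun z hz hzB h => h.elim (fun h' => Set.disjoint_left.1 hXY (hAX h') hz) hzB) hRd
    (fun h => h (Or.inr hb)) hyY hr' hyr hr
  obtain ⟨p, hp, hpK⟩ := (ConnOn.compIn (G := G) (A ∪ B)ᶜ r k hk k' hk').exists_path hk
  have hne : u ≠ v := fun h => Set.disjoint_left.1 hXY (hAX huA) (hBY (h ▸ hvB))
  have hup : u ∉ p.support := fun h => (hpK u h).1 (Or.inl huA)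
  have hvp : v ∉ p.support := fun h => (hpK v h).1 (Or.inr hvB)
  refine ⟨u, huA, v, hvB, .cons huk (p.concat hvk.symm), ?_, ?_, ?_⟩
  · rw [SimpleGraph.Walk.cons_isPath_iff]
    refine ⟨hp.concat hvp _, ?_⟩
    simp [SimpleGraph.Walk.support_concat, hup, hne]
  · simp
  · intro z hz hzAB
    simp only [SimpleGraph.Walk.support_cons, SimpleGraph.Walk.support_concat,
      List.mem_cons, List.mem_append, List.not_mem_nil, or_false] at hz
    rcases hz with h | h | h
    · exact Or.inl h
    · exact absurd hzAB (hpK z h).1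
    · exact Or.inr h

theorem containsEfTheta_of_rooted [DecidableEq V] {X Y R : Set V} {a b c d : V}
    (hab : G.Adj a b) (hcd : G.Adj c d)
    (hX : ConnOn G X) (hY : ConnOn G Y) (hR : ConnOn G R)
    (hXY : Disjoint X Y) (hXR : Disjoint X R) (hYR : Disjoint Y R)
    (ha : a ∈ X) (hc : c ∈ X) (hb : b ∈ Y) (hd : d ∈ Y)
    (hx : ∃ x ∈ X, ∃ r ∈ R, G.Adj x r) (hy : ∃ y ∈ Y, ∃ r ∈ R, G.Adj y r) :
    ContainsEfTheta G s(a, b) s(c, d) := by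
  obtain ⟨A, hA, hAX⟩ := (hX a ha c hc).exists_path ha
  obtain ⟨B, hB, hBY⟩ := (hY b hb d hd).exists_path hb
  obtain ⟨u, huA, v, hvB, P, hP, hPl, hPd⟩ := exists_connecting_path
    (A := {x | x ∈ A.support}) (B := {x | x ∈ B.support}) hX hY hR hXY hXR hYR hAX hBY
    A.start_mem_support B.start_mem_support hx hy
  have hAB : ∀ x ∈ A.support, x ∉ B.support := fun x h h' =>
    Set.disjoint_left.1 hXY (hAX x h) (hBY x h')
  have hAt := A.support_takeUntil_subset_support huA
  have hAd := A.support_dropUntil_subset_support huA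
  have hBt := B.support_takeUntil_subset_support hvB
  have hBd := B.support_dropUntil_subset_support hvB
  have h1 : ∀ x,
      x ∈ ((A.takeUntil u huA).reverse.append (.cons hab (B.takeUntil v hvB))).support ↔
      x ∈ (A.takeUntil u huA).support ∨ x ∈ (B.takeUntil v hvB).support := by
    intro x
    simp only [SimpleGraph.Walk.mem_support_append_iff, SimpleGraph.Walk.support_cons,
      SimpleGraph.Walk.support_reverse, List.mem_reverse, List.mem_cons]
    have : x = a → x ∈ (A.takeUntil u huA).support := fun h => by
      rw [h]
      exact SimpleGraph.Walk.start_mem_support _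
    tauto
  have h2 : ∀ x,
      x ∈ ((A.dropUntil u huA).append (.cons hcd (B.dropUntil v hvB).reverse)).support ↔
      x ∈ (A.dropUntil u huA).support ∨ x ∈ (B.dropUntil v hvB).support := by
    intro x
    simp only [SimpleGraph.Walk.mem_support_append_iff, SimpleGraph.Walk.support_cons,
      SimpleGraph.Walk.support_reverse, List.mem_reverse, List.mem_cons]
    have : x = c → x ∈ (A.dropUntil u huA).support := fun h => by
      rw [h]
      exact SimpleGraph.Walk.end_mem_support _
    tauto
  refine ⟨u, v, fun h => hAB u huA (h ▸ hvB),
    (A.takeUntil u huA).reverse.append (.cons hab (B.takeUntil v hvB)),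
    (A.dropUntil u huA).append (.cons hcd (B.dropUntil v hvB).reverse), P,
    ?_, ?_, hP, ?_, ?_, ?_, ?_, ?_, hPl⟩
  · refine isPath_append (hA.takeUntil huA).reverse ?_ ?_
    · rw [SimpleGraph.Walk.cons_isPath_iff]
      exact ⟨hB.takeUntil hvB, fun h => hAB a A.start_mem_support (hBt h)⟩
    · intro x hx hx'
      simp only [SimpleGraph.Walk.support_reverse, List.mem_reverse] at hx
      rw [SimpleGraph.Walk.support_cons, List.mem_cons] at hx'
      exact hx'.resolve_right fun h => hAB x (hAt hx) (hBt h)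
  · refine isPath_append (hA.dropUntil huA) ?_ ?_
    · rw [SimpleGraph.Walk.cons_isPath_iff]
      refine ⟨(hB.dropUntil hvB).reverse, fun h => hAB c A.end_mem_support (hBd ?_)⟩
      simpa using h
    · intro x hx hx'
      simp only [SimpleGraph.Walk.support_reverse, List.mem_reverse, SimpleGraph.Walk.support_cons,
        List.mem_cons] at hx'
      exact hx'.resolve_right fun h => hAB x (hAd hx) (hBd h)
  · intro x hx hx'
    rw [h1] at hx
    rw [h2] at hx'
    rcases hx with hx | hx <;> rcases hx' with hx' | hx'
    · exact Or.inl (eq_of_mem_takeUntil_dropUntil hA huA hx hx')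
    · exact absurd (hBd hx') (hAB x (hAt hx))
    · exact absurd (hBt hx) (hAB x (hAd hx'))
    · exact Or.inr (eq_of_mem_takeUntil_dropUntil hB hvB hx hx')
  · intro x hx hx'
    rw [h1] at hx
    exact hPd x hx' (hx.imp (fun h => hAt h) fun h => hBt h)
  · intro x hx hx'
    rw [h2] at hx
    exact hPd x hx' (hx.imp (fun h => hAd h) fun h => hBd h)
  · simp
  · simp

end Theta

section TwoConnected

variable {V : Type} {G : SimpleGraph V}

/-- In a graph without cut vertices, a bipartition into two connected sets can be moved by a
single vertex. -/
theorem exists_connOn_insert [Finite V] (h2 : ∀ v, ConnOn G {v}ᶜ) {X : Set V} {a b w : V}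
    (hX : ConnOn G X) (hXc : ConnOn G Xᶜ) (ha : a ∈ X) (hb : b ∉ X) (hw : w ∉ X) (hwb : w ≠ b) :
    ∃ x, x ∉ X ∧ x ≠ b ∧ ConnOn G (insert x X) ∧ ConnOn G (insert x X)ᶜ := by
  have hne : {x | x ∉ X ∧ x ≠ b ∧ ∃ y ∈ X, G.Adj y x}.Nonempty := by
    obtain ⟨s, t, hst, hs, ht, hsX, htX⟩ :=
      (h2 b a (fun h => hb (h ▸ ha)) w hwb).exists_exit ha hw
    exact ⟨t, htX, ht, s, hsX, hst⟩
  obtain ⟨x, ⟨hxX, hxb, y, hy, hyx⟩, hmax⟩ := Set.exists_max_image _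
    (fun x => (compIn G (Xᶜ \ {x}) b).ncard) (Set.toFinite _) hne
  refine ⟨x, hxX, hxb, ?_, ?_⟩
  · rw [Set.insert_eq, Set.union_comm]
    exact hX.union_of_adj (ConnOn.singleton x) hy rfl hyx
  have hcompl : (insert x X)ᶜ = Xᶜ \ {x} := by
    ext z
    simp only [Set.mem_compl_iff, Set.mem_insert_iff, Set.mem_sdiff, Set.mem_singleton_iff]
    tauto
  rw [hcompl]
  have hbS : b ∈ Xᶜ \ {x} := ⟨hb, fun h => hxb h.symm⟩
  suffices Xᶜ \ {x} ⊆ compIn G (Xᶜ \ {x}) b by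
    exact fun u hu v hv => (this hu).2.symm.trans (this hv).2
  intro z hz
  by_contra hzC
  obtain ⟨s, t, hst, hs, ht, hsD, htD⟩ := (h2 x z hz.2 a (fun h => hxX (h ▸ ha))).exists_exit
    (U := compIn G (Xᶜ \ {x}) z) (mem_compIn_self hz) (fun h => h.1.1 ha)
  have htX : t ∈ X := by_contra fun h => htD (mem_compIn_of_adj hsD hst ⟨h, ht⟩)
  have hsC : s ∉ compIn G (Xᶜ \ {x}) b := fun h => hzC ⟨hz, h.2.trans hsD.2.symm⟩
  have hsb : s ≠ b := by
    rintro rfl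
    exact hsC (mem_compIn_self hbS)
  have hle := hmax s ⟨hsD.1.1, hsb, t, htX, hst.symm⟩
  refine absurd hle (not_le.2 (Set.ncard_lt_ncard ?_ (Set.toFinite _)))
  have hsub : compIn G (Xᶜ \ {x}) b ⊆ Xᶜ \ {s} := fun v hv => ⟨hv.1.1, fun h => hsC (h ▸ hv)⟩
  have hsub' : compIn G (Xᶜ \ {x}) b ⊆ compIn G (Xᶜ \ {s}) b := fun v hv =>
    ⟨hsub hv, hv.2.in_compIn.mono hsub⟩
  obtain ⟨p, q, hpq, -, hq, hpC, hqC⟩ := (hXc b hb x hxX).exists_exit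
    (mem_compIn_self hbS) (fun h => h.1.2 rfl)
  have hqx : q = x := by_contra fun h => hqC (mem_compIn_of_adj hpC hpq ⟨hq, h⟩)
  subst hqx
  refine ⟨hsub', fun h => hqC (h (mem_compIn_of_adj (hsub' hpC) hpq ⟨hq, ?_⟩))⟩
  exact fun h => hsD.1.2 h.symm

theorem exists_connOn_split_aux [Finite V] (h2 : ∀ v, ConnOn G {v}ᶜ) {a b c d : V}
    (hcb : c ≠ b) (hcd : c ≠ d) (n : ℕ) :
    ∀ X : Set V, Xᶜ.ncard = n → ConnOn G X → ConnOn G Xᶜ → a ∈ X → b ∉ X → c ∉ X → d ∉ X →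
      ∃ X Y : Set V, ConnOn G X ∧ ConnOn G Y ∧ Disjoint X Y ∧ a ∈ X ∧ b ∈ Y ∧
        (c ∈ X ∧ d ∈ Y ∨ d ∈ X ∧ c ∈ Y) := by
  induction n using Nat.strong_induction_on with
  | _ n ih =>
    intro X hn hX hXc ha hb hc hd
    obtain ⟨x, hxX, hxb, h1, h3⟩ := exists_connOn_insert h2 hX hXc ha hb hc hcb
    have hlt : (insert x X)ᶜ.ncard < n := by
      rw [← hn]
      refine Set.ncard_lt_ncard ⟨fun z hz hz' => hz (Or.inr hz'), fun h => ?_⟩ (Set.toFinite _)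
      exact h hxX (Or.inl rfl)
    have hb' : b ∉ insert x X := by
      rintro (h | h)
      · exact hxb h.symm
      · exact hb h
    by_cases hxc : x = c
    · subst hxc
      refine ⟨_, _, h1, h3, disjoint_compl_right, Or.inr ha, hb', Or.inl ⟨Or.inl rfl, ?_⟩⟩
      rintro (h | h)
      · exact hcd h.symm
      · exact hd h
    by_cases hxd : x = d
    · subst hxd
      refine ⟨_, _, h1, h3, disjoint_compl_right, Or.inr ha, hb', Or.inr ⟨Or.inl rfl, ?_⟩⟩
      rintro (h | h)
      · exact hcd h
      · exact hc h
    refine ih _ hlt _ rfl h1 h3 (Or.inr ha) hb' ?_ ?_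
    · rintro (h | h)
      · exact hxc h.symm
      · exact hc h
    · rintro (h | h)
      · exact hxd h.symm
      · exact hd h

/-- Two disjoint edges of a graph without cut vertices are joined by two disjoint
connected sets. -/
theorem exists_connOn_split [Finite V] (h2 : ∀ v, ConnOn G {v}ᶜ) {a b c d : V}
    (hab : a ≠ b) (hac : a ≠ c) (had : a ≠ d) (hbc : b ≠ c) (hcd : c ≠ d) :
    ∃ X Y : Set V, ConnOn G X ∧ ConnOn G Y ∧ Disjoint X Y ∧ a ∈ X ∧ b ∈ Y ∧
      (c ∈ X ∧ d ∈ Y ∨ d ∈ X ∧ c ∈ Y) :=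
  exists_connOn_split_aux h2 hbc.symm hcd _ {a} rfl (ConnOn.singleton a) (h2 a) rfl hab.symm
    hac.symm had.symm

end TwoConnected

section Linkage

variable {V : Type} {G : SimpleGraph V} {a b c d : V} {α β : ℕ → V} {n m : ℕ}

/-- There is no triple of disjoint connected sets `X`, `Y`, `R` such that `X` and `Y` link
`{a, b}` to `{c, d}` and `R` is adjacent to both `X` and `Y`. -/
def NoRooted (G : SimpleGraph V) (a b c d : V) : Prop :=
  ∀ X Y R : Set V, ConnOn G X → ConnOn G Y → ConnOn G R →
    Disjoint X Y → Disjoint X R → Disjoint Y R → a ∈ X → b ∈ Y →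
    (c ∈ X ∧ d ∈ Y ∨ d ∈ X ∧ c ∈ Y) →
    (∃ x ∈ X, ∃ r ∈ R, G.Adj x r) → (∃ y ∈ Y, ∃ r ∈ R, G.Adj y r) → False

theorem NoRooted.swap (h : NoRooted G a b c d) : NoRooted G b a d c :=
  fun X Y R hX hY hR hXY hXR hYR ha hb hcd hx hy =>
    h Y X R hY hX hR hXY.symm hYR hXR hb ha (hcd.imp And.symm And.symm) hy hx

/-- `α` and `β` enumerate disjoint paths from `a` to `c` and from `b` to `d`. -/
structure Linkage (G : SimpleGraph V) (a b c d : V) (α β : ℕ → V) (n m : ℕ) : Prop where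
  α_zero : α 0 = a
  α_last : α n = c
  β_zero : β 0 = b
  β_last : β m = d
  α_adj : ∀ i < n, G.Adj (α i) (α (i + 1))
  β_adj : ∀ i < m, G.Adj (β i) (β (i + 1))
  α_inj : ∀ i ≤ n, ∀ j ≤ n, α i = α j → i = j
  β_inj : ∀ i ≤ m, ∀ j ≤ m, β i = β j → i = j
  disj : ∀ i ≤ n, ∀ j ≤ m, α i ≠ β j

theorem Linkage.swap (L : Linkage G a b c d α β n m) : Linkage G b a d c β α m n where
  α_zero := L.β_zero
  α_last := L.β_last
  β_zero := L.α_zero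
  β_last := L.α_last
  α_adj := L.β_adj
  β_adj := L.α_adj
  α_inj := L.β_inj
  β_inj := L.α_inj
  disj := fun i hi j hj h => L.disj j hj i hi h.symm

theorem connOn_image_Icc {α : ℕ → V} {n : ℕ} (h : ∀ i < n, G.Adj (α i) (α (i + 1))) {i j : ℕ}
    (hj : j ≤ n) : ConnOn G (α '' Set.Icc i j) := by
  induction j with
  | zero =>
    rintro _ ⟨p, hp, rfl⟩ _ ⟨q, hq, rfl⟩
    obtain rfl : p = q := by grind
    exact .refl
  | succ j ih =>
    rcases Nat.lt_or_ge j i with hij | hij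
    · rintro _ ⟨p, hp, rfl⟩ _ ⟨q, hq, rfl⟩
      obtain rfl : p = q := by grind
      exact .refl
    · have : α '' Set.Icc i (j + 1) = α '' Set.Icc i j ∪ {α (j + 1)} := by
        rw [← Set.image_singleton, ← Set.image_union]
        congr 1
        ext k
        simp only [Set.mem_Icc, Set.mem_union, Set.mem_singleton_iff]
        omega
      rw [this]
      exact (ih (by omega)).union_of_adj (ConnOn.singleton _)
        ⟨j, ⟨hij, le_rfl⟩, rfl⟩ rfl (h j (by omega))

/-- The vertices of the two paths of a linkage. -/
def linkVerts (α β : ℕ → V) (n m : ℕ) : Set V := α '' Set.Icc 0 n ∪ β '' Set.Icc 0 m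

/-- `x` and `y` are joined by an edge or by a connected set avoiding the linkage. -/
def Link (G : SimpleGraph V) (S : Set V) (x y : V) : Prop :=
  G.Adj x y ∨ ∃ J, ConnOn G J ∧ Disjoint S J ∧ (∃ s ∈ J, G.Adj x s) ∧ ∃ t ∈ J, G.Adj t y

theorem Link.symm {S : Set V} {x y : V} (h : Link G S x y) : Link G S y x := by
  rcases h with h | ⟨J, hJ, hd, ⟨s, hs, hxs⟩, t, ht, hty⟩
  · exact Or.inl h.symm
  · exact Or.inr ⟨J, hJ, hd, ⟨t, ht, hty.symm⟩, s, hs, hxs.symm⟩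

/-- A link between the two paths is an edge. -/
theorem Linkage.adj_of_link (L : Linkage G a b c d α β n m) (H : NoRooted G a b c d) {i j : ℕ}
    (hi : i ≤ n) (hj : j ≤ m) (h : Link G (linkVerts α β n m) (α i) (β j)) :
    G.Adj (α i) (β j) := by
  refine h.resolve_right ?_
  rintro ⟨J, hJ, hd, ⟨s, hs, hxs⟩, t, ht, hty⟩
  have hd' := Set.disjoint_union_left.1 hd
  refine H (α '' Set.Icc 0 n) (β '' Set.Icc 0 m) J (connOn_image_Icc L.α_adj le_rfl)
    (connOn_image_Icc L.β_adj le_rfl) hJ ?_ hd'.1 hd'.2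
    ⟨0, by simp, L.α_zero⟩ ⟨0, by simp, L.β_zero⟩
    (Or.inl ⟨⟨n, by simp, L.α_last⟩, ⟨m, by simp, L.β_last⟩⟩)
    ⟨_, ⟨i, by simpa using hi, rfl⟩, s, hs, hxs⟩ ⟨_, ⟨j, by simpa using hj, rfl⟩, t, ht, hty.symm⟩
  rw [Set.disjoint_left]
  rintro _ ⟨p, hp, rfl⟩ ⟨q, hq, hpq⟩
  exact L.disj p hp.2 q hq.2 hpq.symm

/-- No link jumps over a vertex with a neighbour on the other path. -/
theorem Linkage.not_jump (L : Linkage G a b c d α β n m) (H : NoRooted G a b c d)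
    {p i q j : ℕ} (hpi : p < i) (hiq : i < q) (hq : q ≤ n) (hj : j ≤ m)
    (hij : G.Adj (α i) (β j)) : ¬ Link G (linkVerts α β n m) (α p) (α q) := by
  intro h
  obtain ⟨J, hd, hX⟩ : ∃ J, Disjoint (linkVerts α β n m) J ∧
      ConnOn G (α '' Set.Icc 0 p ∪ J ∪ α '' Set.Icc q n) := by
    have h1 : ConnOn G (α '' Set.Icc 0 p) := connOn_image_Icc L.α_adj (by omega)
    have h2 : ConnOn G (α '' Set.Icc q n) := connOn_image_Icc L.α_adj le_rfl
    have hp' : α p ∈ α '' Set.Icc 0 p := ⟨p, by simp, rfl⟩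
    have hq' : α q ∈ α '' Set.Icc q n := ⟨q, by simpa using hq, rfl⟩
    rcases h with h | ⟨J, hJ, hd, ⟨s, hs, hxs⟩, t, ht, hty⟩
    · refine ⟨∅, Set.disjoint_empty _, ?_⟩
      rw [Set.union_empty]
      exact h1.union_of_adj h2 hp' hq' h
    · exact ⟨J, hd, (h1.union_of_adj hJ hp' hs hxs).union_of_adj h2 (Or.inr ht) hq' hty⟩
  have hd' := Set.disjoint_union_left.1 hd
  refine H _ (β '' Set.Icc 0 m) (α '' Set.Icc (p + 1) (q - 1)) hX
    (connOn_image_Icc L.β_adj le_rfl) (connOn_image_Icc L.α_adj (by omega)) ?_ ?_ ?_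
    (Or.inl (Or.inl ⟨0, by simp, L.α_zero⟩)) ⟨0, by simp, L.β_zero⟩
    (Or.inl ⟨Or.inr ⟨n, by simpa using hq, L.α_last⟩, ⟨m, by simp, L.β_last⟩⟩)
    ⟨α p, Or.inl (Or.inl ⟨p, by simp, rfl⟩), α (p + 1), ⟨p + 1, ⟨le_rfl, by omega⟩, rfl⟩,
      L.α_adj p (by omega)⟩
    ⟨β j, ⟨j, by simpa using hj, rfl⟩, α i, ⟨i, ⟨by omega, by omega⟩, rfl⟩, hij.symm⟩
  · rw [Set.disjoint_left]
    rintro _ ((⟨k, hk, rfl⟩ | h) | ⟨k, hk, rfl⟩) ⟨l, hl, hkl⟩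
    · exact L.disj k (by grind) l hl.2 hkl.symm
    · exact Set.disjoint_left.1 hd'.2 ⟨l, hl, rfl⟩ (hkl ▸ h)
    · exact L.disj k hk.2 l hl.2 hkl.symm
  · rw [Set.disjoint_left]
    rintro _ ((⟨k, hk, rfl⟩ | h) | ⟨k, hk, rfl⟩) ⟨l, hl, hkl⟩
    · have := L.α_inj l (by grind) k (by grind) hkl
      grind
    · exact Set.disjoint_left.1 hd'.1 ⟨l, by grind, rfl⟩ (hkl ▸ h)
    · have := L.α_inj l (by grind) k (by grind) hkl
      grind
  · rw [Set.disjoint_left]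
    rintro _ ⟨k, hk, rfl⟩ ⟨l, hl, hkl⟩
    exact L.disj l (by grind) k hk.2 hkl

theorem Linkage.consecutive_aux (L : Linkage G a b c d α β n m) (H : NoRooted G a b c d)
    {i i' j j' : ℕ} (hi : i < i') (hj : j' < j) (hi' : i' ≤ n) (hjm : j ≤ m)
    (h : G.Adj (α i) (β j)) (h' : G.Adj (α i') (β j')) : i' = i + 1 := by
  by_contra hne
  refine H (α '' Set.Icc 0 i ∪ β '' Set.Icc j m) (β '' Set.Icc 0 j' ∪ α '' Set.Icc i' n)
    (α '' Set.Icc (i + 1) (i' - 1))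
    ((connOn_image_Icc L.α_adj (by omega)).union_of_adj (connOn_image_Icc L.β_adj le_rfl)
      ⟨i, by simp, rfl⟩ ⟨j, by simpa using hjm, rfl⟩ h)
    ((connOn_image_Icc L.β_adj (by omega)).union_of_adj (connOn_image_Icc L.α_adj le_rfl)
      ⟨j', by simp, rfl⟩ ⟨i', by simpa using hi', rfl⟩ h'.symm)
    (connOn_image_Icc L.α_adj (by omega)) ?_ ?_ ?_
    (Or.inl ⟨0, by simp, L.α_zero⟩) (Or.inl ⟨0, by simp, L.β_zero⟩)
    (Or.inr ⟨Or.inr ⟨m, by simpa using hjm, L.β_last⟩, Or.inr ⟨n, by simpa using hi', L.α_last⟩⟩)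
    ⟨α i, Or.inl ⟨i, by simp, rfl⟩, α (i + 1), ⟨i + 1, ⟨le_rfl, by omega⟩, rfl⟩,
      L.α_adj i (by omega)⟩
    ⟨α i', Or.inr ⟨i', by simpa using hi', rfl⟩, α (i' - 1), ⟨i' - 1, ⟨by omega, le_rfl⟩, rfl⟩, ?_⟩
  · rw [Set.disjoint_left]
    rintro _ (⟨k, hk, rfl⟩ | ⟨k, hk, rfl⟩) (⟨l, hl, hkl⟩ | ⟨l, hl, hkl⟩)
    · exact L.disj k (by grind) l (by grind) hkl.symm
    · have := L.α_inj l (by grind) k (by grind) hkl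
      grind
    · have := L.β_inj l (by grind) k (by grind) hkl
      grind
    · exact L.disj l (by grind) k (by grind) hkl
  · rw [Set.disjoint_left]
    rintro _ (⟨k, hk, rfl⟩ | ⟨k, hk, rfl⟩) ⟨l, hl, hkl⟩
    · have := L.α_inj l (by grind) k (by grind) hkl
      grind
    · exact L.disj l (by grind) k (by grind) hkl
  · rw [Set.disjoint_left]
    rintro _ (⟨k, hk, rfl⟩ | ⟨k, hk, rfl⟩) ⟨l, hl, hkl⟩
    · exact L.disj l (by grind) k (by grind) hkl
    · have := L.α_inj l (by grind) k (by grind) hkl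
      grind
  · have := L.α_adj (i' - 1) (by omega)
    rw [Nat.sub_add_cancel (by omega)] at this
    exact this.symm

/-- Crossing edges between the two paths have consecutive ends. -/
theorem Linkage.consecutive (L : Linkage G a b c d α β n m) (H : NoRooted G a b c d)
    {i i' j j' : ℕ} (hi : i < i') (hj : j' < j) (hi' : i' ≤ n) (hjm : j ≤ m)
    (h : G.Adj (α i) (β j)) (h' : G.Adj (α i') (β j')) : i' = i + 1 ∧ j = j' + 1 :=
  ⟨L.consecutive_aux H hi hj hi' hjm h h',
    L.swap.consecutive_aux H.swap hj hi hjm hi' h'.symm h.symm⟩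

theorem Linkage.exists_crossing (L : Linkage G a b c d α β n m) (H : NoRooted G a b c d)
    (hnosep : ∀ Z : Set V, Z.ncard = 2 → ¬ SeparatesEdges G a b c d Z)
    {i j : ℕ} (hin : i ≤ n) (hjm : j ≤ m) (h0 : 0 < i ∨ 0 < j) (h1 : i < n ∨ j < m)
    (hi : i = 0 ∨ i = n ∨ ∃ j' ≤ m, G.Adj (α i) (β j'))
    (hj : j = 0 ∨ j = m ∨ ∃ i' ≤ n, G.Adj (α i') (β j)) :
    ∃ p ≤ n, ∃ q ≤ m, G.Adj (α p) (β q) ∧ (p < i ∧ j < q ∨ i < p ∧ q < j) := by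
  by_contra hno
  have hαj : ∀ p q, p < i → i < q → q ≤ n → ¬ Link G (linkVerts α β n m) (α p) (α q) := by
    intro p q hp hq hqn
    obtain ⟨j', hj', hadj⟩ := (hi.resolve_left (by omega)).resolve_left (by omega)
    exact L.not_jump H hp hq hqn hj' hadj
  have hβj : ∀ p q, p < j → j < q → q ≤ m → ¬ Link G (linkVerts α β n m) (β p) (β q) := by
    intro p q hp hq hqn
    obtain ⟨i', hi', hadj⟩ := (hj.resolve_left (by omega)).resolve_left (by omega)
    have := L.swap.not_jump H.swap hp hq hqn hi' hadj.symm
    rwa [linkVerts, Set.union_comm] at this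
  set W := linkVerts α β n m with hW
  set S : Set V := {v | (∃ k < i, α k = v) ∨ ∃ k < j, β k = v} with hS
  set T : Set V := {v | (∃ k, i < k ∧ k ≤ n ∧ α k = v) ∨ ∃ k, j < k ∧ k ≤ m ∧ β k = v} with hT
  have hlink : ∀ s ∈ S, ∀ t ∈ T, ¬ Link G W s t := by
    rintro _ (⟨k, hk, rfl⟩ | ⟨k, hk, rfl⟩) _ (⟨l, hl, hln, rfl⟩ | ⟨l, hl, hln, rfl⟩) h
    · exact hαj k l hk hl hln h
    · exact hno ⟨k, by omega, l, hln, L.adj_of_link H (by omega) hln h, Or.inl ⟨hk, hl⟩⟩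
    · exact hno ⟨l, hln, k, by omega, L.adj_of_link H hln (by omega) h.symm, Or.inr ⟨hl, hk⟩⟩
    · exact hβj k l hk hl hln h
  have hST : ∀ s ∈ S, s ∉ T := by
    rintro _ (⟨k, hk, rfl⟩ | ⟨k, hk, rfl⟩) (⟨l, hl, hln, h⟩ | ⟨l, hl, hln, h⟩)
    · have := L.α_inj l hln k (by omega) h
      omega
    · exact L.disj k (by omega) l hln h.symm
    · exact L.disj l hln k (by omega) h
    · have := L.β_inj l hln k (by omega) h
      omega
  have hTW : T ⊆ W := by
    rintro _ (⟨l, hl, hln, rfl⟩ | ⟨l, hl, hln, rfl⟩)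
    · exact Or.inl ⟨l, ⟨l.zero_le, hln⟩, rfl⟩
    · exact Or.inr ⟨l, ⟨l.zero_le, hln⟩, rfl⟩
  have hWST : ∀ v ∈ W, v ∉ ({α i, β j} : Set V) → v ∉ S → v ∈ T := by
    rintro _ (⟨l, hl, rfl⟩ | ⟨l, hl, rfl⟩) hZ hnS
    · refine Or.inl ⟨l, ?_, hl.2, rfl⟩
      rcases lt_trichotomy l i with h | rfl | h
      · exact absurd (Or.inl ⟨l, h, rfl⟩) hnS
      · exact absurd (Or.inl rfl) hZ
      · exact h
    · refine Or.inr ⟨l, ?_, hl.2, rfl⟩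
      rcases lt_trichotomy l j with h | rfl | h
      · exact absurd (Or.inr ⟨l, h, rfl⟩) hnS
      · exact absurd (Or.inr rfl) hZ
      · exact h
  have haS : a ∉ ({α i, β j} : Set V) → a ∈ S := fun h =>
    Or.inl ⟨0, Nat.pos_of_ne_zero fun h' => h (Or.inl (by rw [h', L.α_zero])), L.α_zero⟩
  have hbS : b ∉ ({α i, β j} : Set V) → b ∈ S := fun h =>
    Or.inr ⟨0, Nat.pos_of_ne_zero fun h' => h (Or.inr (by rw [h', L.β_zero]; rfl)), L.β_zero⟩
  have hcT : c ∉ ({α i, β j} : Set V) → c ∈ T := fun h =>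
    Or.inl ⟨n, lt_of_le_of_ne hin fun h' => h (Or.inl (by rw [h', L.α_last])), le_rfl, L.α_last⟩
  have hdT : d ∉ ({α i, β j} : Set V) → d ∈ T := fun h =>
    Or.inr ⟨m, lt_of_le_of_ne hjm fun h' => h (Or.inr (by rw [h', L.β_last]; rfl)), le_rfl,
      L.β_last⟩
  refine hnosep {α i, β j} (Set.ncard_pair (L.disj i hin j hjm)) ⟨?_, ?_, ?_⟩
  · rcases h0 with h | h
    · refine ⟨a, Or.inl rfl, ?_⟩
      rw [← L.α_zero]
      rintro (h' | h')
      · exact absurd (L.α_inj 0 (by omega) i hin h') (by omega)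
      · exact L.disj 0 (by omega) j hjm h'
    · refine ⟨b, Or.inr rfl, ?_⟩
      rw [← L.β_zero]
      rintro (h' | h')
      · exact L.disj i hin 0 (by omega) h'.symm
      · exact absurd (L.β_inj 0 (by omega) j hjm h') (by omega)
  · rcases h1 with h | h
    · refine ⟨c, Or.inl rfl, ?_⟩
      rw [← L.α_last]
      rintro (h' | h')
      · exact absurd (L.α_inj n le_rfl i hin h') (by omega)
      · exact L.disj n le_rfl j hjm h'
    · refine ⟨d, Or.inr rfl, ?_⟩
      rw [← L.β_last]
      rintro (h' | h')
      · exact L.disj i hin m le_rfl h'.symm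
      · exact absurd (L.β_inj m le_rfl j hjm h') (by omega)
  · rintro p q ⟨hp, hpZ⟩ ⟨hq, hqZ⟩ hreach
    have hpS : (p : V) ∈ S := by
      rcases hp with h | h
      · rw [h] at hpZ ⊢; exact haS hpZ
      · rw [h] at hpZ ⊢; exact hbS hpZ
    have hqT : (q : V) ∈ T := by
      rcases hq with h | h
      · rw [h] at hqZ ⊢; exact hcT hqZ
      · rw [h] at hqZ ⊢; exact hdT hqZ
    obtain ⟨s, t, hst, -, htZ, hsU, htU⟩ := (reachIn_of_reachable_induce hreach).exists_exit
      (U := S ∪ {w | ∃ s ∈ S, ∃ r, G.Adj s r ∧ r ∉ W ∧ w ∈ compIn G Wᶜ r}) (Or.inl hpS) (by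
        rintro (h | ⟨_, _, _, _, _, h⟩)
        · exact hST _ h hqT
        · exact h.1 (hTW hqT))
    have htS : t ∉ S := fun h => htU (Or.inl h)
    by_cases htW : t ∈ W
    · have htT : t ∈ T := hWST t htW htZ htS
      rcases hsU with hs | ⟨s', hs', r, hr, hrW, hsr⟩
      · exact hlink s hs t htT (Or.inl hst)
      · exact hlink s' hs' t htT (Or.inr ⟨compIn G Wᶜ r, ConnOn.compIn _ _,
          Set.disjoint_left.2 fun v hv hv' => hv'.1 hv, ⟨r, mem_compIn_self hrW, hr⟩, s, hsr, hst⟩)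
    · refine htU (Or.inr ?_)
      rcases hsU with hs | ⟨s', hs', r, hr, hrW, hsr⟩
      · exact ⟨s, hs, t, hst, htW, mem_compIn_self htW⟩
      · exact ⟨s', hs', r, hr, hrW, mem_compIn_of_adj hsr hst htW⟩

/-- In the absence of rooted triples, the two paths are single edges and their ends induce a
complete graph. -/
theorem Linkage.length_eq_one (L : Linkage G a b c d α β n m) (H : NoRooted G a b c d)
    (hnosep : ∀ Z : Set V, Z.ncard = 2 → ¬ SeparatesEdges G a b c d Z)
    (hn : 0 < n) (hm : 0 < m) :
    n = 1 ∧ m = 1 ∧ G.Adj a d ∧ G.Adj b c := by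
  have cross : ∀ i j, i ≤ n → j ≤ m → (0 < i ∨ 0 < j) → (i < n ∨ j < m) →
      (∃ j' ≤ m, G.Adj (α i) (β j')) → (∃ i' ≤ n, G.Adj (α i') (β j)) →
      ∃ p ≤ n, ∃ q ≤ m, G.Adj (α p) (β q) ∧ (p < i ∧ j < q ∨ i < p ∧ q < j) :=
    fun i j hi hj h0 h1 h h' =>
      L.exists_crossing H hnosep hi hj h0 h1 (Or.inr (Or.inr h)) (Or.inr (Or.inr h'))
  obtain ⟨p, hp, q, hq, hpq, hlt⟩ := L.exists_crossing H hnosep (Nat.zero_le n) (le_refl m)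
    (Or.inr hm) (Or.inl hn) (Or.inl rfl) (Or.inr (Or.inl rfl))
  obtain ⟨p', hp', q', hq', hpq', hlt'⟩ := cross p q hp hq (by omega) (by omega)
    ⟨q, hq, hpq⟩ ⟨p, hp, hpq⟩
  obtain ⟨i, j, hi, hj, h1, h2⟩ : ∃ i j, i + 1 ≤ n ∧ j + 1 ≤ m ∧ G.Adj (α i) (β (j + 1)) ∧
      G.Adj (α (i + 1)) (β j) := by
    rcases hlt' with ⟨h, h'⟩ | ⟨h, h'⟩
    · obtain ⟨rfl, rfl⟩ := L.consecutive H h h' hp hq' hpq' hpq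
      exact ⟨p', q, hp, hq', hpq', hpq⟩
    · obtain ⟨rfl, rfl⟩ := L.consecutive H h h' hp' hq hpq hpq'
      exact ⟨p, q', hp', hq, hpq, hpq'⟩
  have h00 : i = 0 ∧ j = 0 := by
    by_contra hne
    obtain ⟨k, hk, l, hl, hkl, hc | hc⟩ := cross i j (by omega) (by omega) (by omega) (by omega)
      ⟨_, hj, h1⟩ ⟨_, hi, h2⟩
    · have := L.consecutive H (show k < i + 1 by omega) hc.2 hi hl hkl h2
      omega
    · have := L.consecutive H hc.1 (show l < j + 1 by omega) hk hj h1 hkl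
      omega
  have hnm : i + 1 = n ∧ j + 1 = m := by
    by_contra hne
    obtain ⟨k, hk, l, hl, hkl, hc | hc⟩ := cross (i + 1) (j + 1) hi hj (by omega) (by omega)
      ⟨_, by omega, h2⟩ ⟨_, by omega, h1⟩
    · have := L.consecutive H hc.1 (show j < l by omega) hi hl hkl h2
      omega
    · have := L.consecutive H (show i < k by omega) hc.2 hk hj h1 hkl
      omega
  obtain ⟨rfl, rfl⟩ := h00
  obtain ⟨rfl, rfl⟩ := hnm
  rw [L.α_zero, L.β_last] at h1
  rw [L.α_last, L.β_zero] at h2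
  exact ⟨rfl, rfl, h1, h2.symm⟩

end Linkage

section Main

variable {V : Type} {G : SimpleGraph V} {a b c d : V}

theorem NoRooted.of_not_theta [DecidableEq V] (hab : G.Adj a b) (hcd : G.Adj c d)
    (h : ¬ ContainsEfTheta G s(a, b) s(c, d)) : NoRooted G a b c d := by
  rintro X Y R hX hY hR hXY hXR hYR ha hb (⟨hc, hd⟩ | ⟨hd, hc⟩) hx hy
  · exact h (containsEfTheta_of_rooted hab hcd hX hY hR hXY hXR hYR ha hc hb hd hx hy)
  · rw [Sym2.eq_swap (a := c)] at h
    exact h (containsEfTheta_of_rooted hab hcd.symm hX hY hR hXY hXR hYR ha hd hb hc hx hy)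

/-- Two edges with a common end `a` of degree at least three lie in a theta. -/
theorem containsEfTheta_of_common [DecidableEq V] {w : V} (h2 : ∀ v, ConnOn G {v}ᶜ)
    (hab : G.Adj a b) (had : G.Adj a d) (haw : G.Adj a w)
    (hwb : w ≠ b) (hwd : w ≠ d)
    (hnosep : ∀ Z : Set V, Z.ncard = 2 → ¬ SeparatesEdges G a b a d Z) :
    ContainsEfTheta G s(a, b) s(a, d) := by
  have hbZ : b ∈ ({a, w} : Set V)ᶜ := by simp [hab.ne', hwb.symm]
  have hdZ : d ∈ ({a, w} : Set V)ᶜ := by simp [had.ne', hwd.symm]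
  have hreach : ReachIn G ({a, w} : Set V)ᶜ b d := by
    by_contra hno
    refine hnosep {a, w} (Set.ncard_pair haw.ne) ⟨⟨b, Or.inr rfl, hbZ⟩, ⟨d, Or.inr rfl, hdZ⟩, ?_⟩
    rintro p q ⟨hp, hpZ⟩ ⟨hq, hqZ⟩ h
    have hpb : (p : V) = b := hp.resolve_left fun h => hpZ (Or.inl h)
    have hqd : (q : V) = d := hq.resolve_left fun h => hqZ (Or.inl h)
    exact hno (hpb ▸ hqd ▸ reachIn_of_reachable_induce h)
  set Y := compIn G ({a, w} : Set V)ᶜ b with hY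
  have haY : a ∉ Y := fun h => h.1 (Or.inl rfl)
  have hwY : w ∉ Y := fun h => h.1 (Or.inr rfl)
  have hbY : b ∈ Y := mem_compIn_self hbZ
  have hwS : w ∈ ({a} ∪ Y)ᶜ := by
    rintro (h | h)
    · exact haw.ne' h
    · exact hwY h
  obtain ⟨s, t, hst, -, ht, hsR, htR⟩ := (h2 a w haw.ne' b hab.ne').exists_exit
    (U := compIn G ({a} ∪ Y)ᶜ w) (mem_compIn_self hwS) (fun h => h.1 (Or.inr hbY))
  have htY : t ∈ Y := by_contra fun h =>
    htR (mem_compIn_of_adj hsR hst fun h' => h'.elim ht h)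
  exact containsEfTheta_of_rooted hab had (ConnOn.singleton a) (ConnOn.compIn _ _)
    (ConnOn.compIn ({a} ∪ Y)ᶜ w) (Set.disjoint_singleton_left.2 haY)
    (Set.disjoint_left.2 fun v hv hv' => hv'.1 (Or.inl hv))
    (Set.disjoint_left.2 fun v hv hv' => hv'.1 (Or.inr hv)) rfl rfl hbY ⟨hdZ, hreach⟩
    ⟨a, rfl, w, mem_compIn_self hwS, haw⟩ ⟨t, htY, s, hsR, hst.symm⟩

theorem SeparatesEdges.swap_left {Z : Set V} (h : SeparatesEdges G b a c d Z) :
    SeparatesEdges G a b c d Z := by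
  unfold SeparatesEdges
  rwa [Set.pair_comm a b]

theorem SeparatesEdges.swap_right {Z : Set V} (h : SeparatesEdges G a b d c Z) :
    SeparatesEdges G a b c d Z := by
  unfold SeparatesEdges
  rwa [Set.pair_comm c d]

theorem exists_adj_of_degree_ne_two [Fintype V] [DecidableEq V] [DecidableRel G.Adj]
    (hab : G.Adj a b) (had : G.Adj a d) (hbd : b ≠ d) (h : G.degree a ≠ 2) :
    ∃ w, G.Adj a w ∧ w ≠ b ∧ w ≠ d := by
  by_contra! hno
  refine h ?_
  rw [← SimpleGraph.card_neighborFinset_eq_degree, ← Finset.card_pair hbd]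
  congr 1
  ext x
  simp only [SimpleGraph.mem_neighborFinset, Finset.mem_insert, Finset.mem_singleton]
  constructor
  · intro hx
    by_contra! hx'
    exact hx'.2 (hno x hx hx'.1)
  · rintro (rfl | rfl)
    · exact hab
    · exact had

theorem Linkage.exists_of_connOn [DecidableEq V] {X Y : Set V} (hX : ConnOn G X)
    (hY : ConnOn G Y) (hXY : Disjoint X Y) (ha : a ∈ X) (hc : c ∈ X) (hb : b ∈ Y) (hd : d ∈ Y) :
    ∃ α β n m, Linkage G a b c d α β n m := by
  obtain ⟨A, hA, hAX⟩ := (hX a ha c hc).exists_path ha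
  obtain ⟨B, hB, hBY⟩ := (hY b hb d hd).exists_path hb
  exact ⟨A.getVert, B.getVert, A.length, B.length,
    { α_zero := A.getVert_zero
      α_last := A.getVert_length
      β_zero := B.getVert_zero
      β_last := B.getVert_length
      α_adj := fun i hi => A.adj_getVert_succ hi
      β_adj := fun i hi => B.adj_getVert_succ hi
      α_inj := fun i hi j hj h => hA.getVert_injOn hi hj h
      β_inj := fun i hi j hj h => hB.getVert_injOn hi hj h
      disj := fun i _ j _ h => Set.disjoint_left.1 hXY (hAX _ (A.getVert_mem_support i))
        (h ▸ hBY _ (B.getVert_mem_support j)) }⟩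

theorem NoRooted.eq_of_complete (H : NoRooted G a b c d) (h2 : ∀ v, ConnOn G {v}ᶜ)
    (hab : a ≠ b) (hac : G.Adj a c) (hbd : G.Adj b d) (had : G.Adj a d) (hbc : G.Adj b c)
    (hcd : c ≠ d) (w : V) : w ∈ ({a, b, c, d} : Set V) := by
  by_contra hw
  set Q : Set V := {a, b, c, d} with hQ
  set R := compIn G Qᶜ w with hR
  have hwR : w ∈ R := mem_compIn_self hw
  have hRQ : ∀ q ∈ Q, q ∉ R := fun q hq h => h.1 hq
  have hnbr : ∀ q ∈ Q, ∃ q' ∈ Q, q' ≠ q ∧ ∃ r ∈ R, G.Adj q' r := by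
    intro q hq
    obtain ⟨z, hz, hzq⟩ : ∃ z ∈ Q, z ≠ q := by
      by_cases h : a = q
      · exact ⟨b, by simp [hQ], fun h' => hab (h.trans h'.symm)⟩
      · exact ⟨a, by simp [hQ], h⟩
    obtain ⟨s, t, hst, -, ht, hsR, htR⟩ := (h2 q w (fun h => hw (h ▸ hq)) z hzq).exists_exit
      hwR (hRQ z hz)
    exact ⟨t, by_contra fun h => htR (mem_compIn_of_adj hsR hst h), ht, s, hsR, hst.symm⟩
  obtain ⟨q₁, hq₁, -, hN₁⟩ := hnbr a (by simp [hQ])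
  obtain ⟨q₂, hq₂, hne, hN₂⟩ := hnbr q₁ hq₁
  have hd : ∀ x ∈ Q, ∀ y ∈ Q, Disjoint {x, y} R := by
    intro x hx y hy
    rw [Set.disjoint_left]
    rintro _ (rfl | rfl)
    · exact hRQ _ hx
    · exact hRQ _ hy
  have h1 := H {a, c} {b, d} R (.pair hac) (.pair hbd) (.compIn _ _)
    (by simp [hab.symm, had.ne', hbc.ne, hcd.symm])
    (hd a (by simp [hQ]) c (by simp [hQ])) (hd b (by simp [hQ]) d (by simp [hQ]))
    (by simp) (by simp) (by simp)
  have h3 := H {a, d} {b, c} R (.pair had) (.pair hbc) (.compIn _ _)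
    (by simp [hab.symm, hac.ne', hbd.ne, hcd])
    (hd a (by simp [hQ]) d (by simp [hQ])) (hd b (by simp [hQ]) c (by simp [hQ]))
    (by simp) (by simp) (by simp)
  simp only [Set.mem_insert_iff, Set.mem_singleton_iff, exists_eq_or_imp, exists_eq_left] at h1 h3
  rcases hq₁ with rfl | rfl | rfl | rfl <;> rcases hq₂ with rfl | rfl | rfl | rfl <;>
    first
      | exact hne rfl
      | solve_by_elim only [h1, h3, hN₁, hN₂, Or.inl, Or.inr]

theorem nonempty_iso_top_four [Fintype V] [DecidableEq V] (hab : G.Adj a b) (hcd : G.Adj c d)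
    (hac : G.Adj a c) (hbd : G.Adj b d) (had : G.Adj a d) (hbc : G.Adj b c)
    (hall : ∀ w : V, w ∈ ({a, b, c, d} : Set V)) :
    Nonempty (G ≃g (⊤ : SimpleGraph (Fin 4))) := by
  have htop : G = ⊤ := by
    ext x y
    rw [SimpleGraph.top_adj]
    refine ⟨fun h => h.ne, fun h => ?_⟩
    rcases hall x with rfl | rfl | rfl | rfl <;> rcases hall y with rfl | rfl | rfl | rfl <;>
      first | exact absurd rfl h | assumption | (apply SimpleGraph.Adj.symm; assumption)
  have hcard : Fintype.card V = 4 := by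
    have : (Finset.univ : Finset V) = {a, b, c, d} := by
      ext w
      simpa using hall w
    rw [← Finset.card_univ, this]
    simp [Finset.card_insert_of_notMem, hab.ne, hac.ne, had.ne, hbc.ne, hbd.ne, hcd.ne]
  subst htop
  exact ⟨SimpleGraph.Iso.completeGraph (Fintype.equivFinOfCardEq hcard)⟩

/-- Disjoint edges that lie in no theta and are not separated by a pair of vertices force the
graph to be complete on four vertices. -/
theorem nonempty_iso_of_not_theta [Fintype V] [DecidableEq V] (h2 : ∀ v, ConnOn G {v}ᶜ)
    (hab : G.Adj a b) (hcd : G.Adj c d) (hac : a ≠ c) (had : a ≠ d) (hbc : b ≠ c) (hbd : b ≠ d)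
    (hnosep : ∀ Z : Set V, Z.ncard = 2 → ¬ SeparatesEdges G a b c d Z)
    (h : ¬ ContainsEfTheta G s(a, b) s(c, d)) :
    Nonempty (G ≃g (⊤ : SimpleGraph (Fin 4))) := by
  obtain ⟨X, Y, hX, hY, hXY, ha, hb, hXY'⟩ := exists_connOn_split h2 hab.ne hac had hbc hcd.ne
  wlog hc : c ∈ X ∧ d ∈ Y generalizing c d
  · refine this hcd.symm had hac hbd hbc (fun Z hZ hs => hnosep Z hZ hs.swap_right) ?_ hXY'.symm
      (hXY'.resolve_left hc)
    rwa [Sym2.eq_swap (a := d)]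
  obtain ⟨α, β, n, m, L⟩ := Linkage.exists_of_connOn hX hY hXY ha hc.1 hb hc.2
  have H := NoRooted.of_not_theta hab hcd h
  have hn : 0 < n := by
    refine Nat.pos_of_ne_zero ?_
    rintro rfl
    exact hac (L.α_zero.symm.trans L.α_last)
  have hm : 0 < m := by
    refine Nat.pos_of_ne_zero ?_
    rintro rfl
    exact hbd (L.β_zero.symm.trans L.β_last)
  obtain ⟨rfl, rfl, hadj, hbcj⟩ := L.length_eq_one H hnosep hn hm
  have hacj : G.Adj a c := L.α_zero ▸ L.α_last ▸ L.α_adj 0 one_pos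
  have hbdj : G.Adj b d := L.β_zero ▸ L.β_last ▸ L.β_adj 0 one_pos
  exact nonempty_iso_top_four hab hcd hacj hbdj hadj hbcj
    (H.eq_of_complete h2 hab.ne hacj hbdj hadj hbcj hcd.ne)

end Main

theorem stmt_2 {V : Type} [Fintype V] [DecidableEq V] (G : SimpleGraph V) [DecidableRel G.Adj]
    (a b c d : V) (hab : G.Adj a b) (hcd : G.Adj c d) (hef : s(a, b) ≠ s(c, d))
    (h2c : TwoConnected G)
    (hnosep : ∀ Z : Set V, Z.ncard = 2 → ¬ SeparatesEdges G a b c d Z) :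
    ContainsEfTheta G s(a, b) s(c, d) ∨
      (∃ v : V, (v = a ∨ v = b) ∧ (v = c ∨ v = d) ∧ G.degree v = 2) ∨
      ((({a, b} : Set V) ∩ ({c, d} : Set V) = ∅) ∧
        Nonempty (G ≃g (⊤ : SimpleGraph (Fin 4)))) := by
  have h2 : ∀ v, ConnOn G {v}ᶜ := fun v => ConnOn.of_induce (h2c.2.2 v)
  by_cases hθ : ContainsEfTheta G s(a, b) s(c, d)
  · exact Or.inl hθ
  by_cases hdisj : a ≠ c ∧ a ≠ d ∧ b ≠ c ∧ b ≠ d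
  · obtain ⟨hac, had, hbc, hbd⟩ := hdisj
    refine Or.inr (Or.inr ⟨?_, nonempty_iso_of_not_theta h2 hab hcd hac had hbc hbd hnosep hθ⟩)
    rw [← Set.disjoint_iff_inter_eq_empty]
    simp [hac.symm, had.symm, hbc.symm, hbd.symm]
  refine Or.inr (Or.inl ?_)
  wlog hac : a = c ∨ a = d generalizing a b
  · have hdisj' : ¬ (b ≠ c ∧ b ≠ d ∧ a ≠ c ∧ a ≠ d) := by tauto
    obtain ⟨v, h, h', h''⟩ := this b a hab.symm (by rwa [Sym2.eq_swap])
      (fun Z hZ hs => hnosep Z hZ hs.swap_left) (by rwa [Sym2.eq_swap]) hdisj' (by tauto)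
    exact ⟨v, h.symm, h', h''⟩
  wlog hac' : a = c generalizing c d
  · obtain ⟨v, h, h', h''⟩ := this d c hcd.symm (by rwa [Sym2.eq_swap (a := d)])
      (fun Z hZ hs => hnosep Z hZ hs.swap_right) (by rwa [Sym2.eq_swap (a := d)]) (by tauto)
      hac.symm (hac.resolve_left hac')
    exact ⟨v, h, h'.symm, h''⟩
  subst hac'
  refine ⟨a, Or.inl rfl, Or.inl rfl, by_contra fun hdeg => hθ ?_⟩
  have hbd : b ≠ d := fun h => hef (by rw [h])
  obtain ⟨w, haw, hwb, hwd⟩ := exists_adj_of_degree_ne_two hab hcd hbd hdeg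
  exact containsEfTheta_of_common h2 hab hcd haw hwb hwd hnosep
end

section
/- Let t ≥ 2 be an integer and let (G,w) be a weighted graph with G 2-connected. If G contains a path of weight strictly greater than (t−2)², then G contains a cycle of weight at least t, and moreover for every two distinct vertices u, v of G there is a u–v path P in G with 2·w(P) ≥ t. -/
open SimpleGraph

/-- The weight of a walk: the sum of the weights of its edges. -/
def walkWeight {V : Type} {G : SimpleGraph V} (w : Sym2 V → ℕ) {u v : V} (P : G.Walk u v) : ℕ :=
  (P.edges.map w).sum

section

namespace SimpleGraph

variable {V : Type} {G : SimpleGraph V}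

/-- Concatenating two paths which only meet in the common endpoint gives a path. -/
lemma Walk.IsPath.append_of_inter {u v x : V} {p : G.Walk u v} {q : G.Walk v x}
    (hp : p.IsPath) (hq : q.IsPath) (h : ∀ z ∈ p.support, z ∈ q.support → z = v) :
    (p.append q).IsPath := by
  induction p with
  | nil => exact hq
  | cons hadj p ih =>
    rw [Walk.cons_isPath_iff] at hp
    rw [Walk.cons_append, Walk.cons_isPath_iff]
    refine ⟨ih hp.1 hq fun z hz => h z (by simp [hz]), ?_⟩
    rw [Walk.mem_support_append_iff]
    rintro (hu | hu)
    · exact hp.2 hu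
    · have := h _ (by simp) hu
      subst this
      exact hp.2 p.end_mem_support

/-- A walk ending in `S` can be split at its first vertex in `S`. -/
lemma Walk.exists_append_first_mem_s3 (S : Set V) {u c : V} (p : G.Walk u c) (hc : c ∈ S) :
    ∃ s ∈ S, ∃ (q : G.Walk u s) (r : G.Walk s c), p = q.append r ∧
      ∀ z ∈ q.support, z ∈ S → z = s := by
  induction p with
  | nil => exact ⟨_, hc, .nil, .nil, rfl, by simp⟩
  | @cons a b c hadj p ih =>
    by_cases ha : a ∈ S
    · exact ⟨a, ha, .nil, .cons hadj p, rfl, by simp⟩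
    · obtain ⟨s, hs, q, r, rfl, hq⟩ := ih hc
      refine ⟨s, hs, .cons hadj q, r, rfl, ?_⟩
      intro z hz hzS
      rw [Walk.support_cons, List.mem_cons] at hz
      rcases hz with rfl | hz
      · exact absurd hzS ha
      · exact hq z hz hzS

lemma exists_isPath_avoiding_of_induce_connected {v : V}
    (h : (G.induce ({v}ᶜ : Set V)).Connected) {a b : V} (ha : a ≠ v) (hb : b ≠ v) :
    ∃ p : G.Walk a b, p.IsPath ∧ v ∉ p.support := by
  classical
  obtain ⟨p⟩ := h.preconnected ⟨a, ha⟩ ⟨b, hb⟩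
  let q : G.Walk a b := p.map (Embedding.induce ({v}ᶜ : Set V)).toHom
  have hq : v ∉ q.support := by
    rw [show q.support = p.support.map Subtype.val from Walk.support_map _ p, List.mem_map]
    rintro ⟨z, -, hz⟩
    exact z.2 hz
  exact ⟨q.bypass, q.bypass_isPath, fun hv => hq (q.support_bypass_subset_support hv)⟩

end SimpleGraph

variable {V : Type} {G : SimpleGraph V}

lemma TwoConnected.exists_isPath_avoiding [Fintype V] (h : TwoConnected G) {a b v : V}
    (ha : a ≠ v) (hb : b ≠ v) : ∃ p : G.Walk a b, p.IsPath ∧ v ∉ p.support :=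
  exists_isPath_avoiding_of_induce_connected (h.2.2 v) ha hb

lemma TwoConnected.exists_adj_ne [Fintype V] (h : TwoConnected G) {x y : V} (hxy : x ≠ y) :
    ∃ z, G.Adj x z ∧ z ≠ y := by
  classical
  obtain ⟨z, hz⟩ : ∃ z, z ∉ ({x, y} : Finset V) := by
    by_contra! hall
    have h1 : Fintype.card V ≤ ({x, y} : Finset V).card :=
      Finset.card_le_card fun a _ => hall a
    have h2 := h.2.1
    have h3 := Finset.card_le_two (a := x) (b := y)
    omega
  simp only [Finset.mem_insert, Finset.mem_singleton, not_or] at hz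
  obtain ⟨p, -, hp⟩ := h.exists_isPath_avoiding hxy hz.2
  cases p with
  | nil => exact absurd rfl hz.1
  | @cons _ b _ hadj p =>
    refine ⟨b, hadj, ?_⟩
    rintro rfl
    exact hp (by simp)

/-- Two disjoint walks link `u` and `v` to `S`. -/
def LinkedTo (G : SimpleGraph V) (S : Set V) (u v : V) : Prop :=
  ∃ c ∈ S, ∃ d ∈ S, ∃ (p : G.Walk u c) (q : G.Walk v d), p.IsPath ∧ q.IsPath ∧
    p.support.Disjoint q.support

lemma LinkedTo.of_walks {S : Set V} {u v c d : V} (hc : c ∈ S) (hd : d ∈ S)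
    (p : G.Walk u c) (q : G.Walk v d) (h : ∀ z ∈ p.support, z ∉ q.support) :
    LinkedTo G S u v := by
  classical
  exact ⟨c, hc, d, hd, p.bypass, q.bypass, p.bypass_isPath, q.bypass_isPath, fun z hz hz' =>
    h z (p.support_bypass_subset_support hz) (q.support_bypass_subset_support hz')⟩

/-- Moving one of the two linked vertices to a neighbour. -/
lemma LinkedTo.of_adj [Fintype V] (h : TwoConnected G) {S : Set V} (hS : S.Nontrivial)
    {u x y : V} (hux : u ≠ x) (hxy : G.Adj x y) (hl : LinkedTo G S u y) :
    LinkedTo G S u x := by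
  classical
  obtain ⟨c, hc, d, hd, p, q, hp, hq, hpq⟩ := hl
  by_cases hxp : x ∈ p.support
  swap
  · refine .of_walks hc hd p (.cons hxy q) fun z hz hz' => ?_
    rw [Walk.support_cons, List.mem_cons] at hz'
    rcases hz' with rfl | hz'
    · exact hxp hz
    · exact hpq hz hz'
  have hxq : x ∉ q.support := fun hx => hpq hxp hx
  obtain ⟨p₁, p₂, rfl⟩ := Walk.mem_support_iff_exists_append.mp hxp
  obtain ⟨e, he, hex⟩ := hS.exists_ne x
  obtain ⟨T, -, hT⟩ := h.exists_isPath_avoiding hux hex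
  obtain ⟨s, hs, T₁, T₂, rfl, hT₁⟩ := T.exists_append_first_mem_s3
    (S ∪ {z | z ∈ p₂.support} ∪ {z | z ∈ q.support}) (.inl (.inl he))
  have hxT : x ∉ T₁.support := fun hx => hT (by simp [Walk.mem_support_append_iff, hx])
  by_cases hs₂ : s ∈ p₂.support
  · obtain ⟨r₁, r₂, rfl⟩ := Walk.mem_support_iff_exists_append.mp hs₂
    have hp₂ := hp.of_append_right
    have hxr : x ∉ r₂.support := fun hx => by
      cases r₁ with
      | nil => exact hxT T₁.end_mem_support
      | cons hadj r₁ =>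
        rw [Walk.cons_append, Walk.cons_isPath_iff] at hp₂
        exact hp₂.2 (by simp [Walk.mem_support_append_iff, hx])
    refine .of_walks hc hd (T₁.append r₂) (.cons hxy q) fun z hz hz' => ?_
    rw [Walk.support_cons, List.mem_cons] at hz'
    rw [Walk.mem_support_append_iff] at hz
    rcases hz' with rfl | hz'
    · exact hz.elim hxT hxr
    · rcases hz with hz | hz
      · obtain rfl := hT₁ z hz (.inr hz')
        exact hpq (a := z) (by simp [Walk.mem_support_append_iff]) hz'
      · exact hpq (a := z) (by simp [Walk.mem_support_append_iff, hz]) hz'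
  have key : ∀ z ∈ T₁.support, z ∉ p₂.support := fun z hz hz' => by
    obtain rfl := hT₁ z hz (.inl (.inr hz'))
    exact hs₂ hz'
  by_cases hsq : s ∈ q.support
  · obtain ⟨r₁, r₂, rfl⟩ := Walk.mem_support_iff_exists_append.mp hsq
    refine .of_walks hd hc (T₁.append r₂) p₂ fun z hz hz' => ?_
    rw [Walk.mem_support_append_iff] at hz
    rcases hz with hz | hz
    · exact key z hz hz'
    · exact hpq (a := z) (by simp [Walk.mem_support_append_iff, hz'])
        (by simp [Walk.mem_support_append_iff, hz])
  · have hsS : s ∈ S := by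
      rcases hs with (hs | hs) | hs
      · exact hs
      · exact absurd hs hs₂
      · exact absurd hs hsq
    exact .of_walks hsS hc T₁ p₂ key

/-- The case of two disjoint paths of Menger's theorem, from `{u, v}` to `S`. -/
lemma TwoConnected.linkedTo [Fintype V] (h : TwoConnected G) {S : Set V} (hS : S.Nontrivial)
    {u v : V} (huv : u ≠ v) : LinkedTo G S u v := by
  obtain ⟨d, hd, hdu⟩ := hS.exists_ne u
  obtain ⟨R, -, hR⟩ := h.exists_isPath_avoiding huv.symm hdu
  clear huv
  induction R with
  | @nil d =>
    obtain ⟨c, hc, hcd⟩ := hS.exists_ne d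
    obtain ⟨p, -, hpd⟩ := h.exists_isPath_avoiding hdu.symm hcd
    exact .of_walks hc hd p .nil fun z hz hz' => hpd (by simp_all)
  | cons hadj R ih =>
    rw [Walk.support_cons, List.mem_cons, not_or] at hR
    exact (ih hd hdu hR.2).of_adj h hS hR.1 hadj

/-- The linking paths may be chosen to meet `S` only in their last vertices. -/
lemma LinkedTo.exists_first {S : Set V} {u v : V} (h : LinkedTo G S u v) :
    ∃ c ∈ S, ∃ d ∈ S, ∃ (p : G.Walk u c) (q : G.Walk v d), p.IsPath ∧ q.IsPath ∧
      (∀ z ∈ p.support, z ∉ q.support) ∧ (∀ z ∈ p.support, z ∈ S → z = c) ∧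
      (∀ z ∈ q.support, z ∈ S → z = d) := by
  obtain ⟨c, hc, d, hd, p, q, hp, hq, hpq⟩ := h
  obtain ⟨c', hc', p₁, p₂, rfl, hp₁⟩ := p.exists_append_first_mem_s3 S hc
  obtain ⟨d', hd', q₁, q₂, rfl, hq₁⟩ := q.exists_append_first_mem_s3 S hd
  exact ⟨c', hc', d', hd', p₁, q₁, hp.of_append_left, hq.of_append_left,
    fun z hz hz' => hpq (a := z) (by simp [Walk.mem_support_append_iff, hz])
      (by simp [Walk.mem_support_append_iff, hz']), hp₁, hq₁⟩

/-- Any two vertices of a 2-connected graph lie on a common cycle. -/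
lemma TwoConnected.exists_isCycle_mem_mem [Fintype V] (h : TwoConnected G) {x y : V}
    (hxy : x ≠ y) : ∃ (r : V) (C : G.Walk r r), C.IsCycle ∧ x ∈ C.support ∧ y ∈ C.support := by
  obtain ⟨x', hxx', hx'y⟩ := h.exists_adj_ne hxy
  obtain ⟨y', hyy', -⟩ := h.exists_adj_ne hxy.symm
  have hS : ({x, x'} : Set V).Nontrivial := Set.nontrivial_pair hxx'.ne
  obtain ⟨c, hc, d, hd, p, q, hp, hq, hpq⟩ := h.linkedTo hS hyy'.ne
  have hcd : c ≠ d := by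
    rintro rfl
    exact hpq p.end_mem_support q.end_mem_support
  simp only [Set.mem_insert_iff, Set.mem_singleton_iff] at hc hd
  have hadj : G.Adj c d := by
    rcases hc with rfl | rfl <;> rcases hd with rfl | rfl
    · exact absurd rfl hcd
    · exact hxx'
    · exact hxx'.symm
    · exact absurd rfl hcd
  have hne : s(y', y) ≠ s(c, d) := by
    rw [Ne, Sym2.eq_iff]
    grind
  have hpath : (p.append (.cons hadj q.reverse)).IsPath := by
    refine hp.append_of_inter ?_ ?_
    · rw [Walk.cons_isPath_iff]
      refine ⟨hq.reverse, fun hcq => ?_⟩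
      exact hpq p.end_mem_support (by simpa using hcq)
    · intro z hz hz'
      simp only [Walk.support_cons, Walk.support_reverse, List.mem_cons, List.mem_reverse] at hz'
      exact hz'.resolve_right fun hz' => hpq hz hz'
  refine ⟨y', .cons hyy'.symm (p.append (.cons hadj q.reverse)), ?_, ?_, ?_⟩
  · rw [Walk.cons_isCycle_iff]
    refine ⟨hpath, fun he => ?_⟩
    simp only [Walk.edges_append, Walk.edges_cons, Walk.edges_reverse, List.mem_append,
      List.mem_cons, List.mem_reverse] at he
    rcases he with he | he | he
    · exact hpq (p.fst_mem_support_of_mem_edges he) q.start_mem_support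
    · exact hne he
    · exact hpq p.start_mem_support (q.snd_mem_support_of_mem_edges he)
  · simp only [Walk.support_cons, List.mem_cons, Walk.mem_support_append_iff]
    have hcp := p.end_mem_support
    have hdq : d ∈ q.reverse.support := by simp
    grind
  · simp

@[simp] lemma walkWeight_cons (w : Sym2 V → ℕ) {u v x : V} (h : G.Adj u v) (p : G.Walk v x) :
    walkWeight w (.cons h p) = w s(u, v) + walkWeight w p := by
  simp [walkWeight]

@[simp] lemma walkWeight_append (w : Sym2 V → ℕ) {u v x : V} (p : G.Walk u v) (q : G.Walk v x) :
    walkWeight w (p.append q) = walkWeight w p + walkWeight w q := by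
  simp [walkWeight]

@[simp] lemma walkWeight_reverse (w : Sym2 V → ℕ) {u v : V} (p : G.Walk u v) :
    walkWeight w p.reverse = walkWeight w p := by
  simp [walkWeight, List.sum_reverse]

lemma length_le_walkWeight {w : Sym2 V → ℕ} (hw : ∀ e ∈ G.edgeSet, 1 ≤ w e) {u v : V}
    (p : G.Walk u v) : p.length ≤ walkWeight w p := by
  induction p with
  | nil => simp
  | cons h p ih =>
    have := hw _ (G.mem_edgeSet.mpr h)
    rw [walkWeight_cons, Walk.length_cons]
    omega

/-- Two distinct vertices split a cycle into two paths. -/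
lemma SimpleGraph.Walk.IsCycle.exists_arcs {r : V} {C : G.Walk r r} (hC : C.IsCycle)
    (w : Sym2 V → ℕ) {a b : V} (ha : a ∈ C.support) (hb : b ∈ C.support) (hab : a ≠ b) :
    ∃ p q : G.Walk a b, p.IsPath ∧ q.IsPath ∧ p.support ⊆ C.support ∧ q.support ⊆ C.support ∧
      walkWeight w p + walkWeight w q = walkWeight w C ∧ p.length + q.length = C.length := by
  classical
  have hD := hC.rotate ha
  have hDe := C.rotate_edges a ha
  have hDs : ∀ z, z ∈ (C.rotate a ha).support ↔ z ∈ C.support := fun z =>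
    C.mem_support_rotate_iff a ha
  have hDw : walkWeight w (C.rotate a ha) = walkWeight w C :=
    (hDe.perm.map w).sum_eq
  have hDl : (C.rotate a ha).length = C.length := by
    simp
  generalize C.rotate a ha = D at *
  obtain ⟨p, q, rfl⟩ := Walk.mem_support_iff_exists_append.mp ((hDs b).mpr hb)
  have hp : ¬ p.Nil := fun hn => hab hn.eq
  have hq : ¬ q.Nil := fun hn => hab hn.eq.symm
  refine ⟨p, q.reverse, hD.isPath_of_append_left hq, (hD.isPath_of_append_right hp).reverse,
    fun z hz => (hDs z).mp (by simp [Walk.mem_support_append_iff, hz]), fun z hz => (hDs z).mp ?_,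
    by simpa using hDw, by simpa using hDl⟩
  rw [Walk.support_reverse, List.mem_reverse] at hz
  simp [Walk.mem_support_append_iff, hz]

/-- If every subpath whose ends are its only vertices in `S` has weight at most `B`, then a path
between vertices of `S` which meets `S` in `k` vertices has weight at most `B * (k - 1)`. -/
lemma walkWeight_add_le_of_ears [DecidableEq V] (w : Sym2 V → ℕ) (S : Finset V) (B : ℕ)
    (hear : ∀ a ∈ S, ∀ b ∈ S, a ≠ b → ∀ E : G.Walk a b, E.IsPath →
      (∀ z ∈ E.support, z ∈ S → z = a ∨ z = b) → walkWeight w E ≤ B)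
    {x y : V} (P : G.Walk x y) (hP : P.IsPath) (hx : x ∈ S) (hy : y ∈ S) :
    walkWeight w P + B ≤ B * (S.filter (· ∈ P.support)).card := by
  induction hn : P.length using Nat.strong_induction_on generalizing x P with
  | _ n ih =>
  subst hn
  cases P with
  | nil =>
    have : 1 ≤ (S.filter (· ∈ (Walk.nil : G.Walk y y).support)).card :=
      Finset.card_pos.mpr ⟨y, by simp [hy]⟩
    simpa [walkWeight] using Nat.mul_le_mul_left B this
  | cons hadj P =>
    obtain ⟨s, hs, q, r, rfl, hq⟩ := P.exists_append_first_mem_s3 (S : Set V) hy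
    rw [Walk.cons_isPath_iff, Walk.mem_support_append_iff, not_or] at hP
    obtain ⟨hqr, hxq, hxr⟩ := hP
    have h1 := ih r.length (by simp) r hqr.of_append_right hs rfl
    have h2 := hear x hx s hs (fun hxs => hxq (hxs ▸ q.end_mem_support)) (.cons hadj q)
      ((Walk.cons_isPath_iff _ _).mpr ⟨hqr.of_append_left, hxq⟩) (by
        intro z hz hzS
        rw [Walk.support_cons, List.mem_cons] at hz
        exact hz.imp_right fun hz => hq z hz hzS)
    have h3 : (S.filter (· ∈ r.support)).card + 1 ≤
        (S.filter (· ∈ (Walk.cons hadj (q.append r)).support)).card := by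
      rw [← Finset.card_insert_of_notMem (a := x) (by simp [hxr])]
      refine Finset.card_le_card fun z hz => ?_
      simp only [Finset.mem_insert, Finset.mem_filter] at hz
      simp only [Finset.mem_filter, Walk.support_cons, List.mem_cons, Walk.mem_support_append_iff]
      grind
    have h4 := Nat.mul_le_mul_left B h3
    rw [mul_add, mul_one] at h4
    rw [walkWeight_cons] at h2 ⊢
    rw [walkWeight_append]
    omega

/-- A path between two vertices of a cycle and otherwise disjoint from it lies on a cycle with at
least one further edge. -/
lemma SimpleGraph.Walk.IsCycle.exists_isCycle_of_ear {w : Sym2 V → ℕ}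
    (hw : ∀ e ∈ G.edgeSet, 1 ≤ w e) {r : V} {C : G.Walk r r} (hC : C.IsCycle) {a b : V}
    (ha : a ∈ C.support) (hb : b ∈ C.support) (hab : a ≠ b) (E : G.Walk a b) (hE : E.IsPath)
    (hES : ∀ z ∈ E.support, z ∈ C.support → z = a ∨ z = b) :
    ∃ (r' : V) (C' : G.Walk r' r'), C'.IsCycle ∧ walkWeight w E + 1 ≤ walkWeight w C' := by
  obtain ⟨A, hA, hAC, hAl⟩ : ∃ A : G.Walk a b, A.IsPath ∧ A.support ⊆ C.support ∧
      2 ≤ A.length := by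
    obtain ⟨p, q, hp, hq, hpC, hqC, -, hl⟩ := hC.exists_arcs w ha hb hab
    have := hC.three_le_length
    by_cases h : 2 ≤ p.length
    · exact ⟨p, hp, hpC, h⟩
    · exact ⟨q, hq, hqC, by omega⟩
  cases A with
  | nil => simp at hAl
  | @cons _ c _ hadj A =>
    rw [Walk.cons_isPath_iff] at hA
    have hcb : c ≠ b := by
      rintro rfl
      rw [(Walk.isPath_iff_nil.mp hA.1).eq_nil] at hAl
      simp at hAl
    have hAC' : ∀ z ∈ A.support, z ∈ C.support := fun z hz => hAC (by simp [hz])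
    have hcE : c ∉ E.support := fun hc =>
      (hES c hc (hAC' c A.start_mem_support)).elim hadj.ne' hcb
    have hpath : (A.append E.reverse).IsPath := by
      refine hA.1.append_of_inter hE.reverse fun z hz hz' => ?_
      rw [Walk.support_reverse, List.mem_reverse] at hz'
      refine (hES z hz' (hAC' z hz)).resolve_left ?_
      rintro rfl
      exact hA.2 hz
    refine ⟨a, .cons hadj (A.append E.reverse), ?_, ?_⟩
    · rw [Walk.cons_isCycle_iff]
      refine ⟨hpath, fun he => ?_⟩
      simp only [Walk.edges_append, Walk.edges_reverse, List.mem_append, List.mem_reverse] at he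
      rcases he with he | he
      · exact hA.2 (A.fst_mem_support_of_mem_edges he)
      · exact hcE (E.snd_mem_support_of_mem_edges he)
    · have := hw _ (G.mem_edgeSet.mpr hadj)
      rw [walkWeight_cons, walkWeight_append, walkWeight_reverse]
      omega

lemma TwoConnected.exists_isCycle_le_walkWeight [Fintype V] (h : TwoConnected G)
    {w : Sym2 V → ℕ} (hw : ∀ e ∈ G.edgeSet, 1 ≤ w e) {t : ℕ} (ht : 2 ≤ t) {x y : V}
    (P : G.Walk x y) (hP : P.IsPath) (hwP : (t - 2) ^ 2 < walkWeight w P) :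
    ∃ (r : V) (C : G.Walk r r), C.IsCycle ∧ t ≤ walkWeight w C := by
  classical
  by_contra! hlt
  have hxy : x ≠ y := by
    rintro rfl
    rw [(Walk.isPath_iff_nil.mp hP).eq_nil] at hwP
    simp [walkWeight] at hwP
  obtain ⟨r, C, hC, hx, hy⟩ := h.exists_isCycle_mem_mem hxy
  have hcard : C.support.toFinset.card ≤ t - 1 := by
    have h1 : C.support.toFinset ⊆ C.support.tail.toFinset := fun z hz => by
      rw [List.mem_toFinset] at hz ⊢
      rw [Walk.mem_support_iff] at hz
      rcases hz with rfl | hz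
      · exact Walk.end_mem_tail_support hC.not_nil
      · exact hz
    have h2 := (Finset.card_le_card h1).trans (List.toFinset_card_le _)
    have h3 := length_le_walkWeight hw C
    have h4 := hlt r C hC
    rw [List.length_tail, Walk.length_support] at h2
    omega
  have hmain := walkWeight_add_le_of_ears w C.support.toFinset (t - 2) (by
    intro a ha b hb hab E hE hES
    simp only [List.mem_toFinset] at ha hb hES
    obtain ⟨r', C', hC', hE'⟩ := hC.exists_isCycle_of_ear hw ha hb hab E hE hES
    have := hlt r' C' hC'
    omega) P hP (by simpa using hx) (by simpa using hy)
  have hle := (Finset.card_filter_le C.support.toFinset (· ∈ P.support)).trans hcard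
  have hle' := hmain.trans (Nat.mul_le_mul_left (t - 2) hle)
  obtain ⟨k, rfl⟩ := Nat.exists_eq_add_of_le' ht
  simp only [Nat.add_sub_cancel, show k + 2 - 1 = k + 1 by omega] at hle' hwP
  nlinarith

lemma TwoConnected.exists_isPath_walkWeight_le_two_mul [Fintype V] (h : TwoConnected G)
    (w : Sym2 V → ℕ) {r : V} {C : G.Walk r r} (hC : C.IsCycle) {u v : V} (huv : u ≠ v) :
    ∃ P : G.Walk u v, P.IsPath ∧ walkWeight w C ≤ 2 * walkWeight w P := by
  have hS : {z | z ∈ C.support}.Nontrivial :=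
    ⟨r, C.start_mem_support, C.snd, C.getVert_mem_support 1, (C.adj_snd hC.not_nil).ne⟩
  obtain ⟨c, hc, d, hd, p, q, hp, hq, hpq, hpS, hqS⟩ := (h.linkedTo hS huv).exists_first
  have hcd : c ≠ d := by
    rintro rfl
    exact hpq c p.end_mem_support q.end_mem_support
  obtain ⟨A, hA, hAC, hAw⟩ : ∃ A : G.Walk c d, A.IsPath ∧ A.support ⊆ C.support ∧
      walkWeight w C ≤ 2 * walkWeight w A := by
    obtain ⟨a₁, a₂, h₁, h₂, hs₁, hs₂, hsum, -⟩ := hC.exists_arcs w hc hd hcd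
    rcases le_total (walkWeight w a₁) (walkWeight w a₂) with hle | hle
    · exact ⟨a₂, h₂, hs₂, by omega⟩
    · exact ⟨a₁, h₁, hs₁, by omega⟩
  refine ⟨p.append (A.append q.reverse), ?_, ?_⟩
  · refine hp.append_of_inter (hA.append_of_inter hq.reverse ?_) ?_
    · intro z hz hz'
      exact hqS z (by simpa using hz') (hAC hz)
    · intro z hz hz'
      rw [Walk.mem_support_append_iff, Walk.support_reverse, List.mem_reverse] at hz'
      rcases hz' with hz' | hz'
      · exact hpS z hz (hAC hz')
      · exact absurd hz' (hpq z hz)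
  · simp only [walkWeight_append]
    omega

end

theorem stmt_3 {V : Type} [Fintype V] (G : SimpleGraph V) (w : Sym2 V → ℕ)
    (hw : ∀ e ∈ G.edgeSet, 1 ≤ w e)
    (t : ℕ) (ht : 2 ≤ t) (h2c : TwoConnected G)
    (hpath : ∃ (u v : V) (P : G.Walk u v), P.IsPath ∧ (t - 2) ^ 2 < walkWeight w P) :
    (∃ (r : V) (C : G.Walk r r), C.IsCycle ∧ t ≤ walkWeight w C) ∧
      ∀ u v : V, u ≠ v → ∃ P : G.Walk u v, P.IsPath ∧ t ≤ 2 * walkWeight w P := by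
  obtain ⟨x, y, P, hP, hwP⟩ := hpath
  obtain ⟨r, C, hC, hCw⟩ := h2c.exists_isCycle_le_walkWeight hw ht P hP hwP
  refine ⟨⟨r, C, hC, hCw⟩, fun u v huv => ?_⟩
  obtain ⟨Q, hQ, hQw⟩ := h2c.exists_isPath_walkWeight_le_two_mul w hC huv
  exact ⟨Q, hQ, hCw.trans hQw⟩
end

section
/- Let d, p ≥ 1 be integers and let G be a simple connected graph whose number of vertices exceeds 1 + d + d(d−1) + d(d−1)² + ⋯ + d(d−1)^{p−1}. Then either G has a vertex of degree greater than d, or for every vertex v of G there is an induced path in G of length p + 1 having v as an endpoint. -/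
open SimpleGraph

namespace SimpleGraph

variable {V : Type*} {G : SimpleGraph V}

/-- A vertex at positive distance from `v` has a neighbor one step closer to `v`. -/
theorem Connected.exists_adj_dist_eq_of_dist_eq_succ (hconn : G.Connected) {v x : V} {k : ℕ}
    (hx : G.dist v x = k + 1) : ∃ y, G.Adj x y ∧ G.dist v y = k := by
  obtain ⟨P, hP⟩ := hconn.exists_walk_length_eq_dist x v
  rw [dist_comm, hx] at hP
  cases P with
  | nil => simp at hP
  | @cons _ y _ h Q =>
    refine ⟨y, h, ?_⟩
    have h₁ : G.dist v y ≤ Q.length := dist_comm (G := G) (u := v) ▸ dist_le Q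
    have h₂ : G.dist v x ≤ G.dist v y + G.dist y x := hconn.dist_triangle
    rw [dist_eq_one_iff_adj.2 h.symm] at h₂
    rw [Walk.length_cons] at hP
    omega

/-- All distances up to the eccentricity of `v` are attained. -/
theorem Connected.exists_dist_eq_of_le (hconn : G.Connected) {v : V} {k n : ℕ} (hkn : k ≤ n)
    (h : ∃ x, G.dist v x = n) : ∃ x, G.dist v x = k := by
  induction n, hkn using Nat.le_induction with
  | base => exact h
  | succ n _ ih =>
    obtain ⟨x, hx⟩ := h
    obtain ⟨y, -, hy⟩ := hconn.exists_adj_dist_eq_of_dist_eq_succ hx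
    exact ih ⟨y, hy⟩

theorem Walk.dist_getVert_of_length_eq_dist {u v : V} {P : G.Walk u v}
    (hP : P.length = G.dist u v) {i : ℕ} (hi : i ≤ P.length) : G.dist u (P.getVert i) = i := by
  have h₁ := dist_le (P.take i)
  have h₂ := dist_le (P.drop i)
  have h₃ := (P.take i).reachable.dist_triangle_left v
  rw [Walk.take_length] at h₁
  rw [Walk.drop_length] at h₂
  omega

/-- A shortest walk is induced. -/
theorem Walk.mk_mem_edges_of_length_eq_dist {u v : V} {P : G.Walk u v}
    (hP : P.length = G.dist u v) {x y : V} (hx : x ∈ P.support) (hy : y ∈ P.support)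
    (hxy : G.Adj x y) : s(x, y) ∈ P.edges := by
  obtain ⟨i, rfl, hi⟩ := Walk.mem_support_iff_exists_getVert.1 hx
  obtain ⟨j, rfl, hj⟩ := Walk.mem_support_iff_exists_getVert.1 hy
  have hdi := dist_getVert_of_length_eq_dist hP hi
  have hdj := dist_getVert_of_length_eq_dist hP hj
  have hij : i ≠ j := by
    rintro rfl
    exact hxy.ne rfl
  have h₁ := (P.take i).reachable.dist_triangle_left (P.getVert j)
  have h₂ := (P.take j).reachable.dist_triangle_left (P.getVert i)
  rw [dist_eq_one_iff_adj.2 hxy] at h₁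
  rw [dist_eq_one_iff_adj.2 hxy.symm] at h₂
  rw [Walk.mk_mem_edges_iff_exists]
  obtain h | h : j = i + 1 ∨ i = j + 1 := by omega
  · subst h
    exact ⟨i, by omega, rfl⟩
  · subst h
    exact ⟨j, by omega, Sym2.eq_swap⟩

variable [Fintype V] [DecidableEq V] [DecidableRel G.Adj]

/-- In a connected graph of maximum degree at most `d`, at most `d * (d - 1) ^ k` vertices are at
distance `k + 1` from a given vertex. -/
theorem Connected.card_filter_dist_eq_succ_le (hconn : G.Connected) {d : ℕ}
    (hdeg : ∀ v, G.degree v ≤ d) (v : V) (k : ℕ) :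
    (Finset.univ.filter fun x ↦ G.dist v x = k + 1).card ≤ d * (d - 1) ^ k := by
  induction k with
  | zero =>
    have hsub : (Finset.univ.filter fun x ↦ G.dist v x = 0 + 1) ⊆ G.neighborFinset v :=
      fun x hx ↦ by simpa using hx
    rw [pow_zero, mul_one]
    exact (Finset.card_le_card hsub).trans (hdeg v)
  | succ k ih =>
    set S := Finset.univ.filter fun x ↦ G.dist v x = k + 1
    let f : V → Finset V := fun y ↦ (G.neighborFinset y).filter fun x ↦ G.dist v x = k + 1 + 1
    have hsub : (Finset.univ.filter fun x ↦ G.dist v x = k + 1 + 1) ⊆ S.biUnion f := by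
      intro x hx
      rw [Finset.mem_filter_univ] at hx
      obtain ⟨y, hxy, hy⟩ := hconn.exists_adj_dist_eq_of_dist_eq_succ hx
      simp only [Finset.mem_biUnion]
      exact ⟨y, by simpa [S] using hy, by simpa [f, hx] using hxy.symm⟩
    have hf : ∀ y ∈ S, (f y).card ≤ d - 1 := by
      intro y hy
      have hvy : G.dist v y = k + 1 := (Finset.mem_filter.1 hy).2
      obtain ⟨z, hyz, hz⟩ := hconn.exists_adj_dist_eq_of_dist_eq_succ hvy
      have hfz : f y ⊆ (G.neighborFinset y).erase z := by
        intro x hx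
        obtain ⟨hx₁, hx₂⟩ := Finset.mem_filter.1 hx
        refine Finset.mem_erase.2 ⟨?_, hx₁⟩
        rintro rfl
        omega
      refine (Finset.card_le_card hfz).trans ?_
      rw [Finset.card_erase_of_mem (by simpa using hyz), card_neighborFinset_eq_degree]
      exact Nat.sub_le_sub_right (hdeg y) 1
    calc _ ≤ (S.biUnion f).card := Finset.card_le_card hsub
      _ ≤ S.card * (d - 1) := Finset.card_biUnion_le_card_mul _ _ _ hf
      _ ≤ d * (d - 1) ^ k * (d - 1) := Nat.mul_le_mul_right _ ih
      _ = d * (d - 1) ^ (k + 1) := by ring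

/-- The Moore bound, for the eccentricity of a single vertex. -/
theorem Connected.card_le_of_forall_dist_le (hconn : G.Connected) {d p : ℕ}
    (hdeg : ∀ v, G.degree v ≤ d) {v : V} (hv : ∀ x, G.dist v x ≤ p) :
    Fintype.card V ≤ 1 + ∑ k ∈ Finset.range p, d * (d - 1) ^ k := by
  have hmaps : ∀ x ∈ (Finset.univ : Finset V), G.dist v x ∈ Finset.range (p + 1) :=
    fun x _ ↦ Finset.mem_range.2 (Nat.lt_succ_of_le (hv x))
  rw [← Finset.card_univ, Finset.card_eq_sum_card_fiberwise hmaps, Finset.sum_range_succ',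
    add_comm]
  refine add_le_add ?_
    (Finset.sum_le_sum fun k _ ↦ hconn.card_filter_dist_eq_succ_le hdeg v k)
  simp [hconn.dist_eq_zero_iff, Finset.filter_eq]

end SimpleGraph

theorem stmt_5 {V : Type} [Fintype V] [DecidableEq V] (G : SimpleGraph V) [DecidableRel G.Adj]
    (d p : ℕ) (hd : 1 ≤ d) (hp : 1 ≤ p)
    (hconn : G.Connected)
    (hcard : 1 + ∑ k ∈ Finset.range p, d * (d - 1) ^ k < Fintype.card V) :
    (∃ v : V, d < G.degree v) ∨
      ∀ v : V, ∃ (u : V) (P : G.Walk v u), P.IsPath ∧ P.length = p + 1 ∧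
        ∀ x y : V, x ∈ P.support → y ∈ P.support → G.Adj x y → s(x, y) ∈ P.edges := by
  refine or_iff_not_imp_left.2 fun hdeg v ↦ ?_
  push Not at hdeg
  obtain ⟨x, hx⟩ : ∃ x, p + 1 ≤ G.dist v x := by
    by_contra! h
    exact hcard.not_ge
      (hconn.card_le_of_forall_dist_le hdeg fun x ↦ Nat.le_of_lt_succ (h x))
  obtain ⟨u, hu⟩ := hconn.exists_dist_eq_of_le hx ⟨x, rfl⟩
  obtain ⟨P, hP, hlen⟩ := hconn.exists_path_of_dist v u
  exact ⟨u, P, hP, hlen.trans hu, fun _ _ ↦ Walk.mk_mem_edges_of_length_eq_dist hlen⟩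
end

section
/- Let d, t ≥ 2 be integers and let T be a tree (a connected acyclic simple graph) with at least d^t leaves. Then either T has a vertex of degree greater than d, or T contains a subdivision of comb_t; explicitly, there exist a path X in T, t distinct vertices x₁, …, x_t on X, and t pairwise vertex-disjoint paths Q₁, …, Q_t in T, each of length at least 1, such that for each i the path Q_i meets X in exactly one vertex, namely its endpoint x_i. -/
open SimpleGraph

namespace SimpleGraph

variable {V : Type*} {G : SimpleGraph V}

lemma IsAcyclic.support_subset_of_isPath (hG : G.IsAcyclic) {a b u v : V} {X : G.Walk a b}
    (hX : X.IsPath) (hu : u ∈ X.support) (hv : v ∈ X.support) {q : G.Walk u v}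
    (hq : q.IsPath) : q.support ⊆ X.support := by
  classical
  have hmem : v ∈ (X.takeUntil u hu).support ∨ v ∈ (X.dropUntil u hu).support := by
    rwa [← Walk.mem_support_append_iff, X.take_spec hu]
  rcases hmem with h | h
  · have hp := ((hX.takeUntil hu).dropUntil h).reverse
    have := congrArg Subtype.val ((hG.subsingleton_path u v).elim ⟨q, hq⟩ ⟨_, hp⟩)
    simp only at this
    subst this
    intro z hz
    rw [Walk.support_reverse, List.mem_reverse] at hz
    exact Walk.support_takeUntil_subset_support _ _ (Walk.support_dropUntil_subset_support _ _ hz)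
  · have hp := (hX.dropUntil hu).takeUntil h
    have := congrArg Subtype.val ((hG.subsingleton_path u v).elim ⟨q, hq⟩ ⟨_, hp⟩)
    simp only at this
    subst this
    intro z hz
    exact Walk.support_dropUntil_subset_support _ _ (Walk.support_takeUntil_subset_support _ _ hz)

/-- Two vertices of a path in a forest have no common neighbour outside the path. -/
lemma IsAcyclic.mem_support_of_adj_of_adj (hG : G.IsAcyclic) {a b u v y : V} {X : G.Walk a b}
    (hX : X.IsPath) (hu : u ∈ X.support) (hv : v ∈ X.support) (huv : u ≠ v)
    (huy : G.Adj u y) (hvy : G.Adj v y) : y ∈ X.support := by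
  have hq : (Walk.cons huy (Walk.cons hvy.symm Walk.nil)).IsPath := by
    simp [Walk.cons_isPath_iff, huy.ne, hvy.ne.symm, huv]
  exact hG.support_subset_of_isPath hX hu hv hq (by simp)

lemma IsAcyclic.exists_adj_notMem_support (hG : G.IsAcyclic) {a b x : V} {X : G.Walk a b}
    (hX : X.IsPath) (hx : x ∈ X.support) [Fintype (G.neighborSet x)] (hdeg : 3 ≤ G.degree x) :
    ∃ y, G.Adj x y ∧ y ∉ X.support := by
  classical
  by_contra! hcon
  have hsub : G.neighborFinset x ⊆
      {(X.takeUntil x hx).reverse.snd, (X.dropUntil x hx).snd} := by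
    intro y hy
    rw [mem_neighborFinset] at hy
    have hmem : y ∈ (X.takeUntil x hx).support ∨ y ∈ (X.dropUntil x hx).support := by
      rw [← Walk.mem_support_append_iff, X.take_spec hx]
      exact hcon y hy
    rw [Finset.mem_insert, Finset.mem_singleton]
    refine hmem.imp (fun h ↦ ?_) fun h ↦ ?_
    · exact hG.eq_snd_of_adj_start (hX.takeUntil hx).reverse hy (by simpa using h)
    · exact hG.eq_snd_of_adj_start (hX.dropUntil hx) hy h
  have := (Finset.card_le_card hsub).trans Finset.card_le_two
  rw [card_neighborFinset_eq_degree] at this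
  omega

open Classical in
/-- The leaves that can be reached by extending the path `p`. -/
noncomputable def leavesBeyond [Fintype V] [DecidableRel G.Adj] {r v : V} (p : G.Walk r v) :
    Finset V :=
  {w | G.degree w = 1 ∧ ∃ q : G.Walk v w, (p.append q).IsPath}

lemma mem_leavesBeyond [Fintype V] [DecidableRel G.Adj] {r v w : V} {p : G.Walk r v} :
    w ∈ leavesBeyond p ↔ G.degree w = 1 ∧ ∃ q : G.Walk v w, (p.append q).IsPath := by
  simp [leavesBeyond]

lemma eq_or_mem_leavesBeyond_concat [Fintype V] [DecidableRel G.Adj] {r v w : V} {p : G.Walk r v}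
    (hw : w ∈ leavesBeyond p) :
    w = v ∨ ∃ (c : V) (h : G.Adj v c), c ∉ p.support ∧ w ∈ leavesBeyond (p.concat h) := by
  obtain ⟨hdeg, q, hq⟩ := mem_leavesBeyond.1 hw
  cases q with
  | nil => exact .inl rfl
  | @cons _ c _ h q =>
    rw [← Walk.concat_append] at hq
    have hc := (Walk.concat_isPath_iff h).1 hq.of_append_left
    exact .inr ⟨c, h, hc.2, mem_leavesBeyond.2 ⟨hdeg, q, hq⟩⟩

/-- If more than `d ^ k` leaves lie beyond a path in a graph of maximum degree at most `d`, then
the path extends by a walk through at least `k + 1` branching vertices. -/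
lemma exists_append_isPath_of_pow_lt_card [Fintype V] [DecidableEq V] [DecidableRel G.Adj] {d : ℕ}
    (hd : ∀ v, G.degree v ≤ d) (n : ℕ) {r u v : V} (p : G.Walk r u) (huv : G.Adj u v) (k : ℕ)
    (hp : (p.concat huv).IsPath) (hn : Fintype.card V ≤ p.length + n)
    (hk : d ^ k < (leavesBeyond (p.concat huv)).card) :
    ∃ (w : V) (q : G.Walk v w), ((p.concat huv).append q).IsPath ∧
      k + 1 ≤ {x ∈ q.support.toFinset | 3 ≤ G.degree x}.card := by
  induction n generalizing u v k with
  | zero =>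
    have := hp.length_lt
    rw [Walk.length_concat] at this
    omega
  | succ n ih =>
    have hpos : 0 < d := (hd v).trans_lt' ((G.degree_pos_iff_exists_adj v).2 ⟨u, huv.symm⟩)
    have hpow : 1 ≤ d ^ k := Nat.one_le_pow _ _ hpos
    have hlen (c : V) : Fintype.card V ≤ (p.concat huv).length + n := by
      rw [Walk.length_concat]; omega
    have hpc {c : V} (h : G.Adj v c)
        (hpos : 0 < (leavesBeyond ((p.concat huv).concat h)).card) :
        ((p.concat huv).concat h).IsPath := by
      obtain ⟨w, hw⟩ := Finset.card_pos.1 hpos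
      obtain ⟨-, q, hq⟩ := mem_leavesBeyond.1 hw
      exact hq.of_append_left
    have hstep {w : V} (hw : w ∈ leavesBeyond (p.concat huv)) (hwv : w ≠ v) :
        ∃ (c : V) (h : G.Adj v c), c ≠ u ∧ w ∈ leavesBeyond ((p.concat huv).concat h) := by
      obtain ⟨c, h, hc, hwc⟩ := (eq_or_mem_leavesBeyond_concat hw).resolve_left hwv
      refine ⟨c, h, ?_, hwc⟩
      rintro rfl
      simp [Walk.support_concat] at hc
    by_cases hdeg : 3 ≤ G.degree v
    · cases k with
      | zero => exact ⟨v, .nil, by simpa using hp, by simp [Finset.filter_singleton, hdeg]⟩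
      | succ k =>
        obtain ⟨c, h, hc⟩ : ∃ (c : V) (h : G.Adj v c),
            d ^ k < (leavesBeyond ((p.concat huv).concat h)).card := by
          by_contra! hcon
          have hsub : leavesBeyond (p.concat huv) ⊆ (G.neighborFinset v).attach.biUnion fun c ↦
              leavesBeyond ((p.concat huv).concat ((G.mem_neighborFinset v c).1 c.2)) := by
            intro w hw
            have hwv : w ≠ v := by
              rintro rfl
              have := (mem_leavesBeyond.1 hw).1
              omega
            obtain ⟨c, h, -, hwc⟩ := hstep hw hwv
            exact Finset.mem_biUnion.2
              ⟨⟨c, (G.mem_neighborFinset v c).2 h⟩, Finset.mem_attach _ _, hwc⟩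
          have h1 := (Finset.card_le_card hsub).trans
            (Finset.card_biUnion_le_card_mul _ _ (d ^ k) fun c _ ↦ hcon _ _)
          rw [Finset.card_attach, card_neighborFinset_eq_degree] at h1
          have h2 := Nat.mul_le_mul_right (d ^ k) (hd v)
          rw [pow_succ'] at hk
          omega
        obtain ⟨w, q, hq, hcard⟩ := ih (p.concat huv) h k (hpc h (by omega)) (hlen c) hc
        rw [Walk.concat_append] at hq
        refine ⟨w, .cons h q, hq, ?_⟩
        have hv : v ∉ q.support := ((Walk.cons_isPath_iff h q).1 hq.of_append_right).2
        rw [Walk.support_cons, List.toFinset_cons, Finset.filter_insert, if_pos hdeg,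
          Finset.card_insert_of_notMem (by simp [hv])]
        omega
    · obtain ⟨w, hw, hwv⟩ := Finset.exists_mem_ne (hpow.trans_lt hk) v
      obtain ⟨c, h, hcu, hwc⟩ := hstep hw hwv
      have hN : G.neighborFinset v = {u, c} := by
        symm
        refine Finset.eq_of_subset_of_card_le ?_ ?_
        · simp [Finset.insert_subset_iff, huv.symm, h]
        · rw [card_neighborFinset_eq_degree, Finset.card_pair hcu.symm]
          omega
      have hv2 : G.degree v = 2 := by
        rw [← card_neighborFinset_eq_degree, hN, Finset.card_pair hcu.symm]
      have hsub : leavesBeyond (p.concat huv) ⊆ leavesBeyond ((p.concat huv).concat h) := by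
        intro z hz
        have hzv : z ≠ v := by
          rintro rfl
          have := (mem_leavesBeyond.1 hz).1
          omega
        obtain ⟨c', h', hc'u, hzc⟩ := hstep hz hzv
        have hc' : c' ∈ G.neighborFinset v := (G.mem_neighborFinset v c').2 h'
        rw [hN, Finset.mem_insert, Finset.mem_singleton] at hc'
        obtain rfl := hc'.resolve_left hc'u
        exact hzc
      have hc := hk.trans_le (Finset.card_le_card hsub)
      obtain ⟨w, q, hq, hcard⟩ := ih (p.concat huv) h k (hpc h (by omega)) (hlen c) hc
      rw [Walk.concat_append] at hq
      refine ⟨w, .cons h q, hq, hcard.trans (Finset.card_le_card ?_)⟩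
      refine Finset.filter_subset_filter _ fun z hz ↦ ?_
      simp_all

/-- A tree of maximum degree at most `d` with at least `d ^ t` leaves has a path through at least
`t` branching vertices. -/
lemma IsTree.exists_isPath_of_pow_le_card [Fintype V] [DecidableEq V] [DecidableRel G.Adj]
    (hG : G.IsTree) {d t : ℕ} (h2 : 2 ≤ d) (ht : 2 ≤ t) (hd : ∀ v, G.degree v ≤ d)
    (hleaves : d ^ t ≤ {v : V | G.degree v = 1}.ncard) :
    ∃ (a b : V) (X : G.Walk a b), X.IsPath ∧
      t ≤ {x ∈ X.support.toFinset | 3 ≤ G.degree x}.card := by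
  obtain ⟨k, rfl⟩ : ∃ k, t = k + 1 := ⟨t - 1, by omega⟩
  have hset : {v : V | G.degree v = 1} = ({v | G.degree v = 1} : Finset V) := by simp
  rw [hset, Set.ncard_coe_finset] at hleaves
  have hpow : 2 ≤ d ^ k := h2.trans (Nat.le_self_pow (by omega) d)
  have hmul : 2 * d ^ k ≤ d ^ (k + 1) := by
    rw [pow_succ']
    exact Nat.mul_le_mul_right _ h2
  obtain ⟨r, hr⟩ := Finset.card_pos.1
    (show 0 < ({v | G.degree v = 1} : Finset V).card by omega)
  have hr1 : G.degree r = 1 := by simpa using hr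
  obtain ⟨c, hc⟩ := Finset.card_eq_one.1 ((G.card_neighborFinset_eq_degree r).trans hr1)
  have hrc : G.Adj r c := by
    rw [← mem_neighborFinset, hc, Finset.mem_singleton]
  have hsub : ({v | G.degree v = 1} : Finset V).erase r ⊆
      leavesBeyond ((Walk.nil : G.Walk r r).concat hrc) := by
    intro w hw
    rw [Finset.mem_erase, Finset.mem_filter_univ] at hw
    obtain ⟨q, hq⟩ := hG.connected.exists_isPath r w
    have hw' : w ∈ leavesBeyond (Walk.nil : G.Walk r r) := mem_leavesBeyond.2 ⟨hw.2, q, hq⟩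
    obtain ⟨c', h, -, hwc⟩ := (eq_or_mem_leavesBeyond_concat hw').resolve_left hw.1
    obtain rfl : c' = c := by
      rwa [← mem_neighborFinset, hc, Finset.mem_singleton] at h
    exact hwc
  have hcard := Finset.card_le_card hsub
  rw [Finset.card_erase_of_mem hr] at hcard
  obtain ⟨w, q, hq, hq'⟩ := exists_append_isPath_of_pow_lt_card hd (Fintype.card V) Walk.nil hrc k
    (by simp [Walk.concat, hrc.ne]) (by simp) (by omega)
  exact ⟨c, w, q, hq.of_append_right, hq'⟩

end SimpleGraph

theorem stmt_7 {V : Type} [Fintype V] [DecidableEq V] (T : SimpleGraph V) [DecidableRel T.Adj]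
    (d t : ℕ) (hd : 2 ≤ d) (ht : 2 ≤ t)
    (htree : T.IsTree)
    (hleaves : d ^ t ≤ {v : V | T.degree v = 1}.ncard) :
    (∃ v : V, d < T.degree v) ∨
      -- a subdivision of comb_t: a spine path X with t distinct attachment vertices
      -- x i on it, and t pairwise vertex-disjoint legs Q i of length ≥ 1, each meeting
      -- X exactly in its endpoint x i
      ∃ (a b : V) (X : T.Walk a b), X.IsPath ∧
        ∃ (x y : Fin t → V) (Q : ∀ i : Fin t, T.Walk (x i) (y i)),
          Function.Injective x ∧
          (∀ i : Fin t, x i ∈ X.support) ∧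
          (∀ i : Fin t, (Q i).IsPath ∧ 1 ≤ (Q i).length) ∧
          (∀ i j : Fin t, i ≠ j → ∀ z : V, z ∈ (Q i).support → z ∉ (Q j).support) ∧
          (∀ (i : Fin t) (z : V), z ∈ (Q i).support → z ∈ X.support → z = x i) := by
  refine or_iff_not_imp_left.2 fun hdeg ↦ ?_
  push Not at hdeg
  obtain ⟨a, b, X, hX, hcard⟩ := htree.exists_isPath_of_pow_le_card hd ht hdeg hleaves
  obtain ⟨s, hs, hst⟩ := Finset.exists_subset_card_eq hcard
  let e := (s.equivFinOfCardEq hst).symm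
  have hx (i : Fin t) : (e i : V) ∈ X.support ∧ 3 ≤ T.degree (e i) := by
    simpa using hs (e i).2
  have hinj : Function.Injective fun i ↦ (e i : V) := Subtype.val_injective.comp e.injective
  choose y hy hyX using fun i ↦
    htree.isAcyclic.exists_adj_notMem_support hX (hx i).1 (hx i).2
  refine ⟨a, b, X, hX, fun i ↦ e i, y, fun i ↦ (hy i).toWalk, hinj, fun i ↦ (hx i).1,
    fun i ↦ ⟨by simp [(hy i).ne], by simp⟩, fun i j hij z hzi hzj ↦ ?_, fun i z hz hzX ↦ ?_⟩
  · have hne := hinj.ne hij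
    simp only [Walk.support_cons, Walk.support_nil, List.mem_cons, List.not_mem_nil,
      or_false] at hzi hzj
    rcases hzi with rfl | rfl <;> rcases hzj with h | h
    · exact hne h
    · exact hyX j (h ▸ (hx i).1)
    · exact hyX i (h ▸ (hx j).1)
    · exact hyX i (htree.isAcyclic.mem_support_of_adj_of_adj hX (hx i).1 (hx j).1 hne (hy i)
        (h ▸ hy j))
  · simp only [Walk.support_cons, Walk.support_nil, List.mem_cons, List.not_mem_nil,
      or_false] at hz
    exact hz.resolve_right fun h ↦ hyX i (h ▸ hzX)
end

section
/- Let G be a simple graph, let H be a subgraph of G with at least 3 vertices, and let P be an H-path in G with endpoints x and y. Assume that there is no vertex set Z ⊆ V(G) with |Z| ≤ 2 such that some connected component of G − Z contains no vertex of H. Let H₀ be the union of P and all (H ∪ P)-bridges of G that are P-local. Then H₀ contains an x–y path Q such that no (H ∪ Q)-bridge of G is Q-local. -/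
open SimpleGraph

/-- `D` is (the vertex set of) a connected component of the subgraph of `G` induced
on the vertex set `W`. -/
def IsCompOf {V : Type} (G : SimpleGraph V) (W : Set V) (D : Set V) : Prop :=
  ∃ c : (G.induce W).ConnectedComponent, D = Subtype.val '' c.supp

/-- No `K`-bridge of `G` has all of its feet in `J`.  A `K`-bridge is either a trivial
bridge (a single edge of `G` not in `K` with both endpoints in `K`, whose feet are its
two endpoints) or the bridge arising from a connected component `D` of `G - V(K)`
(whose feet are the vertices of `K` adjacent to `D`). -/
def NoLocalBridge {V : Type} {G : SimpleGraph V} (K : G.Subgraph) (J : Set V) : Prop :=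
  (∀ u v : V, G.Adj u v → s(u, v) ∉ K.edgeSet → u ∈ K.verts → v ∈ K.verts →
      ¬ (u ∈ J ∧ v ∈ J)) ∧
  (∀ D : Set V, IsCompOf G K.vertsᶜ D →
      ¬ (∀ v ∈ K.verts, (∃ u ∈ D, G.Adj u v) → v ∈ J))

/-- `e` is an edge of some `K`-bridge of `G` all of whose feet lie in `J`. -/
def LocalBridgeEdge {V : Type} {G : SimpleGraph V} (K : G.Subgraph) (J : Set V)
    (e : Sym2 V) : Prop :=
  (∃ u v : V, e = s(u, v) ∧ G.Adj u v ∧ e ∉ K.edgeSet ∧ u ∈ K.verts ∧ v ∈ K.verts ∧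
      u ∈ J ∧ v ∈ J) ∨
  (∃ D : Set V, IsCompOf G K.vertsᶜ D ∧ (∀ v ∈ K.verts, (∃ u ∈ D, G.Adj u v) → v ∈ J) ∧
      ∃ u v : V, e = s(u, v) ∧ G.Adj u v ∧ (u ∈ D ∨ v ∈ D))

/-- `Escapes G A S u` says that some walk of `G` from `u` to a vertex of `A` avoids `S`. -/
inductive Escapes {V : Type} (G : SimpleGraph V) (A S : Set V) : V → Prop
  | base {h : V} : h ∈ A → h ∉ S → Escapes G A S h
  | step {u v : V} : G.Adj u v → u ∉ S → Escapes G A S v → Escapes G A S u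

namespace Escapes

variable {V : Type} {G : SimpleGraph V} {A S T : Set V} {u : V}

lemma notMem (h : Escapes G A S u) : u ∉ S := by
  cases h <;> assumption

lemma of_disjoint (hT : ∀ t ∈ T, ¬ Escapes G A S t) (h : Escapes G A S u) :
    Escapes G A T u := by
  induction h with
  | base hA hS => exact .base hA fun ht => hT _ ht (.base hA hS)
  | step hadj hS hv ih => exact .step hadj (fun ht => hT _ ht (.step hadj hS hv)) ih

end Escapes

/-- Some walk of `G` from `u` to `v` uses no edge of `H` and stays inside `B`. -/
def WalkJoined {V : Type} {G : SimpleGraph V} (H : G.Subgraph) (B : Set V) (u v : V) : Prop :=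
  ∃ R : G.Walk u v, (∀ e ∈ R.edges, e ∉ H.edgeSet) ∧ ∀ t ∈ R.support, t ∈ B

namespace WalkJoined

variable {V : Type} {G : SimpleGraph V} {H : G.Subgraph} {B C : Set V} {u v w : V}

lemma refl (h : u ∈ B) : WalkJoined H B u u := ⟨.nil, by simp, by simpa⟩

lemma symm (h : WalkJoined H B u v) : WalkJoined H B v u := by
  obtain ⟨R, h1, h2⟩ := h
  exact ⟨R.reverse, by simpa using h1, by simpa using h2⟩

lemma trans (h : WalkJoined H B u v) (h' : WalkJoined H B v w) : WalkJoined H B u w := by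
  obtain ⟨R, h1, h2⟩ := h
  obtain ⟨R', h1', h2'⟩ := h'
  refine ⟨R.append R', fun e he => ?_, fun t ht => ?_⟩
  · rw [Walk.edges_append, List.mem_append] at he
    exact he.elim (h1 e) (h1' e)
  · rw [Walk.mem_support_append_iff] at ht
    exact ht.elim (h2 t) (h2' t)

lemma mono (hBC : B ⊆ C) (h : WalkJoined H B u v) : WalkJoined H C u v := by
  obtain ⟨R, h1, h2⟩ := h
  exact ⟨R, h1, fun t ht => hBC (h2 t ht)⟩

lemma right_mem (h : WalkJoined H B u v) : v ∈ B := by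
  obtain ⟨R, -, h2⟩ := h
  exact h2 v R.end_mem_support

lemma of_adj (h : G.Adj u v) (he : s(u, v) ∉ H.edgeSet) (hu : u ∈ B) (hv : v ∈ B) :
    WalkJoined H B u v :=
  ⟨h.toWalk, by simpa using he, by simp [hu, hv]⟩

lemma of_getVert {x y : V} (Q : G.Walk x y) (hQ : ∀ e ∈ Q.edges, e ∉ H.edgeSet) {i j : ℕ}
    (hij : i ≤ j) (hj : j ≤ Q.length) (hB : ∀ k, i ≤ k → k ≤ j → Q.getVert k ∈ B) :
    WalkJoined H B (Q.getVert i) (Q.getVert j) := by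
  induction j, hij using Nat.le_induction with
  | base => exact .refl (hB i le_rfl le_rfl)
  | succ j hij ih =>
    refine (ih (by omega) fun k h1 h2 => hB k h1 (by omega)).trans
      (of_adj (Q.adj_getVert_succ (by omega)) (hQ _ ?_) (hB j hij (by omega))
        (hB (j + 1) (by omega) le_rfl))
    exact Q.mem_edges_toSubgraph.1 (Q.toSubgraph_adj_getVert (by omega))

end WalkJoined

lemma SimpleGraph.Subgraph.notMem_edgeSet_of_left {V : Type} {G : SimpleGraph V}
    (H : G.Subgraph) {u v : V} (hu : u ∉ H.verts) : s(u, v) ∉ H.edgeSet :=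
  fun h => hu (H.edge_vert (H.mem_edgeSet.1 h))

namespace IsCompOf

variable {V : Type} {G : SimpleGraph V} {W D S : Set V} {u v : V}

lemma exists_of_mem (G : SimpleGraph V) (hu : u ∈ W) : ∃ D, IsCompOf G W D ∧ u ∈ D :=
  ⟨_, ⟨(G.induce W).connectedComponentMk ⟨u, hu⟩, rfl⟩, ⟨u, hu⟩, rfl, rfl⟩

lemma nonempty (h : IsCompOf G W D) : D.Nonempty := by
  obtain ⟨c, rfl⟩ := h
  exact c.nonempty_supp.image _

lemma subset (h : IsCompOf G W D) : D ⊆ W := by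
  obtain ⟨c, rfl⟩ := h
  rintro _ ⟨t, -, rfl⟩
  exact t.2

lemma mem_of_adj (h : IsCompOf G W D) (hu : u ∈ D) (hv : v ∈ W) (huv : G.Adj u v) :
    v ∈ D := by
  obtain ⟨c, rfl⟩ := h
  obtain ⟨t, ht, rfl⟩ := hu
  refine ⟨⟨v, hv⟩, ?_, rfl⟩
  have hadj : (G.induce W).Adj t ⟨v, hv⟩ := huv
  rw [ConnectedComponent.mem_supp_iff] at ht ⊢
  rw [← ht]
  exact ConnectedComponent.sound hadj.reachable.symm

lemma subset_of_closed (h : IsCompOf G W D) (hu : u ∈ D) (huS : u ∈ S)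
    (hS : ∀ t ∈ S, t ∈ W → ∀ t' ∈ W, G.Adj t t' → t' ∈ S) : D ⊆ S := by
  obtain ⟨c, rfl⟩ := h
  obtain ⟨a, ha, rfl⟩ := hu
  rintro _ ⟨b, hb, rfl⟩
  rw [ConnectedComponent.mem_supp_iff] at ha hb
  obtain ⟨R⟩ := ConnectedComponent.exact (ha.trans hb.symm)
  clear ha hb
  induction R with
  | nil => exact huS
  | @cons a b c hab _ ih => exact ih (hS _ huS a.2 _ b.2 hab)

lemma walkJoined (h : IsCompOf G W D) {H : G.Subgraph} (hDH : ∀ t ∈ D, t ∉ H.verts)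
    (hu : u ∈ D) (hv : v ∈ D) : WalkJoined H D u v := by
  refine h.subset_of_closed (S := {t | WalkJoined H D u t}) hu (.refl hu) ?_ hv
  intro t ht _ t' ht' hadj
  have htD : t ∈ D := WalkJoined.right_mem ht
  exact WalkJoined.trans ht
    (.of_adj hadj (H.notMem_edgeSet_of_left (hDH t htD)) htD (h.mem_of_adj htD ht' hadj))

/-- A component of `G - V(K)` whose feet all lie in `J` cannot escape to `A ⊆ V(K)`
without meeting `J`. -/
lemma not_escapes {A J : Set V} (h : IsCompOf G Wᶜ D) (hA : A ⊆ W)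
    (hfeet : ∀ v ∈ W, (∃ u ∈ D, G.Adj u v) → v ∈ J) (hu : u ∈ D) : ¬ Escapes G A J u := by
  intro he
  induction he with
  | base hA' _ => exact h.subset hu (hA hA')
  | @step u v hadj _ hv ih =>
    refine ih (h.mem_of_adj hu (fun hvW => ?_) hadj)
    exact hv.notMem (hfeet v hvW ⟨u, hu, hadj⟩)

end IsCompOf

lemma false_of_closed_of_not_separated {V : Type} {G : SimpleGraph V} {A Z S : Set V}
    (hnosep : ∀ Z : Set V, Z.ncard ≤ 2 → ∀ D : Set V, IsCompOf G Zᶜ D → (D ∩ A).Nonempty)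
    (hZ : Z.ncard ≤ 2) (hS : S.Nonempty) (hSZ : ∀ t ∈ S, t ∉ Z) (hSA : ∀ t ∈ S, t ∉ A)
    (hcl : ∀ t ∈ S, ∀ t', t' ∉ Z → G.Adj t t' → t' ∈ S) : False := by
  obtain ⟨u, hu⟩ := hS
  obtain ⟨D, hD, huD⟩ := IsCompOf.exists_of_mem G (W := Zᶜ) (hSZ u hu)
  obtain ⟨h, hhD, hhA⟩ := hnosep Z hZ D hD
  exact hSA h (hD.subset_of_closed huD hu (fun t ht _ t' ht' => hcl t ht t' ht') hhD) hhA

section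

variable {V : Type} {G : SimpleGraph V} {H : G.Subgraph} {x y : V}

/-- An edge outside `H` whose endpoints do not escape to `H` from `P` belongs to `P` or to a
`P`-local bridge. -/
lemma mem_edges_or_localBridgeEdge (P : G.Walk x y) {e : Sym2 V} (he : e ∈ G.edgeSet)
    (heH : e ∉ H.edgeSet)
    (hesc : ∀ t ∈ e, ¬ Escapes G H.verts {z | z ∈ P.support} t) :
    e ∈ P.edges ∨ LocalBridgeEdge (H ⊔ P.toSubgraph) {z : V | z ∈ P.support} e := by
  by_cases heP : e ∈ P.edges
  · exact .inl heP
  right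
  by_cases hall : ∀ t ∈ e, t ∈ P.support
  · left
    induction e with | _ u v
    have hu := hall u (by simp)
    have hv := hall v (by simp)
    refine ⟨u, v, rfl, he, ?_, .inr (by simpa using hu), .inr (by simpa using hv), hu, hv⟩
    rw [Subgraph.edgeSet_sup]
    rintro (h | h)
    · exact heH h
    · exact heP (P.mem_edges_toSubgraph.1 h)
  · right
    push Not at hall
    obtain ⟨u, hue, huP⟩ := hall
    obtain ⟨v, rfl⟩ := hue
    have hu := hesc u (by simp)
    have huW : u ∈ (H ⊔ P.toSubgraph).vertsᶜ := by
      rintro (h | h)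
      · exact hu (.base h huP)
      · exact huP (by simpa using h)
    obtain ⟨D, hD, huD⟩ := IsCompOf.exists_of_mem G huW
    refine ⟨D, hD, ?_, u, v, rfl, he, .inl huD⟩
    have hW : ∀ t ∈ (H ⊔ P.toSubgraph).vertsᶜ, t ∉ {z | z ∈ P.support} :=
      fun t ht htP => ht (.inr (by simpa using htP))
    have hDM := hD.subset_of_closed (S := {t | ¬ Escapes G H.verts {z | z ∈ P.support} t})
      huD hu fun t ht htW t' _ hadj h => ht (.step hadj (hW t htW) h)
    rintro w hw ⟨t, htD, hadj⟩
    by_contra hwP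
    rcases hw with hw | hw
    · exact hDM htD (.step hadj (hW t (hD.subset htD)) (.base hw hwP))
    · exact hwP (by simpa using hw)

/-- Among the `x`–`y` paths inside the union of `P` and its local bridges, one whose set of
escaping vertices is maximal: each of its vertices with an escaping neighbour separates `x`
from `y` among the non-escaping vertices. -/
lemma exists_path_of_maximal_escapes [Finite V] (P : G.Walk x y) (hP : P.IsPath)
    (hPe : ∀ e ∈ P.edges, e ∉ H.edgeSet) :
    ∃ Q : G.Walk x y, Q.IsPath ∧ (∀ e ∈ Q.edges, e ∉ H.edgeSet) ∧
      (∀ t ∈ Q.support, ¬ Escapes G H.verts {z | z ∈ P.support} t) ∧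
      ∀ v ∈ Q.support, ∀ m, G.Adj v m → Escapes G H.verts {z | z ∈ Q.support} m →
        ¬ WalkJoined H {t | ¬ Escapes G H.verts {z | z ∈ Q.support} t ∧ t ≠ v} x y := by
  classical
  let esc : G.Walk x y → Set V := fun Q => {t | Escapes G H.verts {z | z ∈ Q.support} t}
  obtain ⟨_, ⟨Q, ⟨hQ, hQe, hQP⟩, rfl⟩, hmax⟩ := (Set.toFinite (esc ''
    {Q | Q.IsPath ∧ (∀ e ∈ Q.edges, e ∉ H.edgeSet) ∧ ∀ t ∈ Q.support, t ∉ esc P})).exists_maximal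
    ⟨_, P, ⟨hP, hPe, fun t ht h => Escapes.notMem h ht⟩, rfl⟩
  refine ⟨Q, hQ, hQe, hQP, ?_⟩
  rintro v hv m hadj hm ⟨R, hRe, hR⟩
  have hPQ : esc P ⊆ esc Q := fun t ht => Escapes.of_disjoint hQP ht
  have hb : ∀ t ∈ R.bypass.support, ¬ Escapes G H.verts {z | z ∈ Q.support} t ∧ t ≠ v :=
    fun t ht => hR t (R.support_bypass_subset_support ht)
  have hQR : esc Q ⊆ esc R.bypass := fun t ht => Escapes.of_disjoint (fun t ht => (hb t ht).1) ht
  have hRQ : esc R.bypass ⊆ esc Q := hmax ⟨R.bypass, ⟨R.bypass_isPath,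
    fun e he => hRe e (R.edges_bypass_subset_edges he), fun t ht h => (hb t ht).1 (hPQ h)⟩, rfl⟩ hQR
  have hvR : v ∈ esc R.bypass := Escapes.step hadj (fun h => (hb v h).2 rfl) (hQR hm)
  exact Escapes.notMem (hRQ hvR) hv

/-- If the hypothesis on separations holds, every vertex of a path as in
`exists_path_of_maximal_escapes` separates `x` from `y` among the non-escaping vertices. -/
lemma not_walkJoined_of_maximal_escapes
    (hnosep : ∀ Z : Set V, Z.ncard ≤ 2 → ∀ D : Set V, IsCompOf G Zᶜ D →
      (D ∩ H.verts).Nonempty)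
    (Q : G.Walk x y) (hQe : ∀ e ∈ Q.edges, e ∉ H.edgeSet)
    (hQH : ∀ z ∈ Q.support, z ≠ x → z ≠ y → z ∉ H.verts)
    (hQ : Q.IsPath)
    (hmax : ∀ v ∈ Q.support, ∀ m, G.Adj v m → Escapes G H.verts {z | z ∈ Q.support} m →
        ¬ WalkJoined H {t | ¬ Escapes G H.verts {z | z ∈ Q.support} t ∧ t ≠ v} x y) :
    ∀ k, ¬ WalkJoined H
      {t | ¬ Escapes G H.verts {z | z ∈ Q.support} t ∧ t ≠ Q.getVert k} x y := by
  intro p hp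
  set M : Set V := {t | Escapes G H.verts {z | z ∈ Q.support} t}
  let Inn : ℕ → Prop := fun k => WalkJoined H {t | t ∉ M ∧ t ≠ Q.getVert k} x y
  change Inn p at hp
  have hQM : ∀ k, Q.getVert k ∉ M := fun k h => Escapes.notMem h (Q.getVert_mem_support k)
  have hlow : ∀ p, Inn p → ∃ a < p, ¬ Inn a ∧ ∀ k, a < k → k ≤ p → Inn k := by
    intro p
    induction p with
    | zero =>
      rintro h
      exact absurd (Q.getVert_zero).symm h.symm.right_mem.2
    | succ p ih =>
      intro h
      by_cases hp : Inn p
      · obtain ⟨a, hap, ha, hk⟩ := ih hp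
        refine ⟨a, by omega, ha, fun k h1 h2 => ?_⟩
        rcases Nat.lt_or_ge p k with h3 | h3
        · rwa [show k = p + 1 by omega]
        · exact hk k h1 h3
      · refine ⟨p, by omega, hp, fun k h1 h2 => ?_⟩
        rwa [show k = p + 1 by omega]
  have hend : ∀ k, Q.length ≤ k → ¬ Inn k := fun k hk h =>
    h.right_mem.2 (Q.getVert_of_length_le hk).symm
  obtain ⟨a, hap, ha, hak⟩ := hlow p hp
  have hpl : p < Q.length := not_le.1 fun h => hend p h hp
  obtain ⟨b, hpb, hbl, hb, hbk⟩ :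
      ∃ b, p < b ∧ b ≤ Q.length ∧ ¬ Inn b ∧ ∀ k, p ≤ k → k < b → Inn k := by
    classical
    have hex : ∃ b, p < b ∧ ¬ Inn b := ⟨Q.length, hpl, hend _ le_rfl⟩
    refine ⟨Nat.find hex, (Nat.find_spec hex).1, Nat.find_min' hex ⟨hpl, hend _ le_rfl⟩,
      (Nat.find_spec hex).2, fun k h1 h2 => ?_⟩
    rcases h1.eq_or_lt with rfl | h1
    · exact hp
    · by_contra h
      exact Nat.find_min hex h2 ⟨h1, h⟩
  have hinj : ∀ i j, i ≤ Q.length → j ≤ Q.length → i ≠ j → Q.getVert i ≠ Q.getVert j :=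
    fun i j hi hj hij h => hij (hQ.getVert_injOn hi hj h)
  let S : Set V :=
    {t | WalkJoined H {t | t ∉ M ∧ t ≠ Q.getVert a ∧ t ≠ Q.getVert b} (Q.getVert p) t}
  have hSQ : ∀ k ≤ Q.length, Q.getVert k ∈ S → a < k ∧ k < b := by
    intro k hk hkS
    have hne := hkS.right_mem.2
    have hka : k ≠ a := fun h => hne.1 (by rw [h])
    have hkb : k ≠ b := fun h => hne.2 (by rw [h])
    constructor
    · by_contra hlt
      apply ha
      have h1 : WalkJoined H {t | t ∉ M ∧ t ≠ Q.getVert a} (Q.getVert 0) (Q.getVert k) :=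
        .of_getVert Q hQe (by omega) hk
          fun i _ _ => ⟨hQM i, hinj _ _ (by omega) (by omega) (by omega)⟩
      have h2 : WalkJoined H {t | t ∉ M ∧ t ≠ Q.getVert a} (Q.getVert p) (Q.getVert Q.length) :=
        .of_getVert Q hQe (by omega) le_rfl
          fun i _ _ => ⟨hQM i, hinj _ _ (by omega) (by omega) (by omega)⟩
      have h3 : WalkJoined H {t | t ∉ M ∧ t ≠ Q.getVert a} (Q.getVert p) (Q.getVert k) :=
        WalkJoined.mono (fun t ht => ⟨ht.1, ht.2.1⟩) hkS
      have h4 := (h1.trans h3.symm).trans h2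
      simpa using h4
    · by_contra hlt
      apply hb
      have h1 : WalkJoined H {t | t ∉ M ∧ t ≠ Q.getVert b} (Q.getVert 0) (Q.getVert p) :=
        .of_getVert Q hQe (by omega) hpl.le
          fun i _ _ => ⟨hQM i, hinj _ _ (by omega) (by omega) (by omega)⟩
      have h2 : WalkJoined H {t | t ∉ M ∧ t ≠ Q.getVert b} (Q.getVert k) (Q.getVert Q.length) :=
        .of_getVert Q hQe (by omega) le_rfl
          fun i _ _ => ⟨hQM i, hinj _ _ (by omega) (by omega) (by omega)⟩
      have h3 : WalkJoined H {t | t ∉ M ∧ t ≠ Q.getVert b} (Q.getVert p) (Q.getVert k) :=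
        WalkJoined.mono (fun t ht => ⟨ht.1, ht.2.2⟩) hkS
      have h4 := (h1.trans h3).trans h2
      simpa using h4
  have hSH : ∀ t ∈ S, t ∉ H.verts := by
    intro t ht htH
    by_cases htQ : t ∈ Q.support
    · obtain ⟨k, rfl, hk⟩ := Walk.mem_support_iff_exists_getVert.1 htQ
      obtain ⟨h1, h2⟩ := hSQ k hk ht
      refine hQH _ htQ (fun h => ?_) (fun h => ?_) htH
      · exact hinj k 0 hk (by omega) (by omega) (by simpa using h)
      · exact hinj k Q.length hk le_rfl (by omega) (by simpa using h)
    · exact ht.right_mem.1 (.base htH htQ)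
  refine false_of_closed_of_not_separated hnosep (Z := {Q.getVert a, Q.getVert b}) (S := S)
    ((Set.ncard_insert_le _ _).trans (by simp)) ⟨Q.getVert p, .refl ⟨hQM p, ?_, ?_⟩⟩ ?_ hSH ?_
  · exact hinj _ _ (by omega) (by omega) (by omega)
  · exact hinj _ _ (by omega) (by omega) (by omega)
  · rintro t ht (h | h)
    · exact ht.right_mem.2.1 h
    · exact ht.right_mem.2.2 h
  · intro t ht t' ht' hadj
    have htM : t ∉ M := ht.right_mem.1
    have ht'M : t' ∉ M := by
      intro hm
      by_cases htQ : t ∈ Q.support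
      · obtain ⟨k, rfl, hk⟩ := Walk.mem_support_iff_exists_getVert.1 htQ
        obtain ⟨h1, h2⟩ := hSQ k hk ht
        refine hmax _ htQ t' hadj hm ?_
        rcases le_total k p with h | h
        · exact hak k h1 h
        · exact hbk k h h2
      · exact htM (Escapes.step hadj htQ hm)
    exact WalkJoined.trans ht (.of_adj hadj (H.notMem_edgeSet_of_left (hSH t ht)) ht.right_mem
      ⟨ht'M, fun h => ht' (.inl h), fun h => ht' (.inr h)⟩)

/-- If every vertex of `Q` separates `x` from `y` among the non-escaping vertices, then
non-escaping connections that leave `Q` only join vertices at distance at most one on `Q`. -/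
lemma le_succ_of_walkJoined (Q : G.Walk x y) (hQ : Q.IsPath)
    (hQe : ∀ e ∈ Q.edges, e ∉ H.edgeSet)
    (hcut : ∀ k, ¬ WalkJoined H
      {t | ¬ Escapes G H.verts {z | z ∈ Q.support} t ∧ t ≠ Q.getVert k} x y)
    {B : Set V} (hB : ∀ t ∈ B, ¬ Escapes G H.verts {z | z ∈ Q.support} t)
    {i j : ℕ} (hj : j ≤ Q.length)
    (hBQ : ∀ t ∈ B, t ∈ Q.support → t = Q.getVert i ∨ t = Q.getVert j)
    (h : WalkJoined H B (Q.getVert i) (Q.getVert j)) : j ≤ i + 1 := by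
  by_contra! hij
  apply hcut (i + 1)
  have hinj : ∀ i j, i ≤ Q.length → j ≤ Q.length → i ≠ j → Q.getVert i ≠ Q.getVert j :=
    fun i j hi hj hij h => hij (hQ.getVert_injOn hi hj h)
  have hQM : ∀ k, ¬ Escapes G H.verts {z | z ∈ Q.support} (Q.getVert k) :=
    fun k h => h.notMem (Q.getVert_mem_support k)
  have h1 : WalkJoined H {t | ¬ Escapes G H.verts {z | z ∈ Q.support} t ∧ t ≠ Q.getVert (i + 1)}
      (Q.getVert 0) (Q.getVert i) :=
    .of_getVert Q hQe (by omega) (by omega)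
      fun k _ _ => ⟨hQM k, hinj _ _ (by omega) (by omega) (by omega)⟩
  have h2 : WalkJoined H {t | ¬ Escapes G H.verts {z | z ∈ Q.support} t ∧ t ≠ Q.getVert (i + 1)}
      (Q.getVert j) (Q.getVert Q.length) :=
    .of_getVert Q hQe hj le_rfl
      fun k _ _ => ⟨hQM k, hinj _ _ (by omega) (by omega) (by omega)⟩
  have h3 := (h1.trans (h.mono fun t ht => ⟨hB t ht, fun hti => ?_⟩)).trans h2
  · simpa using h3
  · rcases hBQ t ht (hti ▸ Q.getVert_mem_support _) with h' | h'
    · exact hinj i (i + 1) (by omega) (by omega) (by omega) (h'.symm.trans hti)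
    · exact hinj j (i + 1) (by omega) (by omega) (by omega) (h'.symm.trans hti)

lemma noLocalBridge_of_not_walkJoined
    (hnosep : ∀ Z : Set V, Z.ncard ≤ 2 → ∀ D : Set V, IsCompOf G Zᶜ D →
      (D ∩ H.verts).Nonempty)
    (Q : G.Walk x y) (hQ : Q.IsPath) (hQe : ∀ e ∈ Q.edges, e ∉ H.edgeSet)
    (hcut : ∀ k, ¬ WalkJoined H
      {t | ¬ Escapes G H.verts {z | z ∈ Q.support} t ∧ t ≠ Q.getVert k} x y) :
    NoLocalBridge (H ⊔ Q.toSubgraph) {z : V | z ∈ Q.support} := by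
  constructor
  · rintro u v hadj he - - ⟨hu, hv⟩
    obtain ⟨i, rfl, hi⟩ := Walk.mem_support_iff_exists_getVert.1 hu
    obtain ⟨j, rfl, hj⟩ := Walk.mem_support_iff_exists_getVert.1 hv
    rw [Subgraph.edgeSet_sup, Set.mem_union, not_or] at he
    have key : WalkJoined H {Q.getVert i, Q.getVert j} (Q.getVert i) (Q.getVert j) :=
      .of_adj hadj he.1 (by simp) (by simp)
    have hB : ∀ t ∈ ({Q.getVert i, Q.getVert j} : Set V),
        ¬ Escapes G H.verts {z | z ∈ Q.support} t := by
      rintro t (rfl | rfl) h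
      · exact h.notMem hu
      · exact h.notMem hv
    have h1 := le_succ_of_walkJoined Q hQ hQe hcut hB hj (fun t ht _ => ht) key
    have h2 := le_succ_of_walkJoined Q hQ hQe hcut hB hi (fun t ht _ => ht.symm) key.symm
    obtain h | h | h : i = j ∨ j = i + 1 ∨ i = j + 1 := by omega
    · exact hadj.ne (by rw [h])
    · subst h
      exact he.2 (Q.toSubgraph_adj_getVert (by omega))
    · subst h
      exact he.2 (Q.toSubgraph_adj_getVert (by omega)).symm
  · intro D hD hfeet
    have hDH : ∀ t ∈ D, t ∉ H.verts := fun t ht h => hD.subset ht (.inl h)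
    have hDQ : ∀ t ∈ D, t ∉ Q.support := fun t ht h => hD.subset ht (.inr (by simpa using h))
    have hDM : ∀ t ∈ D, ¬ Escapes G H.verts {z | z ∈ Q.support} t :=
      fun t ht => hD.not_escapes (A := H.verts) (fun _ h => .inl h) hfeet ht
    obtain ⟨i, hi⟩ : ∃ i, ∀ j ≤ Q.length, (∃ u ∈ D, G.Adj u (Q.getVert j)) →
        j = i ∨ j = i + 1 := by
      classical
      by_cases hex : ∃ i, i ≤ Q.length ∧ ∃ u ∈ D, G.Adj u (Q.getVert i)
      · refine ⟨Nat.find hex, fun j hj hju => ?_⟩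
        have hmin := Nat.find_min' hex ⟨hj, hju⟩
        obtain ⟨hil, u, hu, hui⟩ := Nat.find_spec hex
        obtain ⟨w, hw, hwj⟩ := hju
        generalize Nat.find hex = i at *
        let B : Set V := {t | t ∈ D ∨ t = Q.getVert i ∨ t = Q.getVert j}
        have hB : ∀ t ∈ B, ¬ Escapes G H.verts {z | z ∈ Q.support} t := by
          rintro t (h | rfl | rfl) h'
          · exact hDM t h h'
          · exact h'.notMem (Q.getVert_mem_support _)
          · exact h'.notMem (Q.getVert_mem_support _)
        have h1 : WalkJoined H B u (Q.getVert i) :=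
          .of_adj hui (H.notMem_edgeSet_of_left (hDH u hu)) (.inl hu) (.inr (.inl rfl))
        have h2 : WalkJoined H B w (Q.getVert j) :=
          .of_adj hwj (H.notMem_edgeSet_of_left (hDH w hw)) (.inl hw) (.inr (.inr rfl))
        have h3 : WalkJoined H B u w := (hD.walkJoined hDH hu hw).mono fun t ht => .inl ht
        have h4 := le_succ_of_walkJoined Q hQ hQe hcut hB hj
          (fun t ht htQ => ht.resolve_left fun h => hDQ t h htQ) ((h1.symm.trans h3).trans h2)
        omega
      · exact ⟨0, fun j hj hju => absurd ⟨j, hj, hju⟩ hex⟩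
    refine false_of_closed_of_not_separated hnosep
      (Z := {Q.getVert i, Q.getVert (i + 1)}) ((Set.ncard_insert_le _ _).trans (by simp))
      hD.nonempty ?_ hDH ?_
    · rintro t ht (rfl | rfl)
      · exact hDQ _ ht (Q.getVert_mem_support _)
      · exact hDQ _ ht (Q.getVert_mem_support _)
    · intro t ht t' ht' hadj
      by_contra ht'D
      refine ht'D (hD.mem_of_adj ht (fun hK => ht' ?_) hadj)
      obtain ⟨j, rfl, hj⟩ := Walk.mem_support_iff_exists_getVert.1 (hfeet t' hK ⟨t, ht, hadj⟩)
      rcases hi j hj ⟨t, ht, hadj⟩ with rfl | rfl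
      · exact .inl rfl
      · exact .inr rfl

end

theorem stmt_8 {V : Type} [Fintype V] [DecidableEq V] (G : SimpleGraph V)
    (H : G.Subgraph) (hH : 3 ≤ H.verts.ncard)
    (x y : V) (hxy : x ≠ y) (P : G.Walk x y) (hP : P.IsPath)
    -- P is an H-path: its endpoints are in H, its other vertices are not,
    -- and none of its edges lies in H
    (hx : x ∈ H.verts) (hy : y ∈ H.verts)
    (hint : ∀ z ∈ P.support, z ≠ x → z ≠ y → z ∉ H.verts)
    (hPe : ∀ e ∈ P.edges, e ∉ H.edgeSet)
    -- there is no Z ⊆ V(G) with |Z| ≤ 2 such that some component of G − Z avoids H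
    (hnosep : ∀ Z : Set V, Z.ncard ≤ 2 → ∀ D : Set V, IsCompOf G Zᶜ D →
      (D ∩ H.verts).Nonempty) :
    ∃ Q : G.Walk x y, Q.IsPath ∧
      -- Q lies in H₀, the union of P and all P-local (H ∪ P)-bridges
      (∀ e ∈ Q.edges, e ∈ P.edges ∨
        LocalBridgeEdge (H ⊔ P.toSubgraph) {z : V | z ∈ P.support} e) ∧
      -- no (H ∪ Q)-bridge is Q-local
      NoLocalBridge (H ⊔ Q.toSubgraph) {z : V | z ∈ Q.support} := by
  obtain ⟨Q, hQ, hQe, hQP, hmax⟩ := exists_path_of_maximal_escapes P hP hPe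
  have hQH : ∀ z ∈ Q.support, z ≠ x → z ≠ y → z ∉ H.verts := by
    intro z hz hzx hzy hzH
    by_cases hzP : z ∈ P.support
    · exact hint z hzP hzx hzy hzH
    · exact hQP z hz (.base hzH hzP)
  refine ⟨Q, hQ, fun e he => ?_, noLocalBridge_of_not_walkJoined hnosep Q hQ hQe
    (not_walkJoined_of_maximal_escapes hnosep Q hQe hQH hQ hmax)⟩
  exact mem_edges_or_localBridgeEdge P (Q.edges_subset_edgeSet he) (hQe e he)
    fun t ht => hQP t (Q.mem_support_of_mem_edges he ht)
end

section
/- Let t ≥ 2 be an integer, let G be a 2-connected simple graph, and let C be a cycle of G of maximum length with |C| ≥ 2t. If some vertex of G does not lie on C, then G contains θ_{2,2,t}. -/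
open SimpleGraph

/-- A cycle through two distinct vertices splits into two internally disjoint paths. -/
theorem SimpleGraph.Walk.IsCycle.exists_two_paths {V : Type} {G : SimpleGraph V} {a b : V}
    {C : G.Walk a a} (hC : C.IsCycle) (hb : b ∈ C.support) (hab : a ≠ b) :
    ∃ A B : G.Walk a b, A.IsPath ∧ B.IsPath ∧ InternallyDisjoint A B ∧
      A.length + B.length = C.length ∧ A.support ⊆ C.support ∧ B.support ⊆ C.support := by
  classical
  have hspec := C.take_spec hb
  set p := C.takeUntil b hb
  set q := C.dropUntil b hb
  rw [← hspec] at hC ⊢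
  refine ⟨p, q.reverse, hC.isPath_of_append_left (Walk.not_nil_of_ne hab.symm),
    (hC.isPath_of_append_right (Walk.not_nil_of_ne hab)).reverse, ?_, by simp,
    fun x hx => by simp [Walk.mem_support_append_iff, hx],
    fun x hx => by
      rw [Walk.support_reverse, List.mem_reverse] at hx
      simp [Walk.mem_support_append_iff, hx]⟩
  intro x hp hq
  rw [Walk.support_reverse, List.mem_reverse] at hq
  have hnd := hC.support_nodup
  rw [Walk.tail_support_append, List.nodup_append'] at hnd
  rw [Walk.mem_support_iff] at hp hq
  rcases hp with rfl | hp
  · exact Or.inl rfl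
  rcases hq with rfl | hq
  · exact Or.inr rfl
  exact (hnd.2.2 hp hq).elim

/-- The concatenation of two paths meeting only at the common endpoint is a path. -/
theorem SimpleGraph.Walk.IsPath.append_of_inter_s9 {V : Type} {G : SimpleGraph V} {u v w : V}
    {p : G.Walk u v} {q : G.Walk v w} (hp : p.IsPath) (hq : q.IsPath)
    (h : ∀ x ∈ p.support, x ∈ q.support → x = v) : (p.append q).IsPath := by
  rw [Walk.isPath_def, Walk.support_append, List.nodup_append']
  have hq' := hq.support_nodup
  rw [← Walk.cons_tail_support, List.nodup_cons] at hq'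
  refine ⟨hp.support_nodup, hq'.2, fun x hx hxq => ?_⟩
  obtain rfl := h x hx (List.mem_of_mem_tail hxq)
  exact hq'.1 hxq

/-- A walk ending in `S` contains a path that stops at its first vertex in `S`. -/
theorem SimpleGraph.Walk.exists_isPath_to_first {V : Type} {G : SimpleGraph V} (S : Set V)
    {u v : V} (p : G.Walk u v) (hv : v ∈ S) :
    ∃ b ∈ S, ∃ q : G.Walk u b, q.IsPath ∧ q.support ⊆ p.support ∧
      ∀ x ∈ q.support, x ∈ S → x = b := by
  classical
  suffices ∃ b ∈ S, ∃ q : G.Walk u b, q.support ⊆ p.support ∧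
      ∀ x ∈ q.support, x ∈ S → x = b by
    obtain ⟨b, hb, q, hqp, hq⟩ := this
    exact ⟨b, hb, q.bypass, q.bypass_isPath,
      fun x hx => hqp (q.support_bypass_subset_support hx),
      fun x hx => hq x (q.support_bypass_subset_support hx)⟩
  induction p with
  | nil => exact ⟨_, hv, .nil, by simp, by simp⟩
  | @cons u w v h p ih =>
    by_cases hu : u ∈ S
    · exact ⟨u, hu, .nil, by simp, by simp⟩
    obtain ⟨b, hb, q, hqp, hq⟩ := ih hv
    refine ⟨b, hb, .cons h q, ?_, ?_⟩
    · exact List.cons_subset_cons _ hqp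
    · intro x hx hxS
      rw [Walk.support_cons, List.mem_cons] at hx
      rcases hx with rfl | hx
      · exact (hu hxS).elim
      · exact hq x hx hxS

/-- A proper vertex set with at least two elements in a 2-connected graph has an ear: a path of length at least
two with distinct ends in the set and all other vertices outside. -/
theorem TwoConnected.exists_ear {V : Type} [Fintype V] {G : SimpleGraph V}
    (h2c : TwoConnected G) {S : Set V} (hS : S.Nontrivial) {v : V} (hv : v ∉ S) :
    ∃ a ∈ S, ∃ b ∈ S, a ≠ b ∧ ∃ (w : V) (h : G.Adj a w) (q : G.Walk w b),
      w ∉ S ∧ (Walk.cons h q).IsPath ∧ ∀ x ∈ q.support, x ∈ S → x = b := by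
  obtain ⟨s, hs⟩ := hS.nonempty
  obtain ⟨p⟩ := h2c.1.preconnected s v
  obtain ⟨⟨⟨a, w⟩, h⟩, -, ha, hw⟩ := p.exists_boundary_dart S hs hv
  obtain ⟨c, hc, hca⟩ := hS.exists_ne a
  have hwa : w ≠ a := fun e => hw (e ▸ ha)
  obtain ⟨p'⟩ := (h2c.2.2 a).preconnected ⟨w, hwa⟩ ⟨c, hca⟩
  obtain ⟨b, hb, q, hq, hqp, hqS⟩ :=
    (p'.map (Embedding.induce _).toHom).exists_isPath_to_first S hc
  have haq : a ∉ q.support := fun haq => by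
    obtain ⟨y, -, hy⟩ := List.mem_map.1 ((Walk.support_map _ _) ▸ hqp haq)
    exact y.2 hy
  exact ⟨a, ha, b, hb, fun e => haq (e ▸ q.end_mem_support), w, h, q, hw,
    Walk.cons_isPath_iff _ _ |>.2 ⟨hq, haq⟩, hqS⟩

theorem stmt_9 {V : Type} [Fintype V] (G : SimpleGraph V)
    (t : ℕ) (ht : 2 ≤ t) (h2c : TwoConnected G)
    (r : V) (C : G.Walk r r) (hC : C.IsCycle)
    (hmax : ∀ (r' : V) (C' : G.Walk r' r'), C'.IsCycle → C'.length ≤ C.length)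
    (hlen : 2 * t ≤ C.length)
    (hout : ∃ v : V, v ∉ C.support) :
    ContainsTheta G 2 2 t := by
  classical
  obtain ⟨v, hv⟩ := hout
  have hS : {x | x ∈ C.support}.Nontrivial :=
    ⟨r, C.start_mem_support, C.snd, C.getVert_mem_support 1, (C.adj_snd hC.not_nil).ne⟩
  obtain ⟨a, ha, b, hb, hab, w, h, q, hw, hE, hqS⟩ := h2c.exists_ear hS hv
  simp only [Set.mem_ofPred_eq] at ha hb hw hqS
  have hrot : ∀ x, x ∈ (C.rotate a ha).support ↔ x ∈ C.support := fun x =>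
    Walk.mem_support_rotate_iff ..
  obtain ⟨A, B, hA, hB, hAB, hsum, hAC, hBC⟩ :=
    (hC.rotate ha).exists_two_paths ((hrot b).2 hb) hab
  rw [Walk.length_rotate] at hsum
  have hdisj : ∀ D : G.Walk a b, D.support ⊆ (C.rotate a ha).support →
      InternallyDisjoint (Walk.cons h q) D := by
    intro D hDC x hx hxD
    rw [Walk.support_cons, List.mem_cons] at hx
    exact hx.imp_right fun hx => hqS x hx ((hrot x).1 (hDC hxD))
  have hqlen : 1 ≤ q.length := by
    rw [Nat.one_le_iff_ne_zero]
    intro h0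
    exact hw (Walk.eq_of_length_eq_zero h0 ▸ hb)
  have hcycle : ∀ D : G.Walk a b, D.IsPath → D.support ⊆ (C.rotate a ha).support →
      D.length + 2 ≤ C.length := by
    intro D hD hDC
    have hcyc : (Walk.cons h (q.append D.reverse)).IsCycle := by
      rw [Walk.cons_isCycle_iff]
      refine ⟨((Walk.cons_isPath_iff _ _).1 hE).1.append_of_inter_s9 hD.reverse ?_, ?_⟩
      · intro x hx hxD
        rw [Walk.support_reverse, List.mem_reverse] at hxD
        exact hqS x hx ((hrot x).1 (hDC hxD))
      · rw [Walk.edges_append, List.mem_append, Walk.edges_reverse, List.mem_reverse]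
        rintro (he | he)
        · exact ((Walk.cons_isPath_iff _ _).1 hE).2 (Walk.fst_mem_support_of_mem_edges _ he)
        · exact hw ((hrot w).1 (hDC (Walk.snd_mem_support_of_mem_edges _ he)))
    have := hmax _ _ hcyc
    simp only [Walk.length_cons, Walk.length_append, Walk.length_reverse] at this
    omega
  have hA' := hcycle A hA hAC
  have hB' := hcycle B hB hBC
  have hE2 : 2 ≤ (Walk.cons h q).length := by rw [Walk.length_cons]; omega
  rcases le_total A.length B.length with hle | hle
  · exact ⟨a, b, hab, _, A, B, hE, hA, hB, hE2, by omega, by omega,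
      hdisj A hAC, hdisj B hBC, hAB⟩
  · exact ⟨a, b, hab, _, B, A, hE, hB, hA, hE2, by omega, by omega,
      hdisj B hBC, hdisj A hAC, fun x hxB hxA => hAB x hxA hxB⟩
end

section
/- Let t ≥ 2 be an integer and let G be a simple graph on at least 4t vertices having a Hamiltonian cycle C. If there exist four distinct vertices u, x, v, y occurring in this cyclic order along C with uv ∈ E(G) and xy ∈ E(G), then G contains θ_{2,2,t}. -/
open SimpleGraph

/-- The segment from `i` to `i + d` of a walk `f` through distinct vertices is a path. -/
lemma exists_isPath_of_adj_succ {V : Type} {G : SimpleGraph V} {f : ℕ → V}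
    (hadj : ∀ i, G.Adj (f i) (f (i + 1))) (i d : ℕ)
    (hinj : ∀ a b, i ≤ a → a < b → b ≤ i + d → f a ≠ f b) :
    ∃ w : G.Walk (f i) (f (i + d)), w.IsPath ∧ w.length = d ∧
      ∀ x ∈ w.support, ∃ k, i ≤ k ∧ k ≤ i + d ∧ x = f k := by
  induction d with
  | zero => exact ⟨.nil, by simp, rfl, fun x hx => ⟨i, by simpa using hx⟩⟩
  | succ d ih =>
    obtain ⟨w, hw, hl, hs⟩ := ih fun a b h₁ h₂ h₃ => hinj a b h₁ h₂ (by omega)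
    refine ⟨w.concat (hadj (i + d)), hw.concat (fun h => ?_) _, by simp [hl], fun x hx => ?_⟩
    · obtain ⟨k, h₁, h₂, h₃⟩ := hs _ h
      exact hinj k (i + d + 1) h₁ (by omega) (by omega) h₃.symm
    · rw [Walk.support_concat, List.mem_append, List.mem_singleton] at hx
      rcases hx with hx | rfl
      · obtain ⟨k, h₁, h₂, h₃⟩ := hs x hx
        exact ⟨k, h₁, by omega, h₃⟩
      · exact ⟨i + d + 1, by omega, by omega, rfl⟩

/-- Two crossing chords of a cycle `f` of length `n` whose first arc has length at least `t`
yield a `θ_{2,2,t}` between the ends of that arc. -/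
lemma containsTheta_of_crossing_of_le {V : Type} {G : SimpleGraph V} {f : ℕ → V} {n : ℕ}
    (hadj : ∀ i, G.Adj (f i) (f (i + 1))) (hper : ∀ i, f (i + n) = f i)
    (hinj : ∀ a b, a < b → b < a + n → f a ≠ f b) {t p q r s : ℕ}
    (hpq : p < q) (hqr : q < r) (hrs : r < s) (hsp : s < p + n)
    (hpr : G.Adj (f p) (f r)) (hqs : G.Adj (f q) (f s)) (ht : p + t ≤ q) :
    ContainsTheta G 2 2 t := by
  have arc : ∀ i j, i ≤ j → j < i + n → ∃ w : G.Walk (f i) (f j), w.IsPath ∧ w.length = j - i ∧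
      ∀ x ∈ w.support, ∃ k, i ≤ k ∧ k ≤ j ∧ x = f k := by
    intro i j hij hj
    obtain ⟨d, rfl⟩ := Nat.exists_eq_add_of_le hij
    simpa using exists_isPath_of_adj_succ hadj i d
      fun a b h₁ h₂ h₃ => hinj a b h₂ (by omega)
  have inj : ∀ a b, a < b + n → b < a + n → f a = f b → a = b := by
    intro a b h₁ h₂ h
    by_contra hne
    rcases Nat.lt_or_gt_of_ne hne with h' | h'
    · exact hinj a b h' h₂ h
    · exact hinj b a h' h₁ h.symm
  obtain ⟨A, hA, hAl, hAs⟩ := arc p q (by omega) (by omega)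
  obtain ⟨B, hB, hBl, hBs⟩ := arc q r (by omega) (by omega)
  obtain ⟨D, hD, hDl, hDs⟩ : ∃ w : G.Walk (f s) (f p), w.IsPath ∧ w.length = p + n - s ∧
      ∀ x ∈ w.support, ∃ k, s ≤ k ∧ k ≤ p + n ∧ x = f k :=
    hper p ▸ arc s (p + n) (by omega) (by omega)
  refine ⟨f p, f q, hinj p q hpq (by omega), .cons hpr B.reverse, (Walk.cons hqs D).reverse, A,
    ?_, ?_, hA, ?_, ?_, by omega, ?_, ?_, ?_⟩
  · refine hB.reverse.cons fun h => ?_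
    obtain ⟨k, h₁, h₂, h₃⟩ := hBs _ (by simpa using h)
    have := inj p k (by omega) (by omega) h₃
    omega
  · refine (hD.cons fun h => ?_).reverse
    obtain ⟨k, h₁, h₂, h₃⟩ := hDs _ h
    have := inj q k (by omega) (by omega) h₃
    omega
  · simp only [Walk.length_cons, Walk.length_reverse]
    omega
  · simp only [Walk.length_cons, Walk.length_reverse]
    omega
  all_goals
    intro x hx hy
    simp only [Walk.support_cons, Walk.support_reverse, List.mem_cons, List.mem_reverse] at hx hy
  · rcases hx with rfl | hx
    · exact .inl rfl
    rcases hy with rfl | hy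
    · exact .inr rfl
    obtain ⟨k, h₁, h₂, rfl⟩ := hBs x hx
    obtain ⟨l, h₃, h₄, h⟩ := hDs _ hy
    by_cases hk : k + n ≤ l
    · omega
    have := inj k l (by omega) (by omega) h
    omega
  · rcases hx with rfl | hx
    · exact .inl rfl
    obtain ⟨k, h₁, h₂, rfl⟩ := hBs x hx
    obtain ⟨l, h₃, h₄, h⟩ := hAs _ hy
    have := inj k l (by omega) (by omega) h
    exact .inr (congrArg f (by omega))
  · rcases hx with rfl | hx
    · exact .inr rfl
    obtain ⟨k, h₁, h₂, rfl⟩ := hDs x hx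
    obtain ⟨l, h₃, h₄, h⟩ := hAs _ hy
    by_cases hk : l + n ≤ k
    · exact .inl (by rw [h, show l = p by omega])
    have := inj k l (by omega) (by omega) h
    omega

theorem stmt_10 {V : Type} [Fintype V] (G : SimpleGraph V)
    (t : ℕ) (ht : 2 ≤ t) (hcard : 4 * t ≤ Fintype.card V)
    (r : V) (C : G.Walk r r) (hC : C.IsCycle) (hham : ∀ v : V, v ∈ C.support)
    -- four distinct vertices u, x, v, y in this cyclic order along C (witnessed by
    -- increasing positions along the closed walk) with uv ∈ E(G) and xy ∈ E(G)
    (hcross : ∃ i₁ i₂ i₃ i₄ : ℕ, i₁ < i₂ ∧ i₂ < i₃ ∧ i₃ < i₄ ∧ i₄ < C.length ∧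
      C.getVert i₁ ≠ C.getVert i₂ ∧ C.getVert i₁ ≠ C.getVert i₃ ∧
      C.getVert i₁ ≠ C.getVert i₄ ∧ C.getVert i₂ ≠ C.getVert i₃ ∧
      C.getVert i₂ ≠ C.getVert i₄ ∧ C.getVert i₃ ≠ C.getVert i₄ ∧
      G.Adj (C.getVert i₁) (C.getVert i₃) ∧ G.Adj (C.getVert i₂) (C.getVert i₄)) :
    ContainsTheta G 2 2 t := by
  obtain ⟨i₁, i₂, i₃, i₄, h₁₂, h₂₃, h₃₄, h₄, -, -, -, -, -, -, huv, hxy⟩ := hcross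
  set n := C.length with hn
  have hn0 : 0 < n := by omega
  have hmod : ∀ i ≤ n, C.getVert (i % n) = C.getVert i := by
    intro i hi
    rcases hi.lt_or_eq with hi | rfl
    · rw [Nat.mod_eq_of_lt hi]
    · rw [Nat.mod_self, Walk.getVert_zero, hn, Walk.getVert_length]
  have hcardn : Fintype.card V ≤ n := by
    have hsurj : Function.Surjective fun i : Fin n => C.getVert i := by
      intro v
      obtain ⟨i, rfl, hi⟩ := Walk.mem_support_iff_exists_getVert.1 (hham v)
      exact ⟨⟨i % n, Nat.mod_lt _ hn0⟩, hmod i hi⟩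
    simpa using Fintype.card_le_of_surjective _ hsurj
  let f : ℕ → V := fun i => C.getVert (i % n)
  have hadj : ∀ i, G.Adj (f i) (f (i + 1)) := by
    intro i
    have hlt := Nat.mod_lt i hn0
    have h := C.adj_getVert_succ hlt
    rwa [← hmod (i % n + 1) hlt, Nat.mod_add_mod] at h
  have hper : ∀ i, f (i + n) = f i := fun i => by simp [f]
  have hinj : ∀ a b, a < b → b < a + n → f a ≠ f b := by
    intro a b hab hba h
    have ha := Nat.mod_lt a hn0
    have hb := Nat.mod_lt b hn0
    have hmodeq : a ≡ b [MOD n] := hC.getVert_injOn' (by simp only [Set.mem_ofPred_eq]; omega)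
      (by simp only [Set.mem_ofPred_eq]; omega) h
    have := Nat.le_of_dvd (by omega) ((Nat.modEq_iff_dvd' hab.le).1 hmodeq)
    omega
  have hf : ∀ i ≤ n, f i = C.getVert i := hmod
  rw [← hf i₁ (by omega), ← hf i₃ (by omega)] at huv
  rw [← hf i₂ (by omega), ← hf i₄ (by omega)] at hxy
  have huv' : G.Adj (f i₃) (f (i₁ + n)) := by rw [hper]; exact huv.symm
  have hxy' : G.Adj (f i₄) (f (i₂ + n)) := by rw [hper]; exact hxy.symm
  have huv'' : G.Adj (f (i₁ + n)) (f (i₃ + n)) := by rw [hper, hper]; exact huv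
  have key := @containsTheta_of_crossing_of_le V G f n hadj hper hinj t
  obtain h | h | h | h : i₁ + t ≤ i₂ ∨ i₂ + t ≤ i₃ ∨ i₃ + t ≤ i₄ ∨ i₄ + t ≤ i₁ + n := by omega
  · exact key h₁₂ h₂₃ h₃₄ (by omega) huv hxy h
  · exact key h₂₃ h₃₄ (by omega : i₄ < i₁ + n) (by omega) hxy huv' (by omega)
  · exact key h₃₄ (by omega : i₄ < i₁ + n) (by omega : i₁ + n < i₂ + n) (by omega) huv' hxy' h
  · exact key (by omega : i₄ < i₁ + n) (by omega : i₁ + n < i₂ + n) (by omega : i₂ + n < i₃ + n)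
      (by omega) hxy' huv'' h
end

section
/- Let G be a 2-connected simple graph and let a, b, d be three distinct vertices with e = ab ∈ E(G) and f = ad ∈ E(G). Suppose the degree of a in G is at least 3, and suppose that no 2-element subset Z of V(G) separates e from f. Then G contains an ef-theta. -/
open SimpleGraph

namespace SimpleGraph.Walk

variable {V : Type*} {G : SimpleGraph V}

/-- A walk ending in `S` can be shortened to a path that meets `S` only at its last vertex. -/
theorem exists_isPath_first_mem {u w : V} (p : G.Walk u w) (S : Set V) (hw : w ∈ S) :
    ∃ v ∈ S, ∃ q : G.Walk u v, q.IsPath ∧ q.support ⊆ p.support ∧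
      ∀ x ∈ q.support, x ∈ S → x = v := by
  classical
  suffices h : ∃ v ∈ S, ∃ q : G.Walk u v, q.support ⊆ p.support ∧
      ∀ x ∈ q.support, x ∈ S → x = v by
    obtain ⟨v, hv, q, hqp, hq⟩ := h
    exact ⟨v, hv, q.bypass, q.bypass_isPath, fun x hx => hqp (q.support_bypass_subset_support hx),
      fun x hx => hq x (q.support_bypass_subset_support hx)⟩
  induction p with
  | nil => exact ⟨_, hw, nil, by simp, by simp⟩
  | @cons u u' w h p ih =>
    by_cases hu : u ∈ S
    · exact ⟨u, hu, nil, by simp, by simp⟩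
    · obtain ⟨v, hv, q, hqp, hq⟩ := ih hw
      refine ⟨v, hv, cons h q, ?_, ?_⟩
      · exact List.cons_subset_cons u hqp
      · intro x hx hxS
        rw [support_cons, List.mem_cons] at hx
        rcases hx with rfl | hx
        · exact absurd hxS hu
        · exact hq x hx hxS

/-- The two parts of a path split at `v` share only the vertex `v`. -/
theorem IsPath.eq_of_mem_takeUntil_of_mem_dropUntil [DecidableEq V] {u w v x : V}
    {p : G.Walk u w} (hp : p.IsPath) (hv : v ∈ p.support)
    (hx : x ∈ (p.takeUntil v hv).support) (hx' : x ∈ (p.dropUntil v hv).support) : x = v := by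
  have hnd := hp.support_nodup
  rw [← p.take_spec hv, support_append, List.nodup_append] at hnd
  rw [mem_support_iff] at hx'
  rcases hx' with rfl | hx'
  · rfl
  · exact absurd rfl (hnd.2.2 x hx x hx')

end SimpleGraph.Walk

/-- Vertices reachable from one another in `G.induce S` are joined by a path of `G` inside `S`. -/
theorem SimpleGraph.Reachable.exists_isPath_of_induce {V : Type*} {G : SimpleGraph V} {S : Set V}
    {u v : S} (h : (G.induce S).Reachable u v) :
    ∃ p : G.Walk u v, p.IsPath ∧ ∀ x ∈ p.support, x ∈ S := by
  obtain ⟨p, hp⟩ := h.exists_isPath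
  refine ⟨p.map (Embedding.induce S).toHom, hp.map Subtype.val_injective, ?_⟩
  intro x hx
  obtain ⟨y, -, rfl⟩ := List.mem_map.1 (p.support_map _ ▸ hx)
  exact y.2

theorem stmt_11 {V : Type} [Fintype V] [DecidableEq V] (G : SimpleGraph V) [DecidableRel G.Adj]
    (h2c : TwoConnected G)
    (a b d : V) (hab : a ≠ b) (had : a ≠ d) (hbd : b ≠ d)
    (he : G.Adj a b) (hf : G.Adj a d)
    (hdeg : 3 ≤ G.degree a)
    (hnosep : ∀ Z : Set V, Z.ncard = 2 → ¬ SeparatesEdges G a b a d Z) :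
    ContainsEfTheta G s(a, b) s(a, d) := by
  obtain ⟨c, hc, hcbd⟩ : ∃ c ∈ G.neighborFinset a, c ∉ ({b, d} : Finset V) :=
    Finset.exists_mem_notMem_of_card_lt_card
      (lt_of_le_of_lt Finset.card_le_two (by rw [G.card_neighborFinset_eq_degree]; omega))
  have hac : G.Adj a c := by simpa using hc
  obtain ⟨hcb, hcd⟩ : c ≠ b ∧ c ≠ d := by simpa using hcbd
  obtain ⟨P, hP, hPZ⟩ : ∃ P : G.Walk b d, P.IsPath ∧ ∀ x ∈ P.support, x ∈ ({a, c}ᶜ : Set V) := by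
    have h := hnosep {a, c} (Set.ncard_pair hac.ne)
    have hb : b ∉ ({a, c} : Set V) := by simp [hab.symm, hcb.symm]
    have hd : d ∉ ({a, c} : Set V) := by simp [had.symm, hcd.symm]
    simp only [SeparatesEdges, not_and, not_forall, not_not] at h
    obtain ⟨p, q, ⟨hp, hpZ⟩, ⟨hq, hqZ⟩, hpq⟩ := h ⟨b, by simp, hb⟩ ⟨d, by simp, hd⟩
    obtain rfl : p = ⟨b, hb⟩ := Subtype.ext (by
      rcases hp with hp | hp
      · exact absurd (Or.inl hp) hpZ
      · exact hp)
    obtain rfl : q = ⟨d, hd⟩ := Subtype.ext (by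
      rcases hq with hq | hq
      · exact absurd (Or.inl hq) hqZ
      · exact hq)
    exact hpq.exists_isPath_of_induce
  obtain ⟨R, -, hRa⟩ := ((h2c.2.2 a).preconnected ⟨c, hac.ne'⟩
    ⟨b, hab.symm⟩).exists_isPath_of_induce
  obtain ⟨v, hv, Q, hQ, hQR, hQP⟩ :=
    R.exists_isPath_first_mem {x | x ∈ P.support} P.start_mem_support
  have hv' : v ∈ P.support := hv
  have haP : a ∉ P.support := fun h => hPZ a h (by simp)
  have haQ : a ∉ Q.support := fun h => hRa a (hQR h) rfl
  have hvc : c ≠ v := fun h => hPZ v hv (by simp [h])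
  have hT := P.support_takeUntil_subset_support hv'
  have hD := P.support_dropUntil_subset_support hv'
  refine ⟨a, v, fun h => haP (h ▸ hv'), .cons he (P.takeUntil v hv'),
    .cons hf (P.dropUntil v hv').reverse, .cons hac Q, ?_, ?_, ?_, ?_, ?_, ?_, ?_, ?_, ?_⟩
  · exact (hP.takeUntil hv').cons fun h => haP (hT h)
  · exact (hP.dropUntil hv').reverse.cons fun h => haP (hD (by simpa using h))
  · exact hQ.cons haQ
  · intro x hx hx'
    simp only [Walk.support_cons, List.mem_cons, Walk.support_reverse, List.mem_reverse] at hx hx'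
    rcases hx with hx | hx
    · exact Or.inl hx
    rcases hx' with hx' | hx'
    · exact Or.inl hx'
    exact Or.inr (hP.eq_of_mem_takeUntil_of_mem_dropUntil hv' hx hx')
  · intro x hx hx'
    simp only [Walk.support_cons, List.mem_cons] at hx hx'
    rcases hx with hx | hx
    · exact Or.inl hx
    rcases hx' with hx' | hx'
    · exact Or.inl hx'
    exact Or.inr (hQP x hx' (hT hx))
  · intro x hx hx'
    simp only [Walk.support_cons, List.mem_cons, Walk.support_reverse, List.mem_reverse] at hx hx'
    rcases hx with hx | hx
    · exact Or.inl hx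
    rcases hx' with hx' | hx'
    · exact Or.inl hx'
    exact Or.inr (hQP x hx' (hD hx))
  · simp
  · simp
  · have : Q.length ≠ 0 := fun h => hvc (Walk.eq_of_length_eq_zero h)
    rw [Walk.length_cons]
    omega
end
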